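/- MDS Coherence: the functor G from MDS to Br is faithful; that is, for all arrow terms f, g : A ⊢ B of MDS, if Gf = Gg in Br then f = g in MDS. -/

import Mathlib

/-! ### The category Br of Brauerian split equivalences of finite ordinals

An arrow `m ⊢ n` of `Br` is represented as a relation on `ℕ ⊕ ℕ`, where
`Sum.inl i` (with `i < m`) is the source copy `i_s` and `Sum.inr j`
(with `j < n`) is the target copy `j_t`. -/

abbrev GRel : Type := (ℕ ⊕ ℕ) → (ℕ ⊕ ℕ) → Prop

/-- The identity arrow of `Br` on `n`: transversals `{i_s, i_t}` for `i < n`. -/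
def gId (n : ℕ) : GRel := fun u v =>
  ∃ i, i < n ∧ (u = Sum.inl i ∨ u = Sum.inr i) ∧ (v = Sum.inl i ∨ v = Sum.inr i)

/-- The Brauerian split equivalence whose transversals are `{i_s, (φ i)_t}` for `i < m`. -/
def gFun (m : ℕ) (φ : ℕ → ℕ) : GRel := fun u v =>
  ∃ i, i < m ∧ (u = Sum.inl i ∨ u = Sum.inr (φ i)) ∧ (v = Sum.inl i ∨ v = Sum.inr (φ i))

/-- The block transposition exchanging the first `a` and the last `b` elements. -/
def gSwap (a b : ℕ) : GRel :=
  gFun (a + b) (fun i => if i < a then i + b else i - a)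

/-- `G Δ̂∧_{B,A}` with `a = GA`, `b = GB`: identity transversals on the stem `A`
together with caps joining the two copies of each letter occurrence of `B` in
the crown `¬B ∨ B` of the target. -/
def gDelta (a b : ℕ) : GRel := fun u v =>
  (∃ i, i < a ∧ (u = Sum.inl i ∨ u = Sum.inr i) ∧ (v = Sum.inl i ∨ v = Sum.inr i)) ∨
  (∃ j, j < b ∧ (u = Sum.inr (a + j) ∨ u = Sum.inr (a + b + j)) ∧
                (v = Sum.inr (a + j) ∨ v = Sum.inr (a + b + j)))

/-- `G Σ̂∨_{B,A}` with `a = GA`, `b = GB`: identity transversals on the stem `A`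
together with cups joining the two copies of each letter occurrence of `B` in
the crown `B ∧ ¬B` of the source. -/
def gSigma (a b : ℕ) : GRel := fun u v =>
  (∃ i, i < a ∧ (u = Sum.inl (2*b + i) ∨ u = Sum.inr i) ∧
                (v = Sum.inl (2*b + i) ∨ v = Sum.inr i)) ∨
  (∃ j, j < b ∧ (u = Sum.inl j ∨ u = Sum.inl (b + j)) ∧
                (v = Sum.inl j ∨ v = Sum.inl (b + j)))

/-- Composition `P ∗ R` in `Br`: glue along the middle copy and take the
transitive closure, restricted to the outer copies. -/
def gComp (Pr R : GRel) : GRel := fun u v =>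
  Relation.TransGen
    (fun x y : ℕ ⊕ ℕ ⊕ ℕ =>
      (∃ x' y', Sum.map id Sum.inl x' = x ∧ Sum.map id Sum.inl y' = y ∧ R x' y') ∨
      (∃ x' y', Sum.inr x' = x ∧ Sum.inr y' = y ∧ Pr x' y'))
    (Sum.map id Sum.inr u) (Sum.map id Sum.inr v)

/-- Shift a split relation by `a` on the source side and by `d` on the target side. -/
def gShift (a d : ℕ) (R : GRel) : GRel := fun u v =>
  ∃ u' v', R u' v' ∧ u = Sum.map (· + a) (· + d) u' ∧ v = Sum.map (· + a) (· + d) v'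

/-- Disjoint union of split relations: `G(f ξ g) = Gf ∪ Gg_{+GD}^{+GA}`. -/
def gPar (a d : ℕ) (R S : GRel) : GRel := fun u v => R u v ∨ gShift a d S u v
/-! ### The language L∧,∨ generated from the set `P` of letters -/

inductive Form (P : Type) : Type
  | letter : P → Form P
  | conj : Form P → Form P → Form P
  | disj : Form P → Form P → Form P

infixr:70 " ⋏ " => Form.conj
infixr:66 " ⋎ " => Form.disj

/-- The number of occurrences of letters in a formula (the object map of `G`). -/
def Form.size {P : Type} : Form P → ℕ
  | .letter _ => 1
  | .conj A B => A.size + B.size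
  | .disj A B => A.size + B.size
/-! ### Arrow terms of the category MDS (DS with the mix arrows) -/

inductive Term (P : Type) : Form P → Form P → Type
  | id (A : Form P) : Term P A A
  | comp {A B C : Form P} : Term P B C → Term P A B → Term P A C
  | conj {A B D E : Form P} : Term P A D → Term P B E → Term P (A ⋏ B) (D ⋏ E)
  | disj {A B D E : Form P} : Term P A D → Term P B E → Term P (A ⋎ B) (D ⋎ E)
  | bConjTo (A B C : Form P) : Term P (A ⋏ (B ⋏ C)) ((A ⋏ B) ⋏ C)
  | bConjFrom (A B C : Form P) : Term P ((A ⋏ B) ⋏ C) (A ⋏ (B ⋏ C))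
  | bDisjTo (A B C : Form P) : Term P (A ⋎ (B ⋎ C)) ((A ⋎ B) ⋎ C)
  | bDisjFrom (A B C : Form P) : Term P ((A ⋎ B) ⋎ C) (A ⋎ (B ⋎ C))
  | cConj (A B : Form P) : Term P (A ⋏ B) (B ⋏ A)
  | cDisj (A B : Form P) : Term P (B ⋎ A) (A ⋎ B)
  | d (A B C : Form P) : Term P (A ⋏ (B ⋎ C)) ((A ⋏ B) ⋎ C)
  | mix (A B : Form P) : Term P (A ⋏ B) (A ⋎ B)

infixr:80 " ⬝ " => Term.comp
infixr:70 " ⊼ " => Term.conj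
infixr:66 " ⊽ " => Term.disj

/-- The arrow `d^R_{C,B,A} : (C∨B)∧A ⊢ C∨(B∧A)`. -/
def dR {P : Type} (C B A : Form P) : Term P ((C ⋎ B) ⋏ A) (C ⋎ (B ⋏ A)) :=
  Term.cDisj C (B ⋏ A) ⬝ ((Term.cConj A B ⊽ Term.id C) ⬝
    (Term.d A B C ⬝ ((Term.id A ⊼ Term.cDisj B C) ⬝ Term.cConj (C ⋎ B) A)))
/-! ### The equations of DS, imposed on arrow terms -/

inductive Eqv {P : Type} : ∀ {A B : Form P}, Term P A B → Term P A B → Prop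
  -- equivalence and congruence
  | refl {A B : Form P} (f : Term P A B) : Eqv f f
  | symm {A B : Form P} {f g : Term P A B} : Eqv f g → Eqv g f
  | trans {A B : Form P} {f g h : Term P A B} : Eqv f g → Eqv g h → Eqv f h
  | congComp {A B C : Form P} {g g' : Term P B C} {f f' : Term P A B} :
      Eqv g g' → Eqv f f' → Eqv (g ⬝ f) (g' ⬝ f')
  | congConj {A B D E : Form P} {f f' : Term P A D} {g g' : Term P B E} :
      Eqv f f' → Eqv g g' → Eqv (f ⊼ g) (f' ⊼ g')
  | congDisj {A B D E : Form P} {f f' : Term P A D} {g g' : Term P B E} :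
      Eqv f f' → Eqv g g' → Eqv (f ⊽ g) (f' ⊽ g')
  -- (cat 1), (cat 2)
  | catIdR {A B : Form P} (f : Term P A B) : Eqv (f ⬝ Term.id A) f
  | catIdL {A B : Form P} (f : Term P A B) : Eqv (Term.id B ⬝ f) f
  | catAssoc {A B C D : Form P} (f : Term P A B) (g : Term P B C) (h : Term P C D) :
      Eqv (h ⬝ (g ⬝ f)) ((h ⬝ g) ⬝ f)
  -- bifunctorial equations (ξ 1), (ξ 2)
  | conjOne (A B : Form P) : Eqv (Term.id A ⊼ Term.id B) (Term.id (A ⋏ B))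
  | disjOne (A B : Form P) : Eqv (Term.id A ⊽ Term.id B) (Term.id (A ⋎ B))
  | conjTwo {A₁ B₁ C₁ A₂ B₂ C₂ : Form P} (g₁ : Term P B₁ C₁) (f₁ : Term P A₁ B₁)
      (g₂ : Term P B₂ C₂) (f₂ : Term P A₂ B₂) :
      Eqv ((g₁ ⬝ f₁) ⊼ (g₂ ⬝ f₂)) ((g₁ ⊼ g₂) ⬝ (f₁ ⊼ f₂))
  | disjTwo {A₁ B₁ C₁ A₂ B₂ C₂ : Form P} (g₁ : Term P B₁ C₁) (f₁ : Term P A₁ B₁)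
      (g₂ : Term P B₂ C₂) (f₂ : Term P A₂ B₂) :
      Eqv ((g₁ ⬝ f₁) ⊽ (g₂ ⬝ f₂)) ((g₁ ⊽ g₂) ⬝ (f₁ ⊽ f₂))
  -- naturality equations
  | bConjNat {A B C D E F : Form P} (f : Term P A D) (g : Term P B E) (h : Term P C F) :
      Eqv (((f ⊼ g) ⊼ h) ⬝ Term.bConjTo A B C) (Term.bConjTo D E F ⬝ (f ⊼ (g ⊼ h)))
  | bDisjNat {A B C D E F : Form P} (f : Term P A D) (g : Term P B E) (h : Term P C F) :
      Eqv (((f ⊽ g) ⊽ h) ⬝ Term.bDisjTo A B C) (Term.bDisjTo D E F ⬝ (f ⊽ (g ⊽ h)))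
  | cConjNat {A B D E : Form P} (f : Term P A D) (g : Term P B E) :
      Eqv ((g ⊼ f) ⬝ Term.cConj A B) (Term.cConj D E ⬝ (f ⊼ g))
  | cDisjNat {A B D E : Form P} (f : Term P A D) (g : Term P B E) :
      Eqv ((g ⊽ f) ⬝ Term.cDisj B A) (Term.cDisj E D ⬝ (f ⊽ g))
  | dNat {A B C D E F : Form P} (f : Term P A D) (g : Term P B E) (h : Term P C F) :
      Eqv (((f ⊼ g) ⊽ h) ⬝ Term.d A B C) (Term.d D E F ⬝ (f ⊼ (g ⊽ h)))
  -- (b̂ξ b̂ξ)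
  | bConjIso₁ (A B C : Form P) :
      Eqv (Term.bConjFrom A B C ⬝ Term.bConjTo A B C) (Term.id (A ⋏ (B ⋏ C)))
  | bConjIso₂ (A B C : Form P) :
      Eqv (Term.bConjTo A B C ⬝ Term.bConjFrom A B C) (Term.id ((A ⋏ B) ⋏ C))
  | bDisjIso₁ (A B C : Form P) :
      Eqv (Term.bDisjFrom A B C ⬝ Term.bDisjTo A B C) (Term.id (A ⋎ (B ⋎ C)))
  | bDisjIso₂ (A B C : Form P) :
      Eqv (Term.bDisjTo A B C ⬝ Term.bDisjFrom A B C) (Term.id ((A ⋎ B) ⋎ C))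
  -- (b̂ξ 5)
  | bConjPent (A B C D : Form P) :
      Eqv (Term.bConjFrom A B (C ⋏ D) ⬝ Term.bConjFrom (A ⋏ B) C D)
        ((Term.id A ⊼ Term.bConjFrom B C D) ⬝
          (Term.bConjFrom A (B ⋏ C) D ⬝ (Term.bConjFrom A B C ⊼ Term.id D)))
  | bDisjPent (A B C D : Form P) :
      Eqv (Term.bDisjFrom A B (C ⋎ D) ⬝ Term.bDisjFrom (A ⋎ B) C D)
        ((Term.id A ⊽ Term.bDisjFrom B C D) ⬝
          (Term.bDisjFrom A (B ⋎ C) D ⬝ (Term.bDisjFrom A B C ⊽ Term.id D)))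
  -- (ĉ∧ ĉ∧), (ĉ∨ ĉ∨)
  | cConjIso (A B : Form P) : Eqv (Term.cConj B A ⬝ Term.cConj A B) (Term.id (A ⋏ B))
  | cDisjIso (A B : Form P) : Eqv (Term.cDisj A B ⬝ Term.cDisj B A) (Term.id (A ⋎ B))
  -- (b̂∧ ĉ∧), (b̂∨ ĉ∨)
  | bcConj (A B C : Form P) :
      Eqv ((Term.id B ⊼ Term.cConj C A) ⬝ (Term.bConjFrom B C A ⬝
            (Term.cConj A (B ⋏ C) ⬝ (Term.bConjFrom A B C ⬝ (Term.cConj B A ⊼ Term.id C)))))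
        (Term.bConjFrom B A C)
  | bcDisj (A B C : Form P) :
      Eqv ((Term.id B ⊽ Term.cDisj A C) ⬝ (Term.bDisjFrom B C A ⬝
            (Term.cDisj (B ⋎ C) A ⬝ (Term.bDisjFrom A B C ⬝ (Term.cDisj A B ⊽ Term.id C)))))
        (Term.bDisjFrom B A C)
  -- (d ∧), (d ∨)
  | dConj (A B C D : Form P) :
      Eqv ((Term.bConjFrom A B C ⊽ Term.id D) ⬝ Term.d (A ⋏ B) C D)
        (Term.d A (B ⋏ C) D ⬝ ((Term.id A ⊼ Term.d B C D) ⬝ Term.bConjFrom A B (C ⋎ D)))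
  | dDisj (D C B A : Form P) :
      Eqv (Term.d D C (B ⋎ A) ⬝ (Term.id D ⊼ Term.bDisjFrom C B A))
        (Term.bDisjFrom (D ⋏ C) B A ⬝ ((Term.d D C B ⊽ Term.id A) ⬝ Term.d D (C ⋎ B) A))
  -- (d b̂∧), (d b̂∨)
  | dBConj (A B C D : Form P) :
      Eqv (dR (A ⋏ B) C D ⬝ (Term.d A B C ⊼ Term.id D))
        (Term.d A B (C ⋏ D) ⬝ ((Term.id A ⊼ dR B C D) ⬝ Term.bConjFrom A (B ⋎ C) D))
  | dBDisj (D C B A : Form P) :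
      Eqv ((Term.id D ⊽ Term.d C B A) ⬝ dR D C (B ⋎ A))
        (Term.bDisjFrom D (C ⋏ B) A ⬝ ((dR D C B ⊽ Term.id A) ⬝ Term.d (D ⋎ C) B A))
  -- (m nat)
  | mixNat {A B D E : Form P} (f : Term P A D) (g : Term P B E) :
      Eqv ((f ⊽ g) ⬝ Term.mix A B) (Term.mix D E ⬝ (f ⊼ g))
  -- (b̂∧ m)
  | mixBConj (A B C : Form P) :
      Eqv (Term.mix (A ⋏ B) C ⬝ Term.bConjTo A B C) (Term.d A B C ⬝ (Term.id A ⊼ Term.mix B C))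
  -- (b̂∨ m)
  | mixBDisj (C B A : Form P) :
      Eqv (Term.bDisjTo C B A ⬝ Term.mix C (B ⋎ A)) ((Term.mix C B ⊽ Term.id A) ⬝ Term.d C B A)
  -- (c m)
  | mixC (A B : Form P) :
      Eqv (Term.mix B A ⬝ Term.cConj A B) (Term.cDisj B A ⬝ Term.mix A B)
/-- The functor `G` from DS to Br on arrow terms. -/
def Term.G {P : Type} : ∀ {A B : Form P}, Term P A B → GRel
  | _, _, .id A => gId A.size
  | _, _, .comp g f => gComp (Term.G g) (Term.G f)
  | _, _, @Term.conj _ A _ D _ f g => gPar A.size D.size (Term.G f) (Term.G g)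
  | _, _, @Term.disj _ A _ D _ f g => gPar A.size D.size (Term.G f) (Term.G g)
  | _, _, .bConjTo A B C => gId (A.size + (B.size + C.size))
  | _, _, .bConjFrom A B C => gId (A.size + B.size + C.size)
  | _, _, .bDisjTo A B C => gId (A.size + (B.size + C.size))
  | _, _, .bDisjFrom A B C => gId (A.size + B.size + C.size)
  | _, _, .cConj A B => gSwap A.size B.size
  | _, _, .cDisj A B => gSwap B.size A.size
  | _, _, .d A B C => gId (A.size + (B.size + C.size))
  | _, _, .mix A B => gId (A.size + B.size)

section
/-- flat presentation: untyped arrows up to associativity and commutativity, `bot` is junk -/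
structure FS (L : Type) where
  Q : Type
  e : Q
  an : Q → Q → Q
  or : Q → Q → Q
  an_comm : ∀ X Y, an X Y = an Y X
  or_comm : ∀ X Y, or X Y = or Y X
  an_assoc : ∀ X Y Z, an (an X Y) Z = an X (an Y Z)
  or_assoc : ∀ X Y Z, or (or X Y) Z = or X (or Y Z)
  e_an : ∀ X, an e X = X
  e_or : ∀ X, or e X = X
  ms : Q → Multiset L
  ms_e : ms e = 0
  ms_an : ∀ X Y, ms (an X Y) = ms X + ms Y
  ms_or : ∀ X Y, ms (or X Y) = ms X + ms Y
  ms_zero : ∀ X, ms X = 0 → X = e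
  res : Set L → Q → Q
  res_e : ∀ S, res S e = e
  res_an : ∀ S X Y, res S (an X Y) = an (res S X) (res S Y)
  res_or : ∀ S X Y, res S (or X Y) = or (res S X) (res S Y)
  res_mem : ∀ S X a, a ∈ ms (res S X) ↔ a ∈ ms X ∧ a ∈ S
  res_all : ∀ S X, (∀ a ∈ ms X, a ∈ S) → res S X = X
  prime : ∀ P R U V, (ms (or P R)).Nodup → or P R = an U V → P = e ∨ R = e ∨ U = e ∨ V = e
  cases : ∀ X, (ms X).card ≤ 1 ∨ (∃ P R, P ≠ e ∧ R ≠ e ∧ X = an P R) ∨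
    (∃ P R, P ≠ e ∧ R ≠ e ∧ X = or P R)
  A : Type
  bot : A
  anA : A → A → A
  orA : A → A → A
  anA_comm : ∀ X Y, anA X Y = anA Y X
  orA_comm : ∀ X Y, orA X Y = orA Y X
  anA_assoc : ∀ X Y Z, anA (anA X Y) Z = anA X (anA Y Z)
  orA_assoc : ∀ X Y Z, orA (orA X Y) Z = orA X (orA Y Z)
  bot_an : ∀ f, anA bot f = bot
  bot_or : ∀ f, orA bot f = bot
  i : Q → A
  e_anA : ∀ f, anA (i e) f = f
  e_orA : ∀ f, orA (i e) f = f
  i_an : ∀ X Y, i (an X Y) = anA (i X) (i Y)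
  i_or : ∀ X Y, i (or X Y) = orA (i X) (i Y)
  i_bot : ∀ X, ¬ (ms X).Nodup → i X = bot
  cmp : A → A → A
  cmp_assoc : ∀ f g h, cmp (cmp f g) h = cmp f (cmp g h)
  bot_cmp : ∀ f, cmp bot f = bot
  cmp_bot : ∀ f, cmp f bot = bot
  H : A → Q → Q → Prop
  H_bot : ∀ X Y, ¬ H bot X Y
  H_ex : ∀ f, f ≠ bot → ∃ X Y, H f X Y
  H_uniq : ∀ {f X Y X' Y'}, H f X Y → H f X' Y' → X = X' ∧ Y = Y'
  H_ms : ∀ {f X Y}, H f X Y → ms X = ms Y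
  H_N : ∀ {f X Y}, H f X Y → (ms X).Nodup
  H_i : ∀ X, (ms X).Nodup → H (i X) X X
  H_cmp : ∀ {f g X Y Z}, H f X Y → H g Y Z → H (cmp f g) X Z
  H_cmp' : ∀ {f g X Z}, H (cmp f g) X Z → ∃ Y, H f X Y ∧ H g Y Z
  H_an : ∀ {f g X Y X' Y'}, H f X Y → H g X' Y' → (ms (an X X')).Nodup → H (anA f g) (an X X') (an Y Y')
  H_an' : ∀ {f g Z W}, H (anA f g) Z W →
    ∃ X Y X' Y', H f X Y ∧ H g X' Y' ∧ Z = an X X' ∧ W = an Y Y'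
  H_or : ∀ {f g X Y X' Y'}, H f X Y → H g X' Y' → (ms (or X X')).Nodup → H (orA f g) (or X X') (or Y Y')
  H_or' : ∀ {f g Z W}, H (orA f g) Z W →
    ∃ X Y X' Y', H f X Y ∧ H g X' Y' ∧ Z = or X X' ∧ W = or Y Y'
  i_cmp : ∀ {f X Y}, H f X Y → cmp (i X) f = f
  cmp_i : ∀ {f X Y}, H f X Y → cmp f (i Y) = f
  anA_cmp : ∀ {f g f' g' X Y Z X' Y' Z'}, H f X Y → H g Y Z → H f' X' Y' → H g' Y' Z' →
    anA (cmp f g) (cmp f' g') = cmp (anA f f') (anA g g')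
  orA_cmp : ∀ {f g f' g' X Y Z X' Y' Z'}, H f X Y → H g Y Z → H f' X' Y' → H g' Y' Z' →
    orA (cmp f g) (cmp f' g') = cmp (orA f f') (orA g g')
  d : Q → Q → Q → A
  d_bot : ∀ X Y Z, ¬ (ms (an X (or Y Z))).Nodup → d X Y Z = bot
  H_d : ∀ X Y Z, (ms (an X (or Y Z))).Nodup → H (d X Y Z) (an X (or Y Z)) (or (an X Y) Z)
  d_nat : ∀ {f g h X Y Z X' Y' Z'}, H f X X' → H g Y Y' → H h Z Z' →
    cmp (anA f (orA g h)) (d X' Y' Z') = cmp (d X Y Z) (orA (anA f g) h)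
  S1 : ∀ X Y U V, d (an X Y) U V = cmp (anA (i X) (d Y U V)) (d X (an Y U) V)
  S2 : ∀ X P R V, d X P (or R V) = cmp (d X (or P R) V) (orA (d X P R) (i V))
  E3 : ∀ U B C D, cmp (anA (d U B C) (i D)) (d D C (an U B)) =
    cmp (anA (i U) (d D C B)) (d U B (an C D))
  E4 : ∀ X U N V, cmp (d (or X U) N V) (orA (d N X U) (i V)) =
    cmp (d (or N V) X U) (orA (d X N V) (i U))
  d_l : ∀ Y Z, d e Y Z = i (or Y Z)
  d_r : ∀ X Y, d X Y e = i (an X Y)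
  res_H : ∀ S {f X Y}, H f X Y → ∃ f', H f' (res S X) (res S Y)
  one : ∀ {f X Y}, H f X Y → (ms X).card ≤ 1 → f = i X ∧ X = Y
  ind : ∀ (p : A → Prop), (∀ X, (ms X).Nodup → p (i X)) → (∀ X Y Z, p (d X Y Z)) →
    (∀ f g, p f → p g → p (anA f g)) → (∀ f g, p f → p g → p (orA f g)) →
    (∀ f g, p f → p g → p (cmp f g)) → ∀ f X Y, H f X Y → p f

namespace FS
variable {L : Type} (M : FS L)

/-- the dual structure -/
def op : FS L where
  Q := M.Q
  e := M.e
  an := M.or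
  or := M.an
  an_comm := M.or_comm
  or_comm := M.an_comm
  an_assoc := M.or_assoc
  or_assoc := M.an_assoc
  e_an := M.e_or
  e_or := M.e_an
  ms := M.ms
  ms_e := M.ms_e
  ms_an := M.ms_or
  ms_or := M.ms_an
  ms_zero := M.ms_zero
  res := M.res
  res_e := M.res_e
  res_an := M.res_or
  res_or := M.res_an
  res_mem := M.res_mem
  res_all := M.res_all
  prime := by
    intro P R U V h h'
    have := M.prime U V P R (by rw [← h']; exact h) h'.symm
    tauto
  cases := fun X => (M.cases X).imp_right Or.symm
  A := M.A
  bot := M.bot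
  anA := M.orA
  orA := M.anA
  anA_comm := M.orA_comm
  orA_comm := M.anA_comm
  anA_assoc := M.orA_assoc
  orA_assoc := M.anA_assoc
  bot_an := M.bot_or
  bot_or := M.bot_an
  i := M.i
  e_anA := M.e_orA
  e_orA := M.e_anA
  i_an := M.i_or
  i_or := M.i_an
  i_bot := M.i_bot
  cmp := fun f g => M.cmp g f
  cmp_assoc := fun f g h => (M.cmp_assoc h g f).symm
  bot_cmp := M.cmp_bot
  cmp_bot := M.bot_cmp
  H := fun f X Y => M.H f Y X
  H_bot := fun _ _ => M.H_bot _ _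
  H_ex := fun f h => let ⟨X, Y, h⟩ := M.H_ex f h; ⟨Y, X, h⟩
  H_uniq := fun h h' => (M.H_uniq h h').symm
  H_ms := fun h => (M.H_ms h).symm
  H_N := fun h => by rw [← M.H_ms h]; exact M.H_N h
  H_i := M.H_i
  H_cmp := fun h h' => M.H_cmp h' h
  H_cmp' := fun h => let ⟨Y, h, h'⟩ := M.H_cmp' h; ⟨Y, h', h⟩
  H_an := fun h h' n => M.H_or h h' (by rw [M.ms_or, M.H_ms h, M.H_ms h', ← M.ms_or]; exact n)
  H_an' := fun h => let ⟨X, Y, X', Y', h, h', a, b⟩ := M.H_or' h; ⟨Y, X, Y', X', h, h', b, a⟩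
  H_or := fun h h' n => M.H_an h h' (by rw [M.ms_an, M.H_ms h, M.H_ms h', ← M.ms_an]; exact n)
  H_or' := fun h => let ⟨X, Y, X', Y', h, h', a, b⟩ := M.H_an' h; ⟨Y, X, Y', X', h, h', b, a⟩
  i_cmp := M.cmp_i
  cmp_i := M.i_cmp
  anA_cmp := fun a b c d => M.orA_cmp b a d c
  orA_cmp := fun a b c d => M.anA_cmp b a d c
  d := fun X Y Z => M.d Z Y X
  d_bot := fun X Y Z h => M.d_bot _ _ _ (by
    rw [M.ms_or, M.ms_an] at h; rw [M.ms_an, M.ms_or]; convert h using 2; abel)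
  H_d := fun X Y Z h => by
    have := M.H_d Z Y X (by
      rw [M.ms_or, M.ms_an] at h; rw [M.ms_an, M.ms_or]; convert h using 1; abel)
    rwa [M.an_comm, M.or_comm, M.or_comm _ X, M.an_comm Z Y] at this
  d_nat := fun {f g h X Y Z X' Y' Z'} a b c => by
    have := M.d_nat c b a
    rw [M.anA_comm g h, M.orA_comm f, M.anA_comm (M.orA f g), M.orA_comm f]
    exact this.symm
  S1 := fun X Y U V => by
    have := M.S2 V U Y X
    rw [M.or_comm X Y, this, M.orA_comm, M.or_comm Y U]
  S2 := fun X P R V => by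
    have := M.S1 V R P X
    rw [M.an_comm R V, this, M.anA_comm, M.an_comm P R]
  E3 := fun U B C D => by
    have := M.E4 B U C D
    rw [M.or_comm U B, M.or_comm C D, M.or_comm D C, M.orA_comm (M.i U)]; exact this
  E4 := fun X U N V => by
    have := M.E3 U X N V
    rw [M.an_comm X U, M.anA_comm _ (M.i U)]; exact this
  d_l := fun Y Z => by rw [M.an_comm]; exact M.d_r _ _
  d_r := fun X Y => by rw [M.or_comm]; exact M.d_l _ _
  res_H := fun S {f X Y} h => M.res_H S h
  one := fun {f X Y} h c => by
    obtain ⟨rfl, rfl⟩ := M.one h (by rw [M.H_ms h]; exact c)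
    exact ⟨rfl, rfl⟩
  ind := fun p a b c d e f X Y h => M.ind p a (fun X Y Z => b Z Y X) d c (fun f g h h' => e g f h' h) f Y X h

instance : Mul M.Q := ⟨M.an⟩
instance : Add M.Q := ⟨M.or⟩
instance : One M.Q := ⟨M.e⟩
instance : Mul M.A := ⟨M.anA⟩
instance : Add M.A := ⟨M.orA⟩
instance : One M.A := ⟨M.i M.e⟩

infixr:60 " ⊙ " => FS.cmp _

variable {M}

theorem an_e (X : M.Q) : M.an X M.e = X := by rw [M.an_comm, M.e_an]
theorem anA_e (X : M.A) : M.anA X (M.i M.e) = X := by rw [M.anA_comm, M.e_anA]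

instance : CommMonoid M.Q where
  mul_assoc := M.an_assoc
  mul_comm := M.an_comm
  one_mul := M.e_an
  mul_one := an_e
instance : AddCommSemigroup M.Q where
  add_assoc := M.or_assoc
  add_comm := M.or_comm
instance : CommMonoid M.A where
  mul_assoc := M.anA_assoc
  mul_comm := M.anA_comm
  one_mul := M.e_anA
  mul_one := anA_e
instance : AddCommSemigroup M.A where
  add_assoc := M.orA_assoc
  add_comm := M.orA_comm

theorem one_add (X : M.Q) : 1 + X = X := M.e_or X
theorem add_one (X : M.Q) : X + 1 = X := by rw [add_comm]; exact M.e_or X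
theorem one_addA (X : M.A) : 1 + X = X := M.e_orA X
theorem add_oneA (X : M.A) : X + 1 = X := by rw [add_comm]; exact M.e_orA X
theorem i_mul (X Y : M.Q) : M.i (X * Y) = M.i X * M.i Y := M.i_an X Y
theorem i_add (X Y : M.Q) : M.i (X + Y) = M.i X + M.i Y := M.i_or X Y
theorem i_one : M.i 1 = 1 := rfl
theorem ca (f g h : M.A) : (f ⊙ g) ⊙ h = f ⊙ g ⊙ h := M.cmp_assoc f g h

/-- typing up to junk -/
def Ty (f : M.A) (X Y : M.Q) : Prop := f ≠ M.bot → M.H f X Y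

variable (M) in
def N (X : M.Q) : Prop := (M.ms X).Nodup

theorem H.ne {f : M.A} {X Y : M.Q} (h : M.H f X Y) : f ≠ M.bot := by
  rintro rfl; exact M.H_bot _ _ h
theorem H.ty {f : M.A} {X Y : M.Q} (h : M.H f X Y) : Ty f X Y := fun _ => h

theorem Ty.i (X : M.Q) : Ty (M.i X) X X := fun h => by
  by_cases n : (M.ms X).Nodup
  · exact M.H_i X n
  · exact absurd (M.i_bot X n) h
theorem Ty.d (X Y Z : M.Q) : Ty (M.d X Y Z) (X * (Y + Z)) (X * Y + Z) := fun h => by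
  by_cases n : (M.ms (X * (Y + Z))).Nodup
  · exact M.H_d _ _ _ n
  · exact absurd (M.d_bot _ _ _ n) h
theorem Ty.cmp {f g : M.A} {X Y Z : M.Q} (h : Ty f X Y) (h' : Ty g Y Z) : Ty (f ⊙ g) X Z := by
  intro n
  obtain ⟨_, _, k⟩ := M.H_ex _ n
  obtain ⟨_, k1, k2⟩ := M.H_cmp' k
  exact M.H_cmp (h (H.ne k1)) (h' (H.ne k2))
theorem Ty.mul {f g : M.A} {X Y X' Y' : M.Q} (h : Ty f X Y) (h' : Ty g X' Y') :
    Ty (f * g) (X * X') (Y * Y') := by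
  intro n
  obtain ⟨Z, _, k⟩ := M.H_ex _ n
  obtain ⟨_, _, _, _, k1, k2, rfl, rfl⟩ := M.H_an' k
  have := M.H_N k
  obtain ⟨rfl, rfl⟩ := M.H_uniq k1 (h (H.ne k1))
  obtain ⟨rfl, rfl⟩ := M.H_uniq k2 (h' (H.ne k2))
  exact k
theorem Ty.add {f g : M.A} {X Y X' Y' : M.Q} (h : Ty f X Y) (h' : Ty g X' Y') :
    Ty (f + g) (X + X') (Y + Y') := by
  intro n
  obtain ⟨Z, _, k⟩ := M.H_ex _ n
  obtain ⟨_, _, _, _, k1, k2, rfl, rfl⟩ := M.H_or' k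
  have := M.H_N k
  obtain ⟨rfl, rfl⟩ := M.H_uniq k1 (h (H.ne k1))
  obtain ⟨rfl, rfl⟩ := M.H_uniq k2 (h' (H.ne k2))
  exact k
theorem Ty.conv {f : M.A} {X Y X' Y' : M.Q} (h : Ty f X Y) (a : X = X') (b : Y = Y') : Ty f X' Y' :=
  a ▸ b ▸ h

theorem bot_mul (f : M.A) : M.bot * f = M.bot := M.bot_an f
theorem mul_bot (f : M.A) : f * M.bot = M.bot := by rw [mul_comm]; exact M.bot_an f
theorem bot_add (f : M.A) : M.bot + f = M.bot := M.bot_or f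
theorem add_bot (f : M.A) : f + M.bot = M.bot := by rw [add_comm]; exact M.bot_or f

theorem interM {f g f' g' : M.A} {X Y Z X' Y' Z' : M.Q} (h1 : Ty f X Y) (h2 : Ty g Y Z)
    (h3 : Ty f' X' Y') (h4 : Ty g' Y' Z') : (f * f') ⊙ (g * g') = (f ⊙ g) * (f' ⊙ g') := by
  by_cases n1 : f = M.bot
  · subst n1; simp only [bot_mul, M.bot_cmp]
  by_cases n2 : g = M.bot
  · subst n2; simp only [bot_mul, M.cmp_bot]
  by_cases n3 : f' = M.bot
  · subst n3; simp only [mul_bot, M.bot_cmp]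
  by_cases n4 : g' = M.bot
  · subst n4; simp only [mul_bot, M.cmp_bot]
  exact (M.anA_cmp (h1 n1) (h2 n2) (h3 n3) (h4 n4)).symm
theorem interA {f g f' g' : M.A} {X Y Z X' Y' Z' : M.Q} (h1 : Ty f X Y) (h2 : Ty g Y Z)
    (h3 : Ty f' X' Y') (h4 : Ty g' Y' Z') : (f + f') ⊙ (g + g') = (f ⊙ g) + (f' ⊙ g') := by
  by_cases n1 : f = M.bot
  · subst n1; simp only [bot_add, M.bot_cmp]
  by_cases n2 : g = M.bot
  · subst n2; simp only [bot_add, M.cmp_bot]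
  by_cases n3 : f' = M.bot
  · subst n3; simp only [add_bot, M.bot_cmp]
  by_cases n4 : g' = M.bot
  · subst n4; simp only [add_bot, M.cmp_bot]
  exact (M.orA_cmp (h1 n1) (h2 n2) (h3 n3) (h4 n4)).symm

theorem i_cm {f : M.A} {X Y : M.Q} (h : Ty f X Y) : M.i X ⊙ f = f := by
  by_cases n : f = M.bot
  · subst n; exact M.cmp_bot _
  · exact M.i_cmp (h n)
theorem cm_i {f : M.A} {X Y : M.Q} (h : Ty f X Y) : f ⊙ M.i Y = f := by
  by_cases n : f = M.bot
  · subst n; exact M.bot_cmp _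
  · exact M.cmp_i (h n)

theorem dnat {f g h : M.A} {X Y Z X' Y' Z' : M.Q} (a : Ty f X X') (b : Ty g Y Y')
    (c : Ty h Z Z') : f * (g + h) ⊙ M.d X' Y' Z' = M.d X Y Z ⊙ (f * g + h) := by
  by_cases n1 : f = M.bot
  · subst n1; simp only [bot_mul, bot_add, M.bot_cmp, M.cmp_bot]
  by_cases n2 : g = M.bot
  · subst n2; simp only [mul_bot, bot_add, M.bot_cmp, M.cmp_bot]
  by_cases n3 : h = M.bot
  · subst n3; simp only [mul_bot, add_bot, M.bot_cmp, M.cmp_bot]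
  exact M.d_nat (a n1) (b n2) (c n3)

/-! ### restriction and cancellation -/
theorem ms_one : M.ms 1 = 0 := M.ms_e
theorem ms_mul (X Y : M.Q) : M.ms (X * Y) = M.ms X + M.ms Y := M.ms_an X Y
theorem ms_add (X Y : M.Q) : M.ms (X + Y) = M.ms X + M.ms Y := M.ms_or X Y
theorem res_mul (S : Set L) (X Y : M.Q) : M.res S (X * Y) = M.res S X * M.res S Y := M.res_an S X Y
theorem res_add (S : Set L) (X Y : M.Q) : M.res S (X + Y) = M.res S X + M.res S Y := M.res_or S X Y
theorem res_one (S : Set L) : M.res S 1 = 1 := M.res_e S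
theorem res_none (S : Set L) (X : M.Q) (h : ∀ a ∈ M.ms X, a ∉ S) : M.res S X = 1 :=
  M.ms_zero _ (Multiset.eq_zero_of_forall_notMem fun a ha =>
    h a ((M.res_mem S X a).1 ha).1 ((M.res_mem S X a).1 ha).2)
theorem res_allOp (S : Set L) (X : M.Q) (h : ∀ a ∈ M.ms X, a ∈ S) : M.res S X = X := M.res_all S X h

/-- letters -/
def lt (X : M.Q) : Set L := {a | a ∈ M.ms X}

theorem N_mul {X Y : M.Q} : M.N (X * Y) ↔ M.N X ∧ M.N Y ∧ Disjoint (M.ms X) (M.ms Y) := by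
  unfold N; rw [ms_mul, Multiset.nodup_add]
theorem N_add {X Y : M.Q} : M.N (X + Y) ↔ M.N X ∧ M.N Y ∧ Disjoint (M.ms X) (M.ms Y) := by
  unfold N; rw [ms_add, Multiset.nodup_add]

theorem mul_cancel {X B B' : M.Q} (n : M.N (X * B)) (h : X * B = X * B') : B = B' := by
  have n' : M.N (X * B') := h ▸ n
  obtain ⟨_, _, n⟩ := N_mul.1 n
  obtain ⟨_, _, n'⟩ := N_mul.1 n'
  rw [Multiset.disjoint_left] at n n'
  have := congrArg (M.res (lt X)ᶜ) h
  rw [res_mul, res_mul, res_none _ X (by simp [lt]), one_mul, one_mul, M.res_all, M.res_all] at this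
  · exact this
  · intro a h h'; exact n' h' h
  · intro a h h'; exact n h' h

theorem whM (X : M.Q) (f g : M.A) : M.i X * (f ⊙ g) = M.i X * f ⊙ M.i X * g := by
  by_cases c : f ⊙ g = M.bot
  · rw [c, mul_bot]
    by_contra h
    obtain ⟨U, W, k⟩ := M.H_ex _ (Ne.symm h)
    obtain ⟨V, k1, k2⟩ := M.H_cmp' k
    obtain ⟨_, _, A, B, j1, k1', rfl, rfl⟩ := M.H_an' k1
    obtain ⟨_, _, A', B', j2, k2', e1, rfl⟩ := M.H_an' k2
    have j := Ty.i X (H.ne j1)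
    obtain ⟨rfl, rfl⟩ := M.H_uniq j1 j
    obtain ⟨rfl, rfl⟩ := M.H_uniq j1 j2
    have n := M.H_N k1
    rw [M.H_ms k1] at n
    have := mul_cancel n e1
    subst this
    exact H.ne (M.H_cmp k1' k2') c
  · obtain ⟨_, _, k⟩ := M.H_ex _ c
    obtain ⟨V, k1, k2⟩ := M.H_cmp' k
    rw [interM (Ty.i X) (Ty.i X) k1.ty k2.ty, i_cm (Ty.i X)]

theorem whA (X : M.Q) (f g : M.A) : M.i X + (f ⊙ g) = M.i X + f ⊙ M.i X + g :=
  whM (M := M.op) X g f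

theorem S1' (X Y P R : M.Q) : M.d (X * Y) P R = M.i X * M.d Y P R ⊙ M.d X (Y * P) R := M.S1 X Y P R
theorem S2' (X P R V : M.Q) : M.d X P (R + V) = M.d X (P + R) V ⊙ M.d X P R + M.i V := M.S2 X P R V
theorem E3' (U B C D : M.Q) :
    M.d U B C * M.i D ⊙ M.d D C (U * B) = M.i U * M.d D C B ⊙ M.d U B (C * D) := M.E3 U B C D
theorem E4' (X U N V : M.Q) :
    M.d (X + U) N V ⊙ M.d N X U + M.i V = M.d (N + V) X U ⊙ M.d X N V + M.i U := M.E4 X U N V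
theorem d_l' (Y Z : M.Q) : M.d 1 Y Z = M.i Y + M.i Z := (M.d_l Y Z).trans (i_add _ _)
theorem d_r' (Y Z : M.Q) : M.d Y Z 1 = M.i Y * M.i Z := (M.d_r Y Z).trans (i_mul _ _)

end FS
end

section
namespace FS
variable {L : Type} {M : FS L}

instance : Std.Associative (M.cmp) := ⟨M.cmp_assoc⟩

/-- the left splitting arrow -/
def del (X Y P R : M.Q) : M.A := M.i X * M.d Y R P ⊙ M.d X P (Y * R)
/-- the right splitting arrow -/
def lam (A N U V : M.Q) : M.A := M.d (N + V) A U ⊙ M.d A N V + M.i U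

theorem Ty.del (X Y P R : M.Q) : Ty (del X Y P R) (X * Y * (P + R)) (X * P + Y * R) := by
  have := ((Ty.i X).mul (Ty.d Y R P)).cmp ((Ty.d X P (Y * R)).conv (by rw [add_comm]) rfl)
  exact this.conv (by rw [mul_assoc, add_comm]) rfl

theorem Ty.lam (A N U V : M.Q) : Ty (lam A N U V) ((A + U) * (N + V)) (A * N + V + U) := by
  have := (Ty.d (N + V) A U).cmp
    (((Ty.d A N V).add (Ty.i U)).conv (by rw [mul_comm]) rfl)
  exact this.conv (by rw [mul_comm]) rfl

theorem op_del (X Y P R : M.Q) : del (M := M.op) X Y P R = lam P R X Y := by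
  show M.cmp (M.d (Y + R) P X) (M.i X + M.d P R Y) = M.d (R + Y) P X ⊙ M.d P R Y + M.i X
  rw [add_comm (M.i X), add_comm Y]
theorem op_lam (X Y P R : M.Q) : lam (M := M.op) X Y P R = del P R X Y := by
  show M.cmp (M.d R Y X * M.i P) (M.d P X (Y * R)) = M.i P * M.d R Y X ⊙ M.d P X (R * Y)
  rw [mul_comm, mul_comm Y]

theorem del_symm (X Y P R : M.Q) : del X Y P R = del Y X R P := by
  have := E3' X P R Y
  unfold del
  grind only

theorem lam_symm (A N U V : M.Q) : lam A N U V = lam N A V U := by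
  have := E4' A U N V
  unfold lam
  grind only

theorem mix_symm (X Y : M.Q) : M.d X 1 Y = M.d Y 1 X := by
  have := del_symm X Y 1 1
  unfold del at this
  rw [d_r', d_r', i_one, mul_one, mul_one, mul_one, mul_one, ← i_mul, ← i_mul] at this
  have h1 := i_cm ((Ty.d X 1 Y).conv (by rw [one_add]) rfl)
  have h2 := i_cm ((Ty.d Y 1 X).conv (by rw [one_add]) rfl)
  rw [h2, h1] at this
  exact this

theorem del_mix (X Y : M.Q) : del X Y 1 1 = M.d X 1 Y := by
  unfold del
  rw [d_r', i_one, mul_one, mul_one, ← i_mul]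
  exact i_cm ((Ty.d X 1 Y).conv (by rw [one_add]) rfl)

theorem del_1 (Y P R : M.Q) : del 1 Y P R = M.d Y R P := by
  unfold del
  rw [i_one, one_mul, d_l', ← i_add]
  exact cm_i ((Ty.d Y R P).conv rfl (by rw [add_comm]))

theorem del_11 (P R : M.Q) : del 1 1 P R = M.i (P + R) := by
  rw [del_1, d_l', i_add, add_comm]

theorem lam_11 (P R : M.Q) : lam P R 1 1 = M.i (P * R) := by
  unfold lam
  rw [d_r', d_r', i_one, add_oneA, add_one, ← i_mul, ← i_mul, mul_comm]
  exact i_cm (Ty.i _)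

theorem wh2 {f : M.A} {X Y : M.Q} (h : Ty f X Y) (Z : M.Q) : M.i (X * Z) ⊙ f * M.i Z = f * M.i Z :=
  i_cm (h.mul (Ty.i Z))

theorem delnat {a b c k : M.A} {X Y P R X' Y' P' R' : M.Q} (ha : Ty a X X') (hb : Ty b Y Y')
    (hc : Ty c P P') (hk : Ty k R R') :
    a * b * (c + k) ⊙ del X' Y' P' R' = del X Y P R ⊙ a * c + b * k := by
  unfold del
  have h1 := dnat hb hk hc
  have h2 := interM ha (Ty.i X') (hb.mul (hk.add hc)) (Ty.d _ _ _)
  have h3 := interM (Ty.i X) ha (Ty.d Y R P) ((hb.mul hk).add hc)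
  have h4 := dnat ha hc (hb.mul hk)
  rw [cm_i ha] at h2
  rw [i_cm ha] at h3
  have h23 : a * (b * (k + c)) ⊙ M.i X' * M.d Y' R' P' =
    M.i X * M.d Y R P ⊙ a * (b * k + c) := by rw [h2, h1, ← h3]
  clear h1 h2 h3
  grind only

theorem lamnat {a b c k : M.A} {X Y P R X' Y' P' R' : M.Q} (ha : Ty a X X') (hb : Ty b Y Y')
    (hc : Ty c P P') (hk : Ty k R R') :
    (a + c) * (b + k) ⊙ lam X' Y' P' R' = lam X Y P R ⊙ a * b + k + c := by
  have := delnat (M := M.op) (a := c) (b := k) (c := a) (k := b) hc hk ha hb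
  rw [op_del, op_del] at this
  have this : lam X Y P R ⊙ (c + k + a * b) = (c + a) * (k + b) ⊙ lam X' Y' P' R' := this
  grind only

theorem S3 (X Y P R V : M.Q) : M.i X * M.d Y R (P + V) ⊙ M.d X P (Y * R + V) =
    M.d (X * Y) (P + R) V ⊙ del X Y P R + M.i V := by
  unfold del
  have h1 := S2' Y R P V
  have h2 := S2' X P (Y * R) V
  have h3 := dnat (Ty.i X) (Ty.d Y R P) (Ty.i V)
  have h4 := S1' X Y (P + R) V
  have h5 := whM X (M.d Y (R + P) V) (M.d Y R P + M.i V)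
  have h6 := whA V (M.i X * M.d Y R P) (M.d X P (Y * R))
  rw [h1, h5, add_comm (M.cmp _ _) (M.i V), h6, h2, h4]
  clear h1 h5 h6 h2 h4
  grind only

theorem EQ1a (U P R B X : M.Q) : M.d (U * (P + R)) B X ⊙ M.d (B * U) P R + M.i X =
    M.d ((B + X) * U) P R ⊙ M.d (U * P) B X + M.i R := by
  have h1 := S1' U (P + R) B X
  have h2 := S1' U B P R
  have h3 := whA X (M.i U * M.d B P R) (M.d U (B * P) R)
  have h4 := dnat (Ty.i U) (Ty.d B P R) (Ty.i X)
  have h5 := S2' U (B * P) R X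
  have k1 := S1' U (B + X) P R
  have k2 := S1' U P B X
  have k3 := whA R (M.i U * M.d P B X) (M.d U (P * B) X)
  have k4 := dnat (Ty.i U) (Ty.d P B X) (Ty.i R)
  have k5 := S2' U (B * P) X R
  have e := E4' P R B X
  have e' := whM U (M.d (P+R) B X) (M.d B P R + M.i X)
  have e'' := whM U (M.d (B+X) P R) (M.d P B X + M.i R)
  grind only

theorem EQ1 (Y1 Y2 P R B X : M.Q) :
    M.d (Y1 * Y2 * (P + R)) B X ⊙ del (B * Y1) Y2 P R + M.i X =
    del ((B + X) * Y1) Y2 P R ⊙ M.d (Y1 * P) B X + M.i (Y2 * R) := by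
  unfold del
  have h1 := EQ1a Y1 P (Y2 * R) B X
  have h2 := dnat ((Ty.i Y1).mul (Ty.d Y2 R P)) (Ty.i B) (Ty.i X)
  have h3 := whA X (M.i (B * Y1) * M.d Y2 R P) (M.d (B * Y1) P (Y2 * R))
  have h4 := i_mul B Y1
  have h5 := i_mul (B + X) Y1
  have h6 := i_add B X
  grind only

theorem EQ2b (A N U V X : M.Q) :
    M.d (N + V) (A + U) X ⊙ lam A N U V + M.i X = lam A N (U + X) V := by
  unfold lam
  have h1 := S2' (N + V) A U X
  have h2 := whA X (M.d (N + V) A U) (M.d A N V + M.i U)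
  have h3 := i_add U X
  grind only

theorem EQ6a (X1 X2 Y1 Y2 P R : M.Q) : del (X1 * X2) (Y1 * Y2) P R =
    M.i (X2 * Y2) * del X1 Y1 P R ⊙ del X2 Y2 (X1 * P) (Y1 * R) := by
  unfold del
  have h1 := S1' Y2 Y1 R P
  have h2 := S1' X2 X1 P (Y1 * Y2 * R)
  have h3 := whM X2 _ _ |>.symm.trans ((congrArg _ (E3' X1 P (Y1 * R) Y2)).trans (whM X2 _ _))
  have h4 := whM (X1 * X2) (M.i Y2 * M.d Y1 R P) (M.d Y2 (Y1 * R) P)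
  have h5 := whM (X2 * Y2) (M.i X1 * M.d Y1 R P) (M.d X1 P (Y1 * R))
  have h6 := i_mul X1 X2
  have h7 := i_mul X2 Y2
  rw [mul_comm Y1 Y2, h1, h4, h5, mul_comm X1 X2, mul_comm Y2 Y1, h2, h7]
  rw [mul_comm X2 X1, h6]
  clear h1 h4 h5 h2 h6 h7
  grind only

theorem four (X1 X2 Y1 Y2 P1 P2 R1 R2 : M.Q) :
    del (X1 * X2) (Y1 * Y2) (P1 + P2) (R1 + R2) ⊙ del X1 X2 P1 P2 + del Y1 Y2 R1 R2 =
    M.i (X1 * X2 * Y1) * M.d Y2 R2 (R1 + P1 + P2) ⊙ M.i (X1 * X2) * M.d Y1 R1 (Y2 * R2 + P1 + P2) ⊙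
    M.i X1 * M.d X2 P2 (P1 + Y1 * R1 + Y2 * R2) ⊙ M.d X1 P1 (X2 * P2 + Y1 * R1 + Y2 * R2) := by
  have h1 := S3 X1 X2 P1 P2 (Y1 * R1 + Y2 * R2)
  have h2 := S3 Y1 Y2 R1 R2 (P1 + P2)
  have h3 := dnat (Ty.i (X1 * X2)) (Ty.i (P1 + P2)) (Ty.del Y1 Y2 R1 R2)
  have h4 := interA (Ty.i (X1 * X2 * (P1 + P2))) ((Ty.del X1 X2 P1 P2)) (Ty.del Y1 Y2 R1 R2)
    (Ty.i (Y1 * R1 + Y2 * R2))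
  rw [i_cm (Ty.del _ _ _ _), cm_i (Ty.del _ _ _ _)] at h4
  have h5 := whM (X1 * X2) (M.d (Y1 * Y2) (R1 + R2) (P1 + P2)) (del Y1 Y2 R1 R2 + M.i (P1 + P2))
  have h6 := whM (X1 * X2) (M.i Y1 * M.d Y2 R2 (R1 + (P1 + P2))) (M.d Y1 R1 (Y2 * R2 + (P1 + P2)))
  have h7 := i_mul (X1 * X2) Y1
  have h8 := i_mul (X1 * X2) (P1 + P2)
  rw [del.eq_1 (X1 * X2)]
  rw [← h4]
  generalize del X1 X2 P1 P2 = D1 at *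
  generalize del Y1 Y2 R1 R2 = D2 at *
  grind only

theorem EQ4 (X1 X2 Y1 Y2 P1 P2 R1 R2 : M.Q) :
    del (X1 * X2) (Y1 * Y2) (P1 + P2) (R1 + R2) ⊙ del X1 X2 P1 P2 + del Y1 Y2 R1 R2 =
    del (X1 * Y1) (X2 * Y2) (P1 + R1) (P2 + R2) ⊙ del X1 Y1 P1 R1 + del X2 Y2 P2 R2 := by
  have a := four X1 X2 Y1 Y2 P1 P2 R1 R2
  have b := four X1 Y1 X2 Y2 P1 R1 P2 R2
  have c := S3 X2 Y1 P2 R1 (Y2 * R2 + P1)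
  have c' := S3 Y1 X2 R1 P2 (Y2 * R2 + P1)
  have h1 := whM X1 (M.i X2 * M.d Y1 R1 (P2 + (Y2 * R2 + P1))) (M.d X2 P2 (Y1 * R1 + (Y2 * R2 + P1)))
  have h2 := whM X1 (M.i Y1 * M.d X2 P2 (R1 + (Y2 * R2 + P1))) (M.d Y1 R1 (X2 * P2 + (Y2 * R2 + P1)))
  have h := del_symm X2 Y1 P2 R1
  have i1 := i_mul X1 X2
  have i2 := i_mul X1 Y1
  rw [a, b]
  clear a b
  grind only

theorem mixS2 (V R W : M.Q) : M.d V R W ⊙ M.d V 1 R + M.i W = M.d V 1 (R + W) := by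
  have := S2' V 1 R W
  rw [one_add] at this
  exact this.symm

theorem EQ5a (X Y P R P' R' : M.Q) :
    del ((P' + R') * X) Y P R ⊙ M.d (X * P) P' R' + M.d R 1 Y =
    M.d Y 1 ((P' + R') * X * (P + R)) ⊙
      (M.d ((P' + R') * X) P R ⊙ M.d (X * P) P' R' + M.i R) + M.i Y := by
  have h1 := mix_symm R Y
  have h2 := mixS2 Y R ((P' + R') * X * P)
  have h3 := dnat (Ty.i Y) (Ty.i 1) ((Ty.d ((P' + R') * X) P R).cmp
    (((Ty.d (X * P) P' R').add (Ty.i R)).conv (by ac_rfl) rfl))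
  have h4 := interA ((Ty.d Y 1 R).conv (by rw [one_add]) rfl) ((Ty.i (Y * 1 + R)))
    (Ty.i ((P' + R') * X * P)) ((Ty.d (X * P) P' R').conv (by ac_rfl) rfl)
  rw [i_cm ((Ty.d (X * P) P' R').conv (by ac_rfl) rfl), cm_i (Ty.d _ _ _)] at h4
  have h6 := dnat (Ty.i Y) (Ty.i 1) (((Ty.d (X * P) P' R').add (Ty.i R)).conv (by ac_rfl) rfl
      : Ty _ ((P' + R') * X * P + R) _)
  have h7 := dnat (Ty.i Y) (Ty.i 1) (Ty.d ((P' + R') * X) P R)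
  have h8 := whA Y (M.d ((P' + R') * X) P R) (M.d (X * P) P' R' + M.i R)
  rw [i_one, one_addA, mul_one] at h7
  rw [i_add, mul_one] at h4
  rw [del_symm, del.eq_1, add_comm (M.d (X * P) P' R'), h1, ← h4, add_comm _ (M.i Y), h8]
  clear h1 h4 h3 h6 h8
  grind only

theorem EQ5b (X Y P R P' R' : M.Q) :
    del ((P' + R') * X) Y P R ⊙ M.d (X * P) P' R' + M.d R 1 Y =
    del ((P + R) * X) Y P' R' ⊙ M.d (X * P') P R + M.d R' 1 Y := by
  rw [EQ5a, EQ5a]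
  have := EQ1a X P' R' P R
  grind only

end FS
end

section
namespace FS
variable {L : Type} {M : FS L}

theorem splitA {a b : M.A} {X Y Z W : M.Q} (ha : Ty a X Y) (hb : Ty b Z W) :
    (a + M.i Z) ⊙ (M.i Y + b) = a + b := by
  rw [interA ha (Ty.i Y) (Ty.i Z) hb, cm_i ha, i_cm hb]
theorem splitM {a b : M.A} {X Y Z W : M.Q} (ha : Ty a X Y) (hb : Ty b Z W) :
    (a * M.i Z) ⊙ (M.i Y * b) = a * b := by
  rw [interM ha (Ty.i Y) (Ty.i Z) hb, cm_i ha, i_cm hb]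

theorem EQ5c (X1 X2 Y1 Y2 P R P' R' : M.Q) :
    del ((P' + R') * X1 * X2) (Y1 * Y2) P R ⊙ del (X1 * P) X2 P' R' + M.d (Y1 * R) 1 Y2 =
    M.i (X1 * Y2) * (M.d Y1 R P * M.d X2 R' P') ⊙
    del ((P' + X2 * R') * X1) Y2 P (Y1 * R) ⊙ M.d (X1 * P) P' (X2 * R') + M.d (Y1 * R) 1 Y2 := by
  have h1 := EQ6a 1 ((P' + R') * X1 * X2) Y1 Y2 P R
  rw [one_mul, one_mul, del_1] at h1
  have h2 := interA ((Ty.i (X1 * P)).mul (Ty.d X2 R' P')) ((Ty.d (X1 * P) P' (X2 * R')).conv (by ac_rfl) rfl)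
    (Ty.i (Y1 * R * Y2)) ((Ty.d (Y1 * R) 1 Y2).conv (by rw [one_add]) rfl)
  rw [i_cm ((Ty.d (Y1 * R) 1 Y2).conv (by rw [one_add]) rfl)] at h2
  have h3 := delnat ((Ty.i X1).mul (Ty.d X2 R' P')) (Ty.i Y2) (Ty.i P) (Ty.i (Y1 * R))
  have h4 := splitM (Ty.d Y1 R P) (Ty.d X2 R' P')
  have h5 := whM (X1 * Y2) (M.d Y1 R P * M.i (X2 * (R' + P'))) (M.i (Y1 * R + P) * M.d X2 R' P')
  rw [← h4, h5, h1, del.eq_1 (X1 * P), ← h2]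
  clear h1 h2 h4 h5
  have e1 := i_mul X1 P
  have e2 := i_mul X1 Y2
  have e3 := i_mul Y2 (Y1 * R)
  have e4 := i_mul (X1 * X2 * (P' + R')) Y2
  have e4 := i_mul (X1 * Y2) (X2 * (R' + P'))
  have e5 := i_add P (Y1 * R)
  grind only

theorem EQ5 (X1 X2 Y1 Y2 P R P' R' : M.Q) :
    del ((P' + R') * X1 * X2) (Y1 * Y2) P R ⊙ del (X1 * P) X2 P' R' + M.d (Y1 * R) 1 Y2 =
    del ((P + R) * X1 * Y1) (X2 * Y2) P' R' ⊙ del (X1 * P') Y1 P R + M.d (X2 * R') 1 Y2 := by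
  rw [EQ5c, EQ5c, EQ5b X1 Y2 P (Y1 * R) P' (X2 * R'), mul_comm (M.d Y1 R P)]

theorem EQ6 (A N U1 U2 V1 V2 : M.Q) :
    del (N + V1) V2 (A + U1) U2 ⊙ lam A N U1 V1 + M.d U2 1 V2 =
    M.d (N + V1) 1 V2 * M.i (A + U1 + U2) ⊙ lam A N (U1 + U2) (V1 + V2) := by
  have hl := (Ty.lam A N U1 V1).conv (mul_comm _ _) rfl
  have a1 := splitA ((Ty.d V2 1 U2).conv (by rw [one_add]) rfl) hl
  have a2 := mixS2 V2 U2 ((N + V1) * (A + U1))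
  have a3 := dnat (Ty.i V2) (Ty.i 1) ((Ty.i U2).add hl)
  rw [i_one, one_addA, mul_one] at a3
  have a4 := EQ2b A N U1 V1 U2
  have a5 := whM V2 (M.d (N + V1) (A + U1) U2) (lam A N U1 V1 + M.i U2)
  have a6 := dnat (Ty.i V2) (Ty.i 1) (Ty.lam A N (U1 + U2) V1)
  rw [i_one, one_addA, mul_one] at a6
  have b1 := EQ2b N A V1 (U1 + U2) V2
  have b2 := E3' V2 1 (N + V1) (A + U1 + U2)
  rw [d_r', mul_one, ← i_mul, ← i_mul, i_cm ((Ty.d V2 1 _).conv (by rw [one_add]; ac_rfl) rfl)] at b2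
  have e1 := i_add V2 U2
  have s1 := mix_symm V2 (N + V1)
  have s2 := mix_symm U2 V2
  have s3 := lam_symm A N (U1 + U2) (V1 + V2)
  have s4 := lam_symm A N (U1 + U2) V1
  rw [s3, ← b1, ← s4, ← s1, del_symm, del.eq_1, add_comm (lam _ _ _ _), s2, ← a1, mul_one]
  rw [a4] at a5
  generalize lam A N U1 V1 = l1 at *
  generalize lam A N (U1 + U2) V1 = l2 at *
  clear s1 s2 s3 s4 a1 b1 a4 hl
  grind only

/-- cutting along B -/
def cut (B X Y : M.Q) (f h : M.A) : M.A := f * M.i Y ⊙ M.d Y B X ⊙ h + M.i X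

theorem op_cut (B X Y : M.Q) (f h : M.A) : cut (M := M.op) B X Y f h = cut B Y X h f := by
  show M.cmp (M.cmp (h * M.i X) (M.d X B Y)) (f + M.i Y) = _
  rw [ca]; rfl

theorem Ty.cut {A B X Y C : M.Q} {f h : M.A} (hf : Ty f A (B + X)) (hh : Ty h (B * Y) C) :
    Ty (cut B X Y f h) (A * Y) (C + X) := by
  refine (hf.mul (Ty.i Y)).cmp (((Ty.d Y B X).conv (mul_comm _ _) rfl).cmp
    ((hh.conv (mul_comm _ _) rfl).add (Ty.i X)))

theorem pushL {A B X Y1 Y2 P R C1 C2 : M.Q} {f h1 h2 : M.A} (hf : Ty f A (B + X))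
    (k1 : Ty h1 (B * Y1 * P) C1) (k2 : Ty h2 (Y2 * R) C2) :
    cut B X (Y1 * Y2 * (P + R)) f (del (B * Y1) Y2 P R ⊙ h1 + h2) =
    del (A * Y1) Y2 P R ⊙ cut B X (Y1 * P) f h1 + h2 := by
  have h1' := EQ1 Y1 Y2 P R B X
  have h2' := delnat (hf.mul (Ty.i Y1)) (Ty.i Y2) (Ty.i P) (Ty.i R)
  have h3 := whA X (del (B * Y1) Y2 P R) (h1 + h2)
  have t1 := ((Ty.d (Y1 * P) B X).cmp ((k1.conv (by ac_rfl) rfl).add (Ty.i X)))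
  have h4 := interA (hf.mul (Ty.i (Y1 * P))) (t1.conv (by ac_rfl) rfl) (Ty.i (Y2 * R)) k2
  have h5 := interA (Ty.d (Y1 * P) B X) ((k1.conv (by ac_rfl) rfl).add (Ty.i X)) (Ty.i (Y2 * R)) k2
  rw [i_cm k2] at h4 h5
  unfold cut
  rw [← h4, ← h5, add_comm (M.cmp _ _) (M.i X), h3]
  have e1 := i_mul Y1 P
  have e2 := i_mul Y2 R
  have e3 := i_mul (Y1 * Y2) (P + R)
  have e4 := i_mul Y1 Y2
  have e5 := i_add P R
  clear h3 h4 h5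
  grind only

theorem pushR {A B X Y1 S A' N U V : M.Q} {f h1 h2 : M.A} (hf : Ty f A (B + X))
    (k1 : Ty h1 (B * Y1) (A' + U)) (k2 : Ty h2 S (N + V)) :
    cut B X (Y1 * S) f (h1 * h2 ⊙ lam A' N U V) = cut B X Y1 f h1 * h2 ⊙ lam A' N (U + X) V := by
  have a1 := EQ2b A' N U V X
  have a2 := dnat k2 k1 (Ty.i X)
  have a3 := S1' S Y1 B X
  have t1 := ((Ty.d Y1 B X).cmp ((k1.conv (by ac_rfl) rfl).add (Ty.i X)))
  have a4 := interM (hf.mul (Ty.i Y1)) (t1.conv (by ac_rfl) rfl) (Ty.i S) k2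
  have a5 := interM (Ty.d Y1 B X) ((k1.conv (by ac_rfl) rfl).add (Ty.i X)) (Ty.i S) k2
  rw [i_cm k2] at a4 a5
  have a6 := whA X (h1 * h2) (lam A' N U V)
  unfold cut
  rw [← a4, ← a5, ← a1, add_comm (M.cmp _ _) (M.i X), a6, mul_comm Y1 S, a3]
  have e1 := i_mul S Y1
  clear a1 a3 a4 a5 a6
  grind only

theorem principal {A X X' Y' P R C1 C2 : M.Q} {f h1 h2 : M.A} (hf : Ty f A (P + R + X))
    (k1 : Ty h1 (P * X') C1) (k2 : Ty h2 (R * Y') C2) :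
    cut (P + R) X (X' * Y') f (del X' Y' P R ⊙ h1 + h2) =
    cut R (C1 + X) Y' (cut P (R + X) X' f h1) h2 := by
  have a1 := S3 Y' X' R P X
  have a2 := whA X (del X' Y' P R) (h1 + h2)
  have a3 := whM Y' (f * M.i X') (M.d X' P (R + X) ⊙ h1 + M.i (R + X))
  have a4 := whM Y' (M.d X' P (R + X)) (h1 + M.i (R + X))
  have a5 := dnat (Ty.i Y') (Ty.i R) (k1.add (Ty.i X))
  have a6 := splitA (k1.add (Ty.i X)) k2
  have s := del_symm X' Y' P R
  unfold cut
  rw [add_comm (M.cmp _ _) (M.i X), a2, mul_comm (M.cmp _ _) (M.i Y'), a3, a4,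
    show M.i X + (h1 + h2) = h1 + M.i X + h2 by ac_rfl, ← a6]
  clear a2 a3 a4 a6
  rw [s, mul_comm X' Y', add_comm P R]
  simp only [i_mul, i_add] at *
  rw [show M.i Y' * (f * M.i X') = f * (M.i Y' * M.i X') by ac_rfl]
  rw [show h1 + (M.i R + M.i X) = M.i R + (h1 + M.i X) by ac_rfl]
  have a1' : ∀ t, M.cmp (M.i Y' * M.d X' P (R + X)) (M.cmp (M.d Y' R (X' * P + X)) t) =
    M.cmp (M.d (Y' * X') (R + P) X) (M.cmp (del Y' X' R P + M.i X) t) := by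
    intro t; rw [← ca, a1, ca]
  have a5' : ∀ t, M.cmp (M.i Y' * (M.i R + (h1 + M.i X))) (M.cmp (M.d Y' R (C1 + X)) t) =
    M.cmp (M.d Y' R (P * X' + X)) (M.cmp (M.i Y' * M.i R + (h1 + M.i X)) t) := by
    intro t; rw [← ca, a5, ca]
  simp only [ca]
  rw [a5', mul_comm P X', a1', add_comm (M.i X) (del _ _ _ _)]
  congr 4
  · ac_rfl
  · ac_rfl
end FS
end

section
namespace FS
variable {L : Type} {M : FS L}

theorem split4 {X Y X' Y' : M.Q} (n : M.N (X * Y)) (h : X * Y = X' * Y') {s t : Set L}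
    (h1 : ∀ a ∈ M.ms X', a ∈ s ∧ a ∉ t) (h2 : ∀ a ∈ M.ms Y', a ∈ t ∧ a ∉ s) :
    X = M.res s X * M.res t X ∧ Y = M.res s Y * M.res t Y ∧ X' = M.res s X * M.res s Y ∧
    Y' = M.res t X * M.res t Y := by
  have e1 := congrArg (M.res s) h
  rw [res_mul, res_mul, M.res_all s X' (fun a k => (h1 a k).1), res_none s Y' (fun a k => (h2 a k).2),
    mul_one] at e1
  have e2 := congrArg (M.res t) h
  rw [res_mul, res_mul, M.res_all t Y' (fun a k => (h2 a k).1), res_none t X' (fun a k => (h1 a k).2),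
    one_mul] at e2
  have n := (N_mul.1 n).2.2
  rw [Multiset.disjoint_left] at n
  have e : ∀ {u : Set L} {r : Set L} {Z : M.Q}, (∀ a ∈ M.ms Z, a ∈ r) →
      M.res r (M.res u Z) = M.res u Z := fun {u r Z} k =>
    M.res_all _ _ fun a ha => k a ((M.res_mem _ _ _).1 ha).1
  have e' : ∀ {u : Set L} {r : Set L} {Z : M.Q}, (∀ a ∈ M.ms Z, a ∉ r) →
      M.res r (M.res u Z) = 1 := fun {u r Z} k =>
    res_none _ _ fun a ha => k a ((M.res_mem _ _ _).1 ha).1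
  rw [← e1, ← e2] at h
  have e3 := congrArg (M.res (lt X)) h
  have e4 := congrArg (M.res (lt Y)) h
  have k1 : ∀ a ∈ M.ms X, a ∈ lt X := fun _ h => h
  have k2 : ∀ a ∈ M.ms Y, a ∈ lt Y := fun _ h => h
  have k3 : ∀ a ∈ M.ms Y, a ∉ lt X := fun _ h h' => n h' h
  have k4 : ∀ a ∈ M.ms X, a ∉ lt Y := fun _ h h' => n h h'
  simp only [res_mul] at e3 e4
  rw [M.res_all _ X k1, res_none _ Y k3, e k1, e k1, e' k3, e' k3, mul_one, mul_one, mul_one] at e3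
  rw [M.res_all _ Y k2, res_none _ X k4, e k2, e k2, e' k4, e' k4, one_mul, one_mul, one_mul] at e4
  exact ⟨e3, e4, e1.symm, e2.symm⟩

theorem split4A {X Y X' Y' : M.Q} (n : M.N (X + Y)) (h : X + Y = X' + Y') {s t : Set L}
    (h1 : ∀ a ∈ M.ms X', a ∈ s ∧ a ∉ t) (h2 : ∀ a ∈ M.ms Y', a ∈ t ∧ a ∉ s) :
    X = M.res s X + M.res t X ∧ Y = M.res s Y + M.res t Y ∧ X' = M.res s X + M.res s Y ∧
    Y' = M.res t X + M.res t Y := split4 (M := M.op) n h h1 h2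

theorem ne1 {X : M.Q} : X ≠ 1 ↔ 0 < (M.ms X).card := by
  rw [Multiset.card_pos, not_iff_not]
  exact ⟨fun h => h ▸ M.ms_e, M.ms_zero X⟩

theorem prime_dvd {B Y S T : M.Q} (hp : ∀ S T, B = S * T → S = 1 ∨ T = 1) (n : M.N (B * Y))
    (h : B * Y = S * T) : (∃ S', S = B * S') ∨ ∃ T', T = B * T' := by
  have nd := (N_mul.1 (h ▸ n)).2.2
  obtain ⟨a, b, c, d⟩ := split4 n h (s := lt S) (t := lt T)
    (fun a ha => ⟨ha, fun h => Multiset.disjoint_left.1 nd ha h⟩)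
    (fun a ha => ⟨ha, fun h => Multiset.disjoint_left.1 nd h ha⟩)
  rcases hp _ _ a with k | k
  · rw [k, one_mul] at a; rw [← a] at d; exact Or.inr ⟨_, d⟩
  · rw [k, mul_one] at a; rw [← a] at c; exact Or.inl ⟨_, c⟩

theorem prime_dvdA {B Y S T : M.Q} (hp : ∀ S T, B = S + T → S = 1 ∨ T = 1) (n : M.N (B + Y))
    (h : B + Y = S + T) : (∃ S', S = B + S') ∨ ∃ T', T = B + T' :=
  prime_dvd (M := M.op) hp n h

theorem sum_prime {P R : M.Q} (n : M.N (P + R)) (h1 : P ≠ 1) (h2 : R ≠ 1) (S T : M.Q)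
    (h : P + R = S * T) : S = 1 ∨ T = 1 := by
  rcases M.prime P R S T n h with h | h | h | h
  · exact absurd h h1
  · exact absurd h h2
  · exact Or.inl h
  · exact Or.inr h

theorem add_cancel {X B B' : M.Q} (n : M.N (X + B)) (h : X + B = X + B') : B = B' :=
  mul_cancel (M := M.op) n h

/-- middle condition -/
def mid (P R : M.Q) : Prop := (P ≠ 1 ∧ R ≠ 1) ∨ (P = 1 ∧ R = 1)

def Left (f : M.A) : Prop := ∃ X Y P R C D f1 f2, f = del X Y P R ⊙ f1 + f2 ∧ M.H f1 (X * P) C ∧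
  M.H f2 (Y * R) D ∧ X * P ≠ 1 ∧ Y * R ≠ 1 ∧ mid P R
def Right (f : M.A) : Prop := ∃ A N U V S T f1 f2, f = f1 * f2 ⊙ lam A N U V ∧ M.H f1 S (A + U) ∧
  M.H f2 T (N + V) ∧ A + U ≠ 1 ∧ N + V ≠ 1 ∧ mid A N
def OK (f : M.A) : Prop := (∃ X, (M.ms X).card ≤ 1 ∧ f = M.i X) ∨ Left f ∨ Right f

theorem op_Left {f : M.A} : Left (M := M.op) f ↔ Right f := by
  constructor
  · rintro ⟨X, Y, P, R, C, D, f1, f2, e, h1, h2, h3, h4, h5⟩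
    replace e := e.trans (congrArg (fun z => M.cmp (M.anA f1 f2) z) (op_del (M := M) X Y P R))
    rw [mul_comm] at h1 h2 h3 h4
    exact ⟨P, R, X, Y, C, D, f1, f2, e, h1, h2, h3, h4, h5⟩
  · rintro ⟨P, R, X, Y, C, D, f1, f2, e, h1, h2, h3, h4, h5⟩
    replace e := e.trans (congrArg (fun z => M.cmp (M.anA f1 f2) z) (op_del (M := M) X Y P R).symm)
    rw [add_comm] at h1 h2 h3 h4
    exact ⟨X, Y, P, R, C, D, f1, f2, e, h1, h2, h3, h4, h5⟩
theorem op_Right {f : M.A} : Right (M := M.op) f ↔ Left f := op_Left (M := M.op) |>.symm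
theorem op_OK {f : M.A} : OK (M := M.op) f ↔ OK f := by
  unfold OK
  rw [op_Left, op_Right, _root_.or_comm (a := Left f)]
  rfl

theorem N_left {X Y : M.Q} (h : M.N (X * Y)) : M.N X := (N_mul.1 h).1
theorem H.N {f : M.A} {X Y : M.Q} (h : M.H f X Y) : M.N X := M.H_N h

theorem H.cut {A B X Y C : M.Q} {f h : M.A} (hf : M.H f A (B + X)) (hh : M.H h (B * Y) C)
    (n : M.N (A * Y)) : M.H (cut B X Y f h) (A * Y) (C + X) := by
  have e := M.H_ms hf
  have e' := M.H_ms hh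
  have k1 : M.H (f * M.i Y) (A * Y) ((B + X) * Y) := M.H_an hf (M.H_i Y (N_mul.1 n).2.1) n
  unfold FS.N at n
  rw [ms_mul] at e'
  rw [ms_add] at e
  rw [ms_mul, e] at n
  have k2 := M.H_d Y B X (by rw [M.ms_an, M.ms_or]; rwa [add_comm])
  have n' : (M.ms (Y * B + X)).Nodup := by
    rw [ms_add, ms_mul]; convert n using 1; rw [add_comm (M.ms Y)]; ac_rfl
  rw [show (B + X) * Y = Y * (B + X) from mul_comm _ _] at k1
  have hh' : M.H h (Y * B) C := by rw [mul_comm]; exact hh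
  refine M.H_cmp k1 (M.H_cmp k2 (M.H_or hh' (M.H_i X ?_) n'))
  exact (N_add.1 n').2.1

theorem cut_id {A B X : M.Q} {f : M.A} (h : M.H f A (B + X)) : cut B X 1 f (M.i B) = f := by
  unfold cut
  rw [i_one, mul_one, d_l', ← i_add, i_cm (Ty.i _), cm_i h.ty]

theorem H.left {X Y P R C D A B : M.Q} {f1 f2 : M.A} (h : M.H (del X Y P R ⊙ f1 + f2) A B)
    (h1 : M.H f1 (X * P) C) (h2 : M.H f2 (Y * R) D) : A = X * Y * (P + R) ∧ B = C + D :=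
  M.H_uniq h ((Ty.del X Y P R).cmp (h1.ty.add h2.ty) h.ne)
theorem H.right {A N U V S T X Y : M.Q} {f1 f2 : M.A} (h : M.H (f1 * f2 ⊙ lam A N U V) X Y)
    (h1 : M.H f1 S (A + U)) (h2 : M.H f2 T (N + V)) : X = S * T ∧ Y = A * N + V + U :=
  M.H_uniq h ((h1.ty.mul h2.ty).cmp (Ty.lam A N U V) h.ne)

theorem cut_prime {n : ℕ} {A B X Y C : M.Q} {f h : M.A}
    (ih : ∀ f X Y, M.H f X Y → (M.ms X).card < n → OK f)
    (ih' : ∀ A B' X Y C f h, (M.ms B').card < (M.ms B).card → B' ≠ 1 → M.H f A (B' + X) →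
      M.H h (B' * Y) C → M.N (A * Y) → (M.ms (A * Y)).card ≤ n → OK f → OK h → OK (cut B' X Y f h))
    (hB : B ≠ 1) (hp : ∀ S T, B = S * T → S = 1 ∨ T = 1) (hf : M.H f A (B + X)) (hh : M.H h (B * Y) C)
    (nd : M.N (A * Y)) (hn : (M.ms (A * Y)).card ≤ n) (of : OK f) (oh : OK h) :
    OK (cut B X Y f h) := by
  have ef := M.H_ms hf
  have hB' := ne1.1 hB
  have hA : A ≠ 1 := by
    rw [ne1, ef, ms_add, Multiset.card_add]; omega
  have pushl : ∀ (X' Y' P R C1 C2 : M.Q) h1 h2, M.H h1 (X' * P) C1 → M.H h2 (Y' * R) C2 →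
      Y' * R ≠ 1 → mid P R → B * Y = X' * Y' * (P + R) → (∃ Z, X' = B * Z) →
      OK (cut B X Y f (del X' Y' P R ⊙ h1 + h2)) := by
    rintro X' Y' P R C1 C2 h1 h2 k1 k2 k4 k5 e ⟨Y1, rfl⟩
    have : Y = Y1 * Y' * (P + R) := by
      refine mul_cancel hh.N (e.trans ?_)
      simp only [mul_assoc]
    subst this
    rw [pushL hf.ty k1.ty k2.ty]
    refine Or.inr (Or.inl ⟨_, _, _, _, C1 + X, _, _, _, rfl, ?_, k2, ?_, k4, k5⟩)
    · have k1' : M.H h1 (B * (Y1 * P)) C1 := by rw [← mul_assoc]; exact k1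
      rw [mul_assoc]
      apply H.cut hf k1'
      have := N_mul.1 nd
      simp only [N_mul, N_add, ms_mul, ms_add, Multiset.disjoint_add_right, Multiset.disjoint_add_left] at this ⊢
      tauto
    · rw [ne1] at hA ⊢
      simp only [ms_mul, Multiset.card_add]; omega
  have pushr : ∀ (A' N U V S T : M.Q) h1 h2, M.H h1 S (A' + U) → M.H h2 T (N + V) →
      A' + U ≠ 1 → N + V ≠ 1 → mid A' N → B * Y = S * T → (∃ Z, S = B * Z) →
      OK (cut B X Y f (h1 * h2 ⊙ lam A' N U V)) := by
    rintro A' N U V S T h1 h2 k1 k2 k3 k4 k5 e ⟨Y1, rfl⟩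
    have : Y = Y1 * T := by
      refine mul_cancel hh.N (e.trans ?_)
      simp only [mul_assoc]
    subst this
    rw [pushR hf.ty k1.ty k2.ty]
    refine Or.inr (Or.inr ⟨_, _, _, _, A * Y1, _, _, _, rfl, ?_, k2, ?_, k4, k5⟩)
    · rw [← add_assoc]
      apply H.cut hf k1
      have := N_mul.1 nd
      simp only [N_mul, N_add, ms_mul, ms_add, Multiset.disjoint_add_right] at this ⊢
      tauto
    · rw [ne1] at k3 ⊢
      simp only [ms_add, Multiset.card_add] at k3 ⊢; omega
  rcases oh with ⟨Z, c, rfl⟩ | ⟨X', Y', P, R, C1, C2, h1, h2, rfl, k1, k2, k3, k4, k5⟩ |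
    ⟨A', N, U, V, S, T, h1, h2, rfl, k1, k2, k3, k4, k5⟩
  · obtain ⟨e1, e2⟩ := M.H_uniq hh ((Ty.i Z) hh.ne)
    subst e1
    have : Y = 1 := by
      rw [ms_mul, Multiset.card_add] at c
      by_contra hY
      rw [← Ne, ne1] at hY
      omega
    subst this
    rw [mul_one, cut_id hf]; exact of
  · have e := (H.left hh k1 k2).1
    have key : (∃ Z, X' * Y' = B * Z) ∨ (∃ Z, P + R = B * Z) := prime_dvd hp hh.N e
    rcases key with ⟨Z, hZ⟩ | ⟨Z, hZ⟩
    · have nz : M.N (X' * Y') := N_left (show M.N (X' * Y' * (P + R)) from e ▸ hh.N)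
      rcases prime_dvd hp (hZ ▸ nz) hZ.symm with h | h
      · exact pushl _ _ _ _ _ _ _ _ k1 k2 k4 k5 e h
      · rw [del_symm, add_comm h1]
        refine pushl _ _ _ _ _ _ _ _ k2 k1 k3 ?_ ?_ h
        · unfold mid at *; tauto
        · rw [e]; ac_rfl
    · rcases k5 with ⟨p1, p2⟩ | ⟨p1, p2⟩
      · have nz : M.N (P + R) := by
          have := hh.N; rw [e] at this; exact (N_mul.1 this).2.1
        rcases sum_prime nz p1 p2 _ _ hZ with h | h
        · exact absurd h hB
        · rw [h, mul_one] at hZ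
          subst hZ
          have : Y = X' * Y' := by
            refine mul_cancel hh.N (e.trans ?_)
            rw [mul_comm]
          subst this
          have k1' : M.H h1 (P * X') C1 := by rw [mul_comm]; exact k1
          have k2' : M.H h2 (R * Y') C2 := by rw [mul_comm]; exact k2
          rw [principal hf.ty k1'.ty k2'.ty]
          rw [add_assoc] at hf
          have nd' : M.N (A * X') := by
            rw [← mul_assoc] at nd; exact N_left nd
          have hg := H.cut hf k1' nd'
          rw [show C1 + (R + X) = R + (C1 + X) by ac_rfl] at hg
          rw [ne1] at p1 p2 k3 k4
          simp only [ms_mul, ms_add, Multiset.card_add] at *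
          have nf := congrArg Multiset.card ef
          simp only [Multiset.card_add] at nf
          have o1 : OK h1 := ih _ _ _ k1 (by rw [ms_mul, Multiset.card_add]; omega)
          have o2 : OK h2 := ih _ _ _ k2 (by rw [ms_mul, Multiset.card_add]; omega)
          have og : OK (FS.cut P (R + X) X' f h1) := by
            refine ih' _ _ _ _ _ _ _ (by omega) (by rw [ne1]; omega) hf k1' nd' ?_ of o1
            omega
          refine ih' _ _ _ _ _ _ _ (by omega) (by rw [ne1]; omega) hg k2' ?_ ?_ og o2
          · rw [mul_assoc]; exact nd
          · simp only [ms_mul, Multiset.card_add]; omega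
      · rw [p1, p2, one_add] at hZ
        have := congrArg (fun Z => (M.ms Z).card) hZ
        simp only [ms_mul, ms_one, Multiset.card_add, Multiset.card_zero] at this
        omega
  · have e := (H.right hh k1 k2).1
    rcases prime_dvd hp hh.N e with h | h
    · exact pushr _ _ _ _ _ _ _ _ k1 k2 k3 k4 k5 e h
    · rw [lam_symm, mul_comm h1]
      refine pushr _ _ _ _ _ _ _ _ k2 k1 k4 k3 ?_ ?_ h
      · unfold mid at *; tauto
      · rw [e]; ac_rfl

theorem cut_OK {n : ℕ} (ih : ∀ f X Y, M.H f X Y → (M.ms X).card < n → OK f) (k : ℕ) :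
    ∀ (A B X Y C : M.Q) f h, (M.ms B).card < k → B ≠ 1 → M.H f A (B + X) →
      M.H h (B * Y) C → M.N (A * Y) → (M.ms (A * Y)).card ≤ n → OK f → OK h → OK (cut B X Y f h) := by
  induction k with
  | zero => intro _ _ _ _ _ _ _ h; omega
  | succ k ihk =>
    intro A B X Y C f h hk hB hf hh nd hn of oh
    have ih' : ∀ A B' X Y C f h, (M.ms B').card < (M.ms B).card → B' ≠ 1 → M.H f A (B' + X) →
      M.H h (B' * Y) C → M.N (A * Y) → (M.ms (A * Y)).card ≤ n → OK f → OK h → OK (cut B' X Y f h) := by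
      intro A B' X Y C f h hb
      exact ihk A B' X Y C f h (by omega)
    have nB : M.N B := N_left hh.N
    rcases M.cases B with c | ⟨P, R, p, r, rfl⟩ | ⟨P, R, p, r, rfl⟩
    · refine cut_prime ih ih' hB ?_ hf hh nd hn of oh
      rintro S T rfl
      by_contra hc
      push Not at hc
      rw [ne1, ne1] at hc
      rw [ms_mul, Multiset.card_add] at c
      omega
    · have nd' : M.N (C + X) := by
        have := M.H_ms (H.cut hf hh nd)
        unfold FS.N; rw [← this]; exact nd
      have hn' : (M.ms (C + X)).card ≤ n := by
        have := M.H_ms (H.cut hf hh nd)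
        rw [← this]; exact hn
      refine (congrArg (OK (M := M)) (op_cut (M := M) _ _ _ h f)).mp (op_OK.1 ?_)
      refine cut_prime (M := M.op) (n := n) ?_ ?_ hB ?_ hh hf nd' hn' (op_OK.2 oh) (op_OK.2 of)
      · intro f X Y k hc
        refine op_OK.2 (ih _ _ _ k ?_)
        rw [M.H_ms k]; exact hc
      · intro (A : M.Q) (B' : M.Q) (X : M.Q) (Y : M.Q) (C : M.Q) (f : M.A) (h : M.A) hb hb' k1 k2 k3 k4 o1 o2
        replace o1 := op_OK.1 o1
        replace o2 := op_OK.1 o2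
        refine op_OK.2 ((congrArg (OK (M := M)) (op_cut (M := M) _ _ _ f h)).mpr ?_)
        have e1' := M.H_ms k1
        have e2' := M.H_ms k2
        change M.ms (M.an B' X) = M.ms A at e1'
        change M.ms C = M.ms (M.or B' Y) at e2'
        change (M.ms (M.or A Y)).Nodup at k3
        change (M.ms (M.or A Y)).card ≤ n at k4
        have e3 : M.ms (M.an C X) = M.ms (M.or A Y) := by
          rw [M.ms_an, e2', M.ms_or, M.ms_or, ← e1', M.ms_an]; ac_rfl
        refine ih' _ _ _ _ _ _ _ hb hb' k2 k1 ?_ ?_ o2 o1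
        · show (M.ms (M.an C X)).Nodup; rw [e3]; exact k3
        · show (M.ms (M.an C X)).card ≤ n; rw [e3]; exact k4
      · intro S T e
        exact sum_prime (M := M.op) nB p r S T e
    · exact cut_prime ih ih' hB (sum_prime nB p r) hf hh nd hn of oh

theorem ok_an {f g : M.A} {Z W : M.Q} (h : M.H (f * g) Z W) (of : OK f) (og : OK g) : OK (f * g) := by
  obtain ⟨X, Y, X', Y', h1, h2, e1, e2⟩ := M.H_an' h
  by_cases c1 : X = 1
  · subst c1
    obtain ⟨rfl, -⟩ := M.one h1 (by rw [ms_one]; simp)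
    rw [i_one, one_mul]; exact og
  by_cases c2 : X' = 1
  · subst c2
    obtain ⟨rfl, -⟩ := M.one h2 (by rw [ms_one]; simp)
    rw [i_one, mul_one]; exact of
  have c1' : Y ≠ 1 := by rw [ne1, ← M.H_ms h1]; exact ne1.1 c1
  have c2' : Y' ≠ 1 := by rw [ne1, ← M.H_ms h2]; exact ne1.1 c2
  refine Or.inr (Or.inr ⟨Y, Y', 1, 1, X, X', f, g, ?_, ?_, ?_, ?_, ?_, Or.inl ⟨c1', c2'⟩⟩)
  · rw [lam_11, cm_i (h1.ty.mul h2.ty)]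
  · rw [add_one]; exact h1
  · rw [add_one]; exact h2
  · rwa [add_one]
  · rwa [add_one]

theorem ok_or {f g : M.A} {Z W : M.Q} (h : M.H (f + g) Z W) (of : OK f) (og : OK g) : OK (f + g) := by
  rw [← op_OK] at *
  exact ok_an (M := M.op) h of og

theorem N_d {X Y Z W : M.Q} {f : M.A} (h : M.H f (X * (Y + Z)) W) : M.N X ∧ M.N Y ∧ M.N Z ∧
    M.N (X * Y) ∧ M.N (Y + Z) := by
  have := h.N
  simp only [N_mul, N_add, ms_add, Multiset.disjoint_add_right] at *
  tauto

theorem ok_i_aux (n : ℕ) : ∀ X : M.Q, (M.ms X).card < n → M.N X → OK (M.i X) := by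
  induction n with
  | zero => intro _ h; omega
  | succ n ih =>
    intro X hX nX
    rcases M.cases X with c | ⟨P, R, p, r, rfl⟩ | ⟨P, R, p, r, rfl⟩
    · exact Or.inl ⟨_, c, rfl⟩
    · change M.N (P * R) at nX
      change (M.ms (P * R)).card < _ at hX
      change P ≠ 1 at p
      change R ≠ 1 at r
      rw [ne1] at p r
      rw [ms_mul, Multiset.card_add] at hX
      have := M.H_i _ nX
      change OK (M.i (P * R))
      rw [i_mul] at *
      exact ok_an this (ih _ (by omega) (N_mul.1 nX).1) (ih _ (by omega) (N_mul.1 nX).2.1)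
    · change M.N (P + R) at nX
      change (M.ms (P + R)).card < _ at hX
      change P ≠ 1 at p
      change R ≠ 1 at r
      rw [ne1] at p r
      rw [ms_add, Multiset.card_add] at hX
      have := M.H_i _ nX
      change OK (M.i (P + R))
      rw [i_add] at *
      exact ok_or this (ih _ (by omega) (N_add.1 nX).1) (ih _ (by omega) (N_add.1 nX).2.1)

theorem ok_i (X : M.Q) (h : M.N X) : OK (M.i X) := ok_i_aux _ X (Nat.lt_succ_self _) h

theorem ok_d {X Y Z U W : M.Q} (h : M.H (M.d X Y Z) U W) : OK (M.d X Y Z) := by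
  have := Ty.d X Y Z h.ne
  obtain ⟨n1, n2, n3, n4, n5⟩ := N_d this
  by_cases c1 : X = 1
  · subst c1; rw [d_l', ← i_add]; exact ok_i _ n5
  by_cases c2 : Z = 1
  · subst c2; rw [d_r', ← i_mul]; exact ok_i _ n4
  refine Or.inr (Or.inl ?_)
  by_cases c3 : Y = 1
  · subst c3
    refine ⟨X, Z, 1, 1, X, Z, M.i X, M.i Z, ?_, ?_, ?_, ?_, ?_, Or.inr ⟨rfl, rfl⟩⟩
    rotate_left
    · rw [mul_one]; exact M.H_i _ n1
    · rw [mul_one]; exact M.H_i _ n3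
    · rwa [mul_one]
    · rwa [mul_one]
    · rw [del_mix, ← i_add, cm_i ((Ty.d X 1 Z).conv rfl (by rw [mul_one]))]
  · refine ⟨1, X, Z, Y, Z, X * Y, M.i Z, M.i (X * Y), ?_, ?_, ?_, ?_, ?_, Or.inl ⟨c2, c3⟩⟩
    rotate_left
    · rw [one_mul]; exact M.H_i _ n3
    · exact M.H_i _ n4
    · rwa [one_mul]
    · have := ne1.1 c1; rw [ne1, ms_mul, Multiset.card_add]; omega
    · rw [del_1, ← i_add, cm_i ((Ty.d X Y Z).conv rfl (by rw [add_comm]))]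

theorem all_OK (n : ℕ) : ∀ f X Y, M.H f X Y → (M.ms X).card < n → OK f := by
  induction n with
  | zero => intro _ _ _ _ h; omega
  | succ n ih =>
    intro f X Y h
    refine M.ind (fun f => ∀ X Y, M.H f X Y → (M.ms X).card < n + 1 → OK f) ?_ ?_ ?_ ?_ ?_ f X Y h X Y h
    · intro X n _ _ _ _; exact ok_i X n
    · intro X Y Z _ _ h _; exact ok_d h
    · intro f g of og X Y h hn
      obtain ⟨_, _, _, _, h1, h2, rfl, rfl⟩ := M.H_an' h
      rw [M.ms_an, Multiset.card_add] at hn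
      exact ok_an h (of _ _ h1 (by omega)) (og _ _ h2 (by omega))
    · intro f g of og X Y h hn
      obtain ⟨_, _, _, _, h1, h2, rfl, rfl⟩ := M.H_or' h
      rw [M.ms_or, Multiset.card_add] at hn
      exact ok_or h (of _ _ h1 (by omega)) (og _ _ h2 (by omega))
    · intro f g of og X Y h hn
      obtain ⟨Z, h1, h2⟩ := M.H_cmp' h
      have o1 := of _ _ h1 hn
      have o2 := og _ _ h2 (by rw [← M.H_ms h1]; exact hn)
      by_cases c : Z = 1
      · have c' : (M.ms X).card ≤ 1 := by rw [M.H_ms h1, c, ms_one]; simp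
        exact Or.inl ⟨X, c', (M.one h c').1⟩
      · have := cut_OK ih _ X Z 1 1 Y f g (Nat.lt_succ_self _) c (by rw [add_one]; exact h1)
          (by rw [mul_one]; exact h2) (by rw [mul_one]; exact h1.N) (by rw [mul_one]; omega) o1 o2
        unfold cut at this
        rwa [i_one, mul_one, add_oneA, d_l', i_one, add_oneA, ← ca, cm_i h1.ty] at this

theorem allOK {f : M.A} {X Y : M.Q} (h : M.H f X Y) : OK f := all_OK _ f X Y h (Nat.lt_succ_self _)
end FS
end

section
namespace FS
variable {L : Type} {M : FS L}

theorem lam_mix (U V : M.Q) : lam 1 1 U V = M.d U 1 V := by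
  unfold lam
  rw [d_l', i_one, one_addA, one_add, ← i_add, cm_i ((Ty.d V 1 U).conv rfl (by rw [mul_one])),
    mix_symm]

theorem H.mkL {X Y P R C D : M.Q} {f1 f2 : M.A} (h1 : M.H f1 (X * P) C) (h2 : M.H f2 (Y * R) D)
    (n : M.N (X * Y * (P + R))) : M.H (del X Y P R ⊙ f1 + f2) (X * Y * (P + R)) (C + D) := by
  unfold FS.N at n
  rw [ms_mul, ms_mul, ms_add] at n
  have nd : M.N (X * (Y * (R + P))) := by
    unfold FS.N; rw [ms_mul, ms_mul, ms_add, add_comm (M.ms R), ← add_assoc]; exact n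
  have k1 : M.H (M.d Y R P) (Y * (R + P)) (Y * R + P) := M.H_d Y R P (N_mul.1 nd).2.1
  have k2 : M.H (M.i X * M.d Y R P) (X * (Y * (R + P))) (X * (Y * R + P)) :=
    M.H_an (M.H_i X (N_mul.1 nd).1) k1 nd
  have k3 : M.H (M.d X P (Y * R)) (X * (P + Y * R)) (X * P + Y * R) := M.H_d _ _ _ (by
    rw [M.ms_an, M.ms_or, ms_mul]; convert n using 1; ac_rfl)
  have k4 : M.H (f1 + f2) (X * P + Y * R) (C + D) := M.H_or h1 h2 (by
    rw [M.ms_or, ms_mul, ms_mul]; convert n using 1; ac_rfl)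
  rw [add_comm (Y * R)] at k2
  have := M.H_cmp (M.H_cmp k2 k3) k4
  rw [show X * Y * (P + R) = X * (Y * (R + P)) by ac_rfl]
  exact this

theorem H.mkR {A N U V S T : M.Q} {f1 f2 : M.A} (h1 : M.H f1 S (A + U)) (h2 : M.H f2 T (N + V))
    (n : M.N (S * T)) : M.H (f1 * f2 ⊙ lam A N U V) (S * T) (A * N + V + U) := by
  have n' : M.N (U + V + A * N) := by
    have e1 := M.H_ms h1
    have e2 := M.H_ms h2
    unfold FS.N at *
    rw [ms_mul, e1, e2, ms_add, ms_add] at n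
    rw [ms_add, ms_add, ms_mul]; convert n using 1; ac_rfl
  rw [add_comm] at h1 h2
  have := H.mkL (M := M.op) (X := U) (Y := V) (P := A) (R := N) h1 h2 n'
  have e : M.cmp (f1 * f2) (del (M := M.op) U V A N) = M.cmp (f1 * f2) (lam A N U V) :=
    congrArg _ (op_del U V A N)
  rw [← e, show A * N + V + U = U + V + A * N by ac_rfl]
  exact this

theorem eqA {X1 X2 Y1 Y2 P1 P2 R1 R2 C1 C2 D1 D2 : M.Q} {f11 f12 f21 f22 : M.A}
    (h11 : M.H f11 (X1 * P1) C1) (h12 : M.H f12 (X2 * P2) C2) (h21 : M.H f21 (Y1 * R1) D1)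
    (h22 : M.H f22 (Y2 * R2) D2) :
    del (X1 * X2) (Y1 * Y2) (P1 + P2) (R1 + R2) ⊙
      (del X1 X2 P1 P2 ⊙ f11 + f12) + (del Y1 Y2 R1 R2 ⊙ f21 + f22) =
    del (X1 * Y1) (X2 * Y2) (P1 + R1) (P2 + R2) ⊙
      (del X1 Y1 P1 R1 ⊙ f11 + f21) + (del X2 Y2 P2 R2 ⊙ f12 + f22) := by
  rw [← interA (Ty.del X1 X2 P1 P2) (h11.ty.add h12.ty) (Ty.del Y1 Y2 R1 R2) (h21.ty.add h22.ty),
    ← interA (Ty.del X1 Y1 P1 R1) (h11.ty.add h21.ty) (Ty.del X2 Y2 P2 R2) (h12.ty.add h22.ty),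
    ← ca, ← ca, EQ4, show f11 + f21 + (f12 + f22) = f11 + f12 + (f21 + f22) by ac_rfl]

theorem eqB {X1 X2 Y1 Y2 P R P' R' C1 C2 D1 D2 : M.Q} {f11 f12 f21 f22 : M.A}
    (h11 : M.H f11 (X1 * P * P') C1) (h12 : M.H f12 (X2 * R') C2) (h21 : M.H f21 (Y1 * R) D1)
    (h22 : M.H f22 Y2 D2) :
    del ((P' + R') * X1 * X2) (Y1 * Y2) P R ⊙
      (del (X1 * P) X2 P' R' ⊙ f11 + f12) + (del (Y1 * R) Y2 1 1 ⊙ f21 + f22) =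
    del ((P + R) * X1 * Y1) (X2 * Y2) P' R' ⊙
      (del (X1 * P') Y1 P R ⊙ f11 + f21) + (del (X2 * R') Y2 1 1 ⊙ f12 + f22) := by
  rw [← interA (Ty.del (X1 * P) X2 P' R') (h11.ty.add h12.ty) (Ty.del (Y1 * R) Y2 1 1)
    ((h21.ty.add h22.ty).conv (by rw [mul_one, mul_one]) rfl),
    ← interA (Ty.del (X1 * P') Y1 P R) ((h11.ty.add h21.ty).conv (by ac_rfl) rfl)
      (Ty.del (X2 * R') Y2 1 1) ((h12.ty.add h22.ty).conv (by rw [mul_one, mul_one]) rfl),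
    ← ca, ← ca, del_mix, del_mix, EQ5,
    show f11 + f21 + (f12 + f22) = f11 + f12 + (f21 + f22) by ac_rfl]

theorem eqC {X1 X2 Y1 Y2 P R A N U1 U2 V1 V2 : M.Q} {f11 f12 f21 f22 : M.A}
    (h11 : M.H f11 (X1 * P) (A + U1)) (h12 : M.H f12 X2 (N + V1)) (h21 : M.H f21 (Y1 * R) U2)
    (h22 : M.H f22 Y2 V2) :
    del (X1 * X2) (Y1 * Y2) P R ⊙
      (f11 * f12 ⊙ lam A N U1 V1) + (f21 * f22 ⊙ lam 1 1 U2 V2) =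
    (del X1 Y1 P R ⊙ f11 + f21) * (del X2 Y2 1 1 ⊙ f12 + f22) ⊙ lam A N (U1 + U2) (V1 + V2) := by
  rw [lam_mix, del_mix]
  rw [← interA (h11.ty.mul h12.ty) (Ty.lam A N U1 V1) (h21.ty.mul h22.ty)
    ((Ty.d U2 1 V2).conv (by rw [one_add]) rfl)]
  have a1 := EQ6a X1 X2 Y1 Y2 P R
  have a2 := delnat h12.ty h22.ty h11.ty h21.ty
  have a3 := EQ6 A N U1 U2 V1 V2
  have a4 := dnat h12.ty (Ty.i 1) h22.ty
  rw [i_one, one_addA, mul_one] at a4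
  have a5 := splitM (Ty.del X1 Y1 P R) ((h12.ty.mul h22.ty).cmp
    ((Ty.d (N + V1) 1 V2).conv (by rw [one_add]) rfl))
  have a6 := interM (Ty.i (X2 * Y2)) ((h12.ty.mul h22.ty).cmp
    ((Ty.d (N + V1) 1 V2).conv (by rw [one_add]) rfl)) (Ty.del X1 Y1 P R) (h11.ty.add h21.ty)
  rw [i_cm ((h12.ty.mul h22.ty).cmp
    ((Ty.d (N + V1) 1 V2).conv (by rw [one_add]) rfl)), a4] at a6
  have a7 := interM (h12.ty.mul h22.ty) ((Ty.d (N + V1) 1 V2).conv (by rw [one_add]) rfl)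
    (h11.ty.add h21.ty) (Ty.i _)
  rw [cm_i (h11.ty.add h21.ty), a4] at a7
  rw [mul_comm (M.cmp _ _), ← a6, ← a7, a1]
  rw [add_assoc A] at *
  rw [mul_comm f11 f12, mul_comm f21 f22]
  generalize lam A N U1 V1 = l1 at *
  generalize lam A N (U1 + U2) (V1 + V2) = l2 at *
  generalize del X1 Y1 P R = l3 at *
  generalize del X2 Y2 (X1 * P) (Y1 * R) = l4 at *
  generalize del (N + V1) V2 (A + U1) U2 = l5 at *
  simp only [ca]
  rw [← M.cmp_assoc l4, ← a2, ca, a3]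

theorem st_ex {X Y : M.Q} (n : M.N (X * Y)) : ∃ s t : Set L, (∀ a ∈ M.ms X, a ∈ s ∧ a ∉ t) ∧
    (∀ a ∈ M.ms Y, a ∈ t ∧ a ∉ s) := by
  have nd := (N_mul.1 n).2.2
  exact ⟨lt X, lt Y, fun a ha => ⟨ha, fun h => Multiset.disjoint_left.1 nd ha h⟩,
    fun a ha => ⟨ha, fun h => Multiset.disjoint_left.1 nd h ha⟩⟩

theorem restr {f : M.A} {X Y : M.Q} (s : Set L) (h : M.H f X Y) : ∃ f', M.H f' (M.res s X) (M.res s Y) :=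
  M.res_H s h

theorem N_hf {f : M.A} {X Y : M.Q} (h : M.H f X Y) : M.N Y := by
  unfold FS.N; rw [← M.H_ms h]; exact M.H_N h

theorem LLa {n : ℕ} (ih : ∀ (f g : M.A) X Y, M.H f X Y → M.H g X Y → (M.ms X).card < n → f = g)
    {X Y P R C D X' Y' P' R' C' D' : M.Q} {f1 f2 g1 g2 : M.A}
    (h1 : M.H f1 (X * P) C) (h2 : M.H f2 (Y * R) D) (k1 : M.H g1 (X' * P') C')
    (k2 : M.H g2 (Y' * R') D') (nd : M.N (X * Y * (P + R))) (n1 : (M.ms (X * P)).card < n)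
    (n2 : (M.ms (Y * R)).card < n) (n3 : (M.ms (X' * P')).card < n) (n4 : (M.ms (Y' * R')).card < n)
    (e1 : X * Y = X' * Y') (e2 : P + R = P' + R') (e3 : C + D = C' + D') :
    del X Y P R ⊙ f1 + f2 = del X' Y' P' R' ⊙ g1 + g2 := by
  have nd' : M.N (X' * P' * (Y' * R')) := by
    rw [e1, e2] at nd; unfold FS.N at *; simp only [ms_mul, ms_add] at *; convert nd using 1; ac_rfl
  obtain ⟨s, t, hs, ht⟩ := st_ex nd'
  have m1 := M.H_ms k1
  have m2 := M.H_ms k2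
  obtain ⟨a1, a2, a3, a4⟩ := split4 (N_mul.1 nd).1 e1 (s := s) (t := t)
    (fun a ha => hs a (by rw [ms_mul]; exact Multiset.mem_add.2 (Or.inl ha)))
    (fun a ha => ht a (by rw [ms_mul]; exact Multiset.mem_add.2 (Or.inl ha)))
  obtain ⟨b1, b2, b3, b4⟩ := split4A (N_mul.1 nd).2.1 e2 (s := s) (t := t)
    (fun a ha => hs a (by rw [ms_mul]; exact Multiset.mem_add.2 (Or.inr ha)))
    (fun a ha => ht a (by rw [ms_mul]; exact Multiset.mem_add.2 (Or.inr ha)))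
  obtain ⟨c1, c2, c3, c4⟩ := split4A (N_hf (H.mkL h1 h2 nd)) e3 (s := s) (t := t)
    (fun a ha => hs a (by rw [m1]; exact ha))
    (fun a ha => ht a (by rw [m2]; exact ha))
  obtain ⟨f11, h11⟩ := restr s h1
  obtain ⟨f12, h12⟩ := restr t h1
  obtain ⟨f21, h21⟩ := restr s h2
  obtain ⟨f22, h22⟩ := restr t h2
  rw [res_mul] at h11 h12 h21 h22
  clear hs ht
  generalize M.res s X = X1 at *
  generalize M.res t X = X2 at *
  generalize M.res s Y = Y1 at *
  generalize M.res t Y = Y2 at *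
  generalize M.res s P = P1 at *
  generalize M.res t P = P2 at *
  generalize M.res s R = R1 at *
  generalize M.res t R = R2 at *
  generalize M.res s C = C1 at *
  generalize M.res t C = C2 at *
  generalize M.res s D = D1 at *
  generalize M.res t D = D2 at *
  subst a1 a2 a3 a4 b1 b2 b3 b4 c1 c2 c3 c4
  rw [ih _ _ _ _ h1 (H.mkL h11 h12 h1.N) n1, ih _ _ _ _ h2 (H.mkL h21 h22 h2.N) n2,
    ih _ _ _ _ k1 (H.mkL h11 h21 k1.N) n3, ih _ _ _ _ k2 (H.mkL h12 h22 k2.N) n4]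
  exact eqA h11 h12 h21 h22

theorem LLb {n : ℕ} (ih : ∀ (f g : M.A) X Y, M.H f X Y → M.H g X Y → (M.ms X).card < n → f = g)
    {W Y P R C D W' Y' P' R' C' D' : M.Q} {f1 f2 g1 g2 : M.A}
    (h1 : M.H f1 ((P' + R') * W * P) C) (h2 : M.H f2 (Y * R) D)
    (k1 : M.H g1 ((P + R) * W' * P') C')
    (k2 : M.H g2 (Y' * R') D') (nd : M.N ((P' + R') * W * Y * (P + R)))
    (n1 : (M.ms ((P' + R') * W * P)).card < n)
    (n2 : (M.ms (Y * R)).card < n) (n3 : (M.ms ((P + R) * W' * P')).card < n)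
    (n4 : (M.ms (Y' * R')).card < n)
    (e1 : W * Y = W' * Y') (e3 : C + D = C' + D') :
    del ((P' + R') * W) Y P R ⊙ f1 + f2 = del ((P + R) * W') Y' P' R' ⊙ g1 + g2 := by
  have nd' : M.N ((P + R) * W' * P' * (Y' * R')) := by
    have : M.ms W + M.ms Y = M.ms W' + M.ms Y' := by rw [← ms_mul, ← ms_mul, e1]
    unfold FS.N at *; simp only [ms_mul, ms_add] at *; convert nd using 1
    calc _ = M.ms P + M.ms R + M.ms P' + M.ms R' + (M.ms W' + M.ms Y') := by ac_rfl
      _ = _ := by rw [← this]; ac_rfl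
  obtain ⟨s, t, hs, ht⟩ := st_ex nd'
  have m1 := M.H_ms k1
  have m2 := M.H_ms k2
  have nwy : M.N (W * Y) := by
    rw [show (P' + R') * W * Y * (P + R) = W * Y * ((P' + R') * (P + R)) by ac_rfl] at nd
    exact N_left nd
  simp only [ms_mul, ms_add, Multiset.mem_add] at hs ht
  obtain ⟨a1, a2, a3, a4⟩ := split4 nwy e1 (s := s) (t := t)
    (fun a ha => hs a (by tauto)) (fun a ha => ht a (by tauto))
  obtain ⟨c1, c2, c3, c4⟩ := split4A (N_hf (H.mkL h1 h2 nd)) e3 (s := s) (t := t)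
    (fun a ha => hs a (by rw [← m1] at ha; simp only [ms_mul, ms_add, Multiset.mem_add] at ha; exact ha))
    (fun a ha => ht a (by rw [← m2] at ha; simp only [ms_mul, Multiset.mem_add] at ha; exact ha))
  obtain ⟨f11, h11⟩ := restr s h1
  obtain ⟨f12, h12⟩ := restr t h1
  obtain ⟨f21, h21⟩ := restr s h2
  obtain ⟨f22, h22⟩ := restr t h2
  simp only [res_mul, res_add] at h11 h12 h21 h22
  have sP := M.res_all s P (fun a ha => (hs a (by tauto)).1)
  have sR := M.res_all s R (fun a ha => (hs a (by tauto)).1)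
  have sP' := M.res_all s P' (fun a ha => (hs a (by tauto)).1)
  have sR' := res_none s R' (fun a ha => (ht a (by tauto)).2)
  have tP := res_none t P (fun a ha => (hs a (by tauto)).2)
  have tR := res_none t R (fun a ha => (hs a (by tauto)).2)
  have tP' := res_none t P' (fun a ha => (hs a (by tauto)).2)
  have tR' := M.res_all t R' (fun a ha => (ht a (by tauto)).1)
  rw [sP, sP', sR', add_one] at h11
  rw [tP, tP', tR', one_add, mul_one] at h12
  rw [sR] at h21
  rw [tR, mul_one] at h22
  clear sP sR sP' sR' tP tR tP' tR'
  clear hs ht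
  generalize M.res s W = X1 at *
  generalize M.res t W = X2 at *
  generalize M.res s Y = Y1 at *
  generalize M.res t Y = Y2 at *
  generalize M.res s C = C1 at *
  generalize M.res t C = C2 at *
  generalize M.res s D = D1 at *
  generalize M.res t D = D2 at *
  subst a1 a2 a3 a4 c1 c2 c3 c4
  have h11' : M.H f11 (X1 * P * P') C1 := by
    rw [show X1 * P * P' = P' * X1 * P by ac_rfl]; exact h11
  have h11'' : M.H f11 (X1 * P' * P) C1 := by
    rw [show X1 * P' * P = P' * X1 * P by ac_rfl]; exact h11
  have h12' : M.H f12 (X2 * R') C2 := by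
    rw [mul_comm]; exact h12
  have w1 : (P' + R') * (X1 * X2) * P = X1 * P * X2 * (P' + R') := by ac_rfl
  have w2 : Y1 * Y2 * R = Y1 * R * Y2 * (1 + 1) := by rw [one_add, mul_one]; ac_rfl
  have w3 : (P + R) * (X1 * Y1) * P' = X1 * P' * Y1 * (P + R) := by ac_rfl
  have w4 : X2 * Y2 * R' = X2 * R' * Y2 * (1 + 1) := by rw [one_add, mul_one]; ac_rfl
  rw [w1] at h1 n1
  rw [w2] at h2 n2
  rw [w3] at k1 n3
  rw [w4] at k2 n4
  have j21 : M.H f21 (Y1 * R * 1) D1 := by rw [mul_one]; exact h21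
  have j22 : M.H f22 (Y2 * 1) D2 := by rw [mul_one]; exact h22
  have j12 : M.H f12 (X2 * R' * 1) C2 := by rw [mul_one]; exact h12'
  rw [ih _ _ _ _ h1 (H.mkL h11' h12' h1.N) n1, ih _ _ _ _ h2 (H.mkL j21 j22 h2.N) n2,
    ih _ _ _ _ k1 (H.mkL h11'' h21 k1.N) n3, ih _ _ _ _ k2 (H.mkL j12 j22 k2.N) n4]
  rw [← mul_assoc, ← mul_assoc]
  exact eqB h11' h12' h21 h22

theorem LRc {n : ℕ} (ih : ∀ (f g : M.A) X Y, M.H f X Y → M.H g X Y → (M.ms X).card < n → f = g)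
    {X Y P R C D S T A N U V : M.Q} {f1 f2 g1 g2 : M.A}
    (h1 : M.H f1 (X * P) (A * N + C)) (h2 : M.H f2 (Y * R) D)
    (k1 : M.H g1 ((P + R) * S) (A + U))
    (k2 : M.H g2 T (N + V)) (nd : M.N (X * Y * (P + R)))
    (n1 : (M.ms (X * P)).card < n)
    (n2 : (M.ms (Y * R)).card < n) (n3 : (M.ms ((P + R) * S)).card < n)
    (n4 : (M.ms T).card < n)
    (e1 : X * Y = S * T) (e3 : C + D = U + V) :
    del X Y P R ⊙ f1 + f2 = g1 * g2 ⊙ lam A N U V := by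
  have nd' : M.N ((P + R) * S * T) := by
    rw [mul_assoc, ← e1, mul_comm]; exact nd
  obtain ⟨s, t, hs, ht⟩ := st_ex nd'
  have m1 := M.H_ms k1
  have m2 := M.H_ms k2
  have hs' := hs
  have ht' := ht
  rw [m1] at hs'
  rw [m2] at ht'
  simp only [ms_mul, ms_add, Multiset.mem_add] at hs ht hs' ht'
  obtain ⟨a1, a2, a3, a4⟩ := split4 (N_left nd) e1 (s := s) (t := t)
    (fun a ha => hs a (by tauto)) (fun a ha => ht a (by tauto))
  have ncd : M.N (C + D) := by
    have := N_hf (H.mkL h1 h2 nd)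
    rw [add_assoc] at this
    exact (N_add.1 this).2.1
  obtain ⟨c1, c2, c3, c4⟩ := split4A ncd e3 (s := s) (t := t)
    (fun a ha => hs' a (by tauto)) (fun a ha => ht' a (by tauto))
  obtain ⟨f11, h11⟩ := restr s h1
  obtain ⟨f12, h12⟩ := restr t h1
  obtain ⟨f21, h21⟩ := restr s h2
  obtain ⟨f22, h22⟩ := restr t h2
  simp only [res_mul, res_add] at h11 h12 h21 h22
  have sP := M.res_all s P (fun a ha => (hs a (by tauto)).1)
  have sR := M.res_all s R (fun a ha => (hs a (by tauto)).1)
  have sA := M.res_all s A (fun a ha => (hs' a (by tauto)).1)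
  have sN := res_none s N (fun a ha => (ht' a (by tauto)).2)
  have tP := res_none t P (fun a ha => (hs a (by tauto)).2)
  have tR := res_none t R (fun a ha => (hs a (by tauto)).2)
  have tA := res_none t A (fun a ha => (hs' a (by tauto)).2)
  have tN := M.res_all t N (fun a ha => (ht' a (by tauto)).1)
  rw [sP, sA, sN, mul_one] at h11
  rw [tP, tA, tN, mul_one, one_mul] at h12
  rw [sR] at h21
  rw [tR, mul_one] at h22
  clear sP sR sA sN tP tR tA tN
  clear hs ht hs' ht'
  generalize M.res s X = X1 at *
  generalize M.res t X = X2 at *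
  generalize M.res s Y = Y1 at *
  generalize M.res t Y = Y2 at *
  generalize M.res s C = U1 at *
  generalize M.res t C = V1 at *
  generalize M.res s D = U2 at *
  generalize M.res t D = V2 at *
  subst a1 a2 a3 a4 c1 c2 c3 c4
  have j21 : M.H f21 (Y1 * R) (1 + U2) := by rw [one_add]; exact h21
  have j22 : M.H f22 Y2 (1 + V2) := by rw [one_add]; exact h22
  have i12 : M.H f12 (X2 * 1) (N + V1) := by rw [mul_one]; exact h12
  have i22 : M.H f22 (Y2 * 1) V2 := by rw [mul_one]; exact h22
  rw [show X1 * X2 * P = X1 * P * X2 by ac_rfl, show A * N + (U1 + V1) = A * N + V1 + U1 by ac_rfl] at h1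
  rw [show Y1 * Y2 * R = Y1 * R * Y2 by ac_rfl, show U2 + V2 = 1 * 1 + V2 + U2 by
    rw [mul_one, one_add, add_comm]] at h2
  rw [show (P + R) * (X1 * Y1) = X1 * Y1 * (P + R) by ac_rfl,
    show A + (U1 + U2) = A + U1 + U2 by ac_rfl] at k1
  rw [show X2 * Y2 = X2 * Y2 * (1 + 1) by rw [one_add, mul_one],
    show N + (V1 + V2) = N + V1 + V2 by ac_rfl] at k2
  rw [show X1 * X2 * P = X1 * P * X2 by ac_rfl] at n1
  rw [show Y1 * Y2 * R = Y1 * R * Y2 by ac_rfl] at n2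
  rw [show (P + R) * (X1 * Y1) = X1 * Y1 * (P + R) by ac_rfl] at n3
  rw [show X2 * Y2 = X2 * Y2 * (1 + 1) by rw [one_add, mul_one]] at n4
  rw [ih _ _ _ _ h1 (H.mkR h11 h12 h1.N) n1, ih _ _ _ _ h2 (H.mkR j21 j22 h2.N) n2,
    ih _ _ _ _ k1 (H.mkL h11 h21 k1.N) n3, ih _ _ _ _ k2 (H.mkL i12 i22 k2.N) n4]
  exact eqC h11 h12 h21 h22
end FS
end

section
namespace FS
variable {L : Type} {M : FS L}

theorem mul_one_left {X Y : M.Q} (h : X * Y = 1) : X = 1 := by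
  have := congrArg M.ms h
  rw [ms_mul, ms_one] at this
  exact M.ms_zero _ (add_eq_zero.1 this |>.1)

theorem mid_dvd {P R Z S T : M.Q} (m : mid P R) (n : M.N ((P + R) * Z)) (h : (P + R) * Z = S * T) :
    (∃ S', S = (P + R) * S') ∨ ∃ T', T = (P + R) * T' := by
  rcases m with ⟨a, b⟩ | ⟨rfl, rfl⟩
  · exact prime_dvd (sum_prime (N_left n) a b) n h
  · exact Or.inl ⟨S, by rw [one_add, one_mul]⟩

theorem mid_dvdA {P R Z S T : M.Q} (m : mid P R) (n : M.N (P * R + Z)) (h : P * R + Z = S + T) :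
    (∃ S', S = P * R + S') ∨ ∃ T', T = P * R + T' :=
  mid_dvd (M := M.op) m n h

theorem mid_symm {P R : M.Q} (h : mid P R) : mid R P := by unfold mid at *; tauto

theorem dvdL {X Y P R X' Y' P' R' : M.Q} (m : mid P R) (m' : mid P' R') (n : M.N (X * Y * (P + R)))
    (e : X * Y * (P + R) = X' * Y' * (P' + R')) (ne : P + R ≠ P' + R') :
    (∃ Z, X' = (P + R) * Z) ∨ ∃ Z, Y' = (P + R) * Z := by
  by_cases c : P + R = 1
  · exact Or.inl ⟨X', by rw [c, one_mul]⟩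
  rw [mul_comm] at n
  have e' : (P + R) * (X * Y) = X' * Y' * (P' + R') := by rw [mul_comm, e]
  rcases mid_dvd m n e' with ⟨Z, h⟩ | ⟨Z, h⟩
  · refine mid_dvd (Z := Z) m ?_ h.symm
    rw [← h]; rw [e'] at n; exact N_left n
  · exfalso
    rcases m' with ⟨a, b⟩ | ⟨rfl, rfl⟩
    · have n' : M.N (P' + R') := by rw [e'] at n; exact (N_mul.1 n).2.1
      rcases sum_prime n' a b _ _ h with k | k
      · exact c k
      · rw [k, mul_one] at h; exact ne h.symm
    · rw [one_add] at h
      exact c (mul_one_left h.symm)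

theorem LL {n : ℕ} (ih : ∀ (f g : M.A) X Y, M.H f X Y → M.H g X Y → (M.ms X).card < n → f = g)
    {X Y P R C D X' Y' P' R' C' D' : M.Q} {f1 f2 g1 g2 : M.A} (m : mid P R) (m' : mid P' R')
    (h1 : M.H f1 (X * P) C) (h2 : M.H f2 (Y * R) D) (k1 : M.H g1 (X' * P') C')
    (k2 : M.H g2 (Y' * R') D') (nd : M.N (X * Y * (P + R))) (n1 : (M.ms (X * P)).card < n)
    (n2 : (M.ms (Y * R)).card < n) (n3 : (M.ms (X' * P')).card < n) (n4 : (M.ms (Y' * R')).card < n)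
    (e : X * Y * (P + R) = X' * Y' * (P' + R')) (e3 : C + D = C' + D') :
    del X Y P R ⊙ f1 + f2 = del X' Y' P' R' ⊙ g1 + g2 := by
  by_cases c : P + R = P' + R'
  · refine LLa ih h1 h2 k1 k2 nd n1 n2 n3 n4 ?_ c e3
    rw [← c, mul_comm, mul_comm _ (P + R)] at e
    rw [mul_comm] at nd
    exact mul_cancel nd e
  -- reduce to the case of the left parts
  have key : ∀ {X Y P R C D X' Y' P' R' C' D' : M.Q} {f1 f2 g1 g2 : M.A} 
    (h1 : M.H f1 (X * P) C) (h2 : M.H f2 (Y * R) D) (k1 : M.H g1 (X' * P') C')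
    (k2 : M.H g2 (Y' * R') D') (nd : M.N (X * Y * (P + R))) (n1 : (M.ms (X * P)).card < n)
    (n2 : (M.ms (Y * R)).card < n) (n3 : (M.ms (X' * P')).card < n) (n4 : (M.ms (Y' * R')).card < n)
    (e : X * Y * (P + R) = X' * Y' * (P' + R')) (e3 : C + D = C' + D') 
    (d1 : ∃ Z, X' = (P + R) * Z) (d2 : ∃ Z, X = (P' + R') * Z),
    del X Y P R ⊙ f1 + f2 = del X' Y' P' R' ⊙ g1 + g2 := by
    intro X Y P R C D X' Y' P' R' C' D' f1 f2 g1 g2 h1 h2 k1 k2 nd n1 n2 n3 n4 e e3 d1 d2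
    obtain ⟨W', rfl⟩ := d1
    obtain ⟨W, rfl⟩ := d2
    refine LLb ih h1 h2 k1 k2 nd n1 n2 n3 n4 ?_ e3
    have e1 : (P' + R') * (P + R) * (W * Y) = (P' + R') * (P + R) * (W' * Y') := by
      calc _ = (P' + R') * W * Y * (P + R) := by ac_rfl
        _ = _ := by rw [e]; ac_rfl
    refine mul_cancel ?_ e1
    convert nd using 1; ac_rfl
  have d1 := dvdL m m' nd e c
  have d2 := dvdL m' m (e ▸ nd) e.symm (Ne.symm c)
  rcases d1 with d1 | d1 <;> rcases d2 with d2 | d2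
  · exact key h1 h2 k1 k2 nd n1 n2 n3 n4 e e3 d1 d2
  · rw [del_symm X, add_comm f1]
    rw [add_comm P] at d1
    refine key h2 h1 k1 k2 ?_ n2 n1 n3 n4 ?_ ?_ d1 d2
    · rw [mul_comm Y, add_comm R]; exact nd
    · rw [mul_comm Y, add_comm R]; exact e
    · rw [add_comm, e3]
  · rw [del_symm X', add_comm g1]
    rw [add_comm P'] at d2
    refine key h1 h2 k2 k1 nd n1 n2 n4 n3 ?_ ?_ d1 d2
    · rw [mul_comm Y', add_comm R']; exact e
    · rw [e3, add_comm]
  · rw [del_symm X, add_comm f1, del_symm X', add_comm g1]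
    rw [add_comm P] at d1
    rw [add_comm P'] at d2
    refine key h2 h1 k2 k1 ?_ n2 n1 n4 n3 ?_ ?_ d1 d2
    · rw [mul_comm Y, add_comm R]; exact nd
    · rw [mul_comm Y, add_comm R, mul_comm Y', add_comm R']; exact e
    · rw [add_comm, e3, add_comm]

theorem LR {n : ℕ} (ih : ∀ (f g : M.A) X Y, M.H f X Y → M.H g X Y → (M.ms X).card < n → f = g)
    {X Y P R C D S T A N U V : M.Q} {f1 f2 g1 g2 : M.A} (m : mid P R) (m' : mid A N)
    (h1 : M.H f1 (X * P) C) (h2 : M.H f2 (Y * R) D)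
    (k1 : M.H g1 S (A + U))
    (k2 : M.H g2 T (N + V)) (nd : M.N (X * Y * (P + R)))
    (n1 : (M.ms (X * P)).card < n)
    (n2 : (M.ms (Y * R)).card < n) (n3 : (M.ms S).card < n)
    (n4 : (M.ms T).card < n)
    (e1 : X * Y * (P + R) = S * T) (e3 : C + D = A * N + V + U) :
    del X Y P R ⊙ f1 + f2 = g1 * g2 ⊙ lam A N U V := by
  have key : ∀ {X Y P R C D S T A N U V : M.Q} {f1 f2 g1 g2 : M.A}
    (h1 : M.H f1 (X * P) C) (h2 : M.H f2 (Y * R) D)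
    (k1 : M.H g1 S (A + U))
    (k2 : M.H g2 T (N + V)) (nd : M.N (X * Y * (P + R)))
    (n1 : (M.ms (X * P)).card < n)
    (n2 : (M.ms (Y * R)).card < n) (n3 : (M.ms S).card < n)
    (n4 : (M.ms T).card < n)
    (e1 : X * Y * (P + R) = S * T) (e3 : C + D = A * N + V + U)
    (d1 : ∃ Z, S = (P + R) * Z) (d2 : ∃ Z, C = A * N + Z), 
    del X Y P R ⊙ f1 + f2 = g1 * g2 ⊙ lam A N U V := by
    intro X Y P R C D S T A N U V f1 f2 g1 g2 h1 h2 k1 k2 nd n1 n2 n3 n4 e1 e3 d1 d2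
    obtain ⟨S, rfl⟩ := d1
    obtain ⟨C, rfl⟩ := d2
    have ne := N_hf (H.mkL h1 h2 nd)
    refine LRc ih h1 h2 k1 k2 nd n1 n2 n3 n4 ?_ ?_
    · rw [mul_comm] at nd
      rw [mul_comm, mul_assoc] at e1
      exact mul_cancel nd e1
    · rw [add_assoc] at ne e3
      rw [add_assoc] at e3
      rw [add_cancel ne e3, add_comm]
  have ne := N_hf (H.mkL h1 h2 nd)
  have d1 := mid_dvd (Z := X * Y) (S := S) (T := T) m (by rw [mul_comm]; exact nd) (by rw [mul_comm]; exact e1)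
  have d2 := mid_dvdA (Z := V + U) (S := C) (T := D) m' (by rw [← add_assoc, ← e3]; exact ne)
    (by rw [← add_assoc]; exact e3.symm)
  rcases d1 with d1 | d1 <;> rcases d2 with d2 | d2
  · exact key h1 h2 k1 k2 nd n1 n2 n3 n4 e1 e3 d1 d2
  · rw [del_symm X, add_comm f1]
    rw [add_comm P] at d1
    refine key h2 h1 k1 k2 ?_ n2 n1 n3 n4 ?_ ?_ d1 d2
    · rw [mul_comm Y, add_comm R]; exact nd
    · rw [mul_comm Y, add_comm R]; exact e1
    · rw [add_comm, e3]
  · rw [lam_symm A, mul_comm g1]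
    rw [mul_comm A] at d2
    refine key h1 h2 k2 k1 nd n1 n2 n4 n3 ?_ ?_ d1 d2
    · rw [e1, mul_comm]
    · rw [e3, mul_comm N]; ac_rfl
  · rw [lam_symm A, mul_comm g1]
    rw [mul_comm A] at d2
    rw [del_symm X, add_comm f1]
    rw [add_comm P] at d1
    refine key h2 h1 k2 k1 ?_ n2 n1 n4 n3 ?_ ?_ d1 d2
    · rw [mul_comm Y, add_comm R]; exact nd
    · rw [mul_comm Y, add_comm R, e1, mul_comm]
    · rw [mul_comm N, add_comm D, e3]; ac_rfl

theorem uniqLL {n : ℕ} (ih : ∀ (f g : M.A) X Y, M.H f X Y → M.H g X Y → (M.ms X).card < n → f = g)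
    {f g : M.A} {A B : M.Q} (hf : M.H f A B) (hg : M.H g A B) (c : (M.ms A).card = n) (lf : Left f)
    (lg : Left g) : f = g := by
  obtain ⟨X, Y, P, R, C, D, f1, f2, rfl, h1, h2, h3, h4, h5⟩ := lf
  obtain ⟨X', Y', P', R', C', D', g1, g2, rfl, k1, k2, k3, k4, k5⟩ := lg
  obtain ⟨rfl, rfl⟩ := hf.left h1 h2
  obtain ⟨e1, e2⟩ := hg.left k1 k2
  have c' := c
  rw [e1] at c'
  have nd := hf.N
  have ne1' := ne1.1 h3
  have ne2 := ne1.1 h4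
  have ne3 := ne1.1 k3
  have ne4 := ne1.1 k4
  simp only [ms_mul, ms_add, Multiset.card_add] at ne1' ne2 ne3 ne4 c c'
  refine LL ih h5 k5 h1 h2 k1 k2 nd ?_ ?_ ?_ ?_ e1 e2 <;>
    simp only [ms_mul, Multiset.card_add] <;> omega

theorem uniqLR {n : ℕ} (ih : ∀ (f g : M.A) X Y, M.H f X Y → M.H g X Y → (M.ms X).card < n → f = g)
    {f g : M.A} {A B : M.Q} (hf : M.H f A B) (hg : M.H g A B) (c : (M.ms A).card = n) (lf : Left f)
    (lg : Right g) : f = g := by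
  obtain ⟨X, Y, P, R, C, D, f1, f2, rfl, h1, h2, h3, h4, h5⟩ := lf
  obtain ⟨A', N', U, V, S, T, g1, g2, rfl, k1, k2, k3, k4, k5⟩ := lg
  obtain ⟨rfl, rfl⟩ := hf.left h1 h2
  obtain ⟨e1, e2⟩ := hg.right k1 k2
  have c' := c
  rw [e1] at c'
  have nd := hf.N
  have ne1' := ne1.1 h3
  have ne2 := ne1.1 h4
  have ne3 := ne1.1 k3
  have ne4 := ne1.1 k4
  rw [← M.H_ms k1] at ne3
  rw [← M.H_ms k2] at ne4
  simp only [ms_mul, ms_add, Multiset.card_add] at ne1' ne2 ne3 ne4 c c'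
  refine LR ih h5 k5 h1 h2 k1 k2 nd ?_ ?_ ?_ ?_ e1 e2 <;>
    (try simp only [ms_mul, Multiset.card_add]) <;> omega

theorem uniq_aux (n : ℕ) : ∀ (f g : M.A) X Y, M.H f X Y → M.H g X Y → (M.ms X).card < n → f = g := by
  induction n with
  | zero => intro f g X Y _ _ h; omega
  | succ n ih => 
    intro f g X Y hf hg h
    rcases (Nat.lt_succ_iff_lt_or_eq.1 h) with h | h
    · exact ih f g X Y hf hg h
    have ih' : ∀ (f g : M.A) X Y, M.op.H f X Y → M.op.H g X Y → (M.op.ms X).card < n → f = g := by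
      intro f g X Y hf hg c
      exact ih f g Y X hf hg (by rw [M.H_ms hf]; exact c)
    have one : ∀ {f g : M.A} {X Y}, M.H f X Y → M.H g X Y → (∃ X, (M.ms X).card ≤ 1 ∧ f = M.i X) → f = g := by
      intro f g X Y hf hg ⟨Z, c, e⟩
      subst e
      obtain ⟨rfl, rfl⟩ := M.H_uniq hf (Ty.i Z hf.ne)
      exact (M.one hg c).1.symm
    rcases allOK hf with k | k | k
    · exact one hf hg k
    all_goals rcases allOK hg with k' | k' | k'
    · exact (one hg hf k').symm
    · exact uniqLL ih hf hg h k k'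
    · exact uniqLR ih hf hg h k k'
    · exact (one hg hf k').symm
    · exact (uniqLR ih hg hf h k' k).symm
    · exact uniqLL (M := M.op) ih' hf hg (by rw [← h, M.H_ms hf]; rfl) (op_Left.2 k) (op_Left.2 k')

theorem uniq {f g : M.A} {X Y : M.Q} (hf : M.H f X Y) (hg : M.H g X Y) : f = g :=
  uniq_aux _ f g X Y hf hg (Nat.lt_succ_self _)
end FS
end

section
structure MX0 (L : Type) where
  Ob : Type
  Hom : Ob → Ob → Type
  id : ∀ X, Hom X X
  comp : ∀ {X Y Z}, Hom X Y → Hom Y Z → Hom X Z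
  id_comp : ∀ {X Y} (f : Hom X Y), comp (id X) f = f
  comp_id : ∀ {X Y} (f : Hom X Y), comp f (id Y) = f
  assoc : ∀ {X Y Z W} (f : Hom X Y) (g : Hom Y Z) (h : Hom Z W),
    comp (comp f g) h = comp f (comp g h)
  e : Ob
  an : Ob → Ob → Ob
  or : Ob → Ob → Ob
  anM : ∀ {X X' Y Y'}, Hom X X' → Hom Y Y' → Hom (an X Y) (an X' Y')
  orM : ∀ {X X' Y Y'}, Hom X X' → Hom Y Y' → Hom (or X Y) (or X' Y')
  anM_id : ∀ X Y, anM (id X) (id Y) = id (an X Y)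
  orM_id : ∀ X Y, orM (id X) (id Y) = id (or X Y)
  anM_comp : ∀ {X Y Z X' Y' Z'} (f : Hom X Y) (g : Hom Y Z) (f' : Hom X' Y') (g' : Hom Y' Z'),
    anM (comp f g) (comp f' g') = comp (anM f f') (anM g g')
  orM_comp : ∀ {X Y Z X' Y' Z'} (f : Hom X Y) (g : Hom Y Z) (f' : Hom X' Y') (g' : Hom Y' Z'),
    orM (comp f g) (comp f' g') = comp (orM f f') (orM g g')
  AC : ∀ {X Y}, Hom X Y → Prop
  ac_id : ∀ X, AC (id X)
  ac_comp : ∀ {X Y Z} {f : Hom X Y} {g : Hom Y Z}, AC f → AC g → AC (comp f g)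
  ac_an : ∀ {X X' Y Y'} {f : Hom X X'} {g : Hom Y Y'}, AC f → AC g → AC (anM f g)
  ac_or : ∀ {X X' Y Y'} {f : Hom X X'} {g : Hom Y Y'}, AC f → AC g → AC (orM f g)
  ac_inv : ∀ {X Y} {f : Hom X Y}, AC f → ∃ g : Hom Y X, AC g ∧ comp f g = id X ∧ comp g f = id Y
  ms : Ob → Multiset L
  ms_hom : ∀ {X Y}, Hom X Y → ms X = ms Y
  ms_e : ms e = 0
  ms_an : ∀ X Y, ms (an X Y) = ms X + ms Y
  ms_or : ∀ X Y, ms (or X Y) = ms X + ms Y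
  ac_uniq : ∀ {X Y} {i j : Hom X Y}, (ms X).Nodup → AC i → AC j → i = j
  an_comm : ∀ {X X' Y Y'} (f : Hom X X') (g : Hom Y Y'),
    ∃ i j, AC i ∧ AC j ∧ comp (anM f g) j = comp i (anM g f)
  or_comm : ∀ {X X' Y Y'} (f : Hom X X') (g : Hom Y Y'),
    ∃ i j, AC i ∧ AC j ∧ comp (orM f g) j = comp i (orM g f)
  an_assoc : ∀ {X X' Y Y' Z Z'} (f : Hom X X') (g : Hom Y Y') (h : Hom Z Z'),
    ∃ i j, AC i ∧ AC j ∧ comp (anM (anM f g) h) j = comp i (anM f (anM g h))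
  or_assoc : ∀ {X X' Y Y' Z Z'} (f : Hom X X') (g : Hom Y Y') (h : Hom Z Z'),
    ∃ i j, AC i ∧ AC j ∧ comp (orM (orM f g) h) j = comp i (orM f (orM g h))
  an_unit : ∀ {X X'} (f : Hom X X'), ∃ i j, AC i ∧ AC j ∧ comp (anM (id e) f) j = comp i f
  or_unit : ∀ {X X'} (f : Hom X X'), ∃ i j, AC i ∧ AC j ∧ comp (orM (id e) f) j = comp i f

namespace MX0
variable {L : Type} (M : MX0 L)

/-- associative-commutative equivalence of objects -/
def ACE (X Y : M.Ob) : Prop := ∃ i : M.Hom X Y, M.AC i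

variable {M}

theorem ACE.refl (X : M.Ob) : M.ACE X X := ⟨_, M.ac_id X⟩
theorem ACE.symm {X Y : M.Ob} : M.ACE X Y → M.ACE Y X := fun ⟨_, hi⟩ =>
  let ⟨g, hg, _⟩ := M.ac_inv hi; ⟨g, hg⟩
theorem ACE.trans {X Y Z : M.Ob} : M.ACE X Y → M.ACE Y Z → M.ACE X Z := fun ⟨_, hi⟩ ⟨_, hj⟩ =>
  ⟨_, M.ac_comp hi hj⟩

variable (M) in
def acSetoid : Setoid M.Ob := ⟨M.ACE, ACE.refl, ACE.symm, ACE.trans⟩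

variable (M) in
/-- objects modulo AC -/
def Q : Type := Quotient M.acSetoid

def q (X : M.Ob) : M.Q := Quotient.mk M.acSetoid X

theorem q_eq {X Y : M.Ob} : q X = q Y ↔ M.ACE X Y :=
  ⟨fun h => Quotient.exact (s := M.acSetoid) h, fun h => Quotient.sound (s := M.acSetoid) h⟩

theorem ACE.of_q {X Y : M.Ob} (h : q X = q Y) : M.ACE X Y := q_eq.1 h

theorem exists_q (a : M.Q) : ∃ X : M.Ob, q X = a := Quotient.exists_rep a

instance : Mul M.Q := ⟨Quotient.map₂ M.an (by
  rintro _ _ ⟨i, hi⟩ _ _ ⟨j, hj⟩; exact ⟨_, M.ac_an hi hj⟩)⟩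
instance : Add M.Q := ⟨Quotient.map₂ M.or (by
  rintro _ _ ⟨i, hi⟩ _ _ ⟨j, hj⟩; exact ⟨_, M.ac_or hi hj⟩)⟩

theorem q_an (X Y : M.Ob) : q (M.an X Y) = q X * q Y := rfl
theorem q_or (X Y : M.Ob) : q (M.or X Y) = q X + q Y := rfl

instance : CommMonoid M.Q where
  mul_assoc := by
    intro a b c
    obtain ⟨X, rfl⟩ := exists_q a; obtain ⟨Y, rfl⟩ := exists_q b; obtain ⟨Z, rfl⟩ := exists_q c
    obtain ⟨i, j, hi, -, -⟩ := M.an_assoc (M.id X) (M.id Y) (M.id Z)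
    exact q_eq.2 ⟨i, hi⟩
  mul_comm := by
    intro a b
    obtain ⟨X, rfl⟩ := exists_q a; obtain ⟨Y, rfl⟩ := exists_q b
    obtain ⟨i, j, hi, -, -⟩ := M.an_comm (M.id X) (M.id Y)
    exact q_eq.2 ⟨i, hi⟩
  one := q M.e
  one_mul := by
    intro a
    obtain ⟨X, rfl⟩ := exists_q a
    obtain ⟨i, j, hi, -, -⟩ := M.an_unit (M.id X)
    exact q_eq.2 ⟨i, hi⟩
  mul_one := by
    intro a
    obtain ⟨X, rfl⟩ := exists_q a
    obtain ⟨i, j, hi, -, -⟩ := M.an_unit (M.id X)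
    obtain ⟨i', j', hi', -, -⟩ := M.an_comm (M.id X) (M.id M.e)
    exact (q_eq.2 ⟨i', hi'⟩ : q (M.an X M.e) = q (M.an M.e X)).trans (q_eq.2 ⟨i, hi⟩)

theorem q_e : q M.e = 1 := rfl

instance : AddCommSemigroup M.Q where
  add_assoc := by
    intro a b c
    obtain ⟨X, rfl⟩ := exists_q a; obtain ⟨Y, rfl⟩ := exists_q b; obtain ⟨Z, rfl⟩ := exists_q c
    obtain ⟨i, j, hi, -, -⟩ := M.or_assoc (M.id X) (M.id Y) (M.id Z)
    exact q_eq.2 ⟨i, hi⟩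
  add_comm := by
    intro a b
    obtain ⟨X, rfl⟩ := exists_q a; obtain ⟨Y, rfl⟩ := exists_q b
    obtain ⟨i, j, hi, -, -⟩ := M.or_comm (M.id X) (M.id Y)
    exact q_eq.2 ⟨i, hi⟩

theorem one_add (a : M.Q) : 1 + a = a := by
  obtain ⟨X, rfl⟩ := exists_q a
  obtain ⟨i, j, hi, -, -⟩ := M.or_unit (M.id X)
  exact q_eq.2 ⟨i, hi⟩

theorem add_one (a : M.Q) : a + 1 = a := by rw [add_comm, one_add]

/-- composition up to AC -/
noncomputable def ac {X Y : M.Ob} (h : M.ACE X Y) : M.Hom X Y := h.choose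
theorem ac_ac {X Y : M.Ob} (h : M.ACE X Y) : M.AC (ac h) := h.choose_spec

noncomputable def acc {X Y Z W : M.Ob} (f : M.Hom X Y) (g : M.Hom Z W)
    (h : M.ACE Y Z := by
      first
        | exact ACE.refl _
        | (apply ACE.of_q; simp only [q_an, q_or, q_e, one_mul, mul_one, one_add, add_one,
            mul_comm, mul_left_comm, mul_assoc, add_comm, add_left_comm, add_assoc])) :
    M.Hom X W := M.comp f (M.comp (ac h) g)

infixr:60 " ⊚ " => MX0.acc

variable (M) in
/-- no letter occurs twice -/
def N (X : M.Ob) : Prop := (M.ms X).Nodup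

theorem N.hom {X Y : M.Ob} (h : M.N X) (f : M.Hom X Y) : M.N Y := by
  unfold N at *; rwa [← M.ms_hom f]
theorem N.hom' {X Y : M.Ob} (h : M.N Y) (f : M.Hom X Y) : M.N X := by
  unfold N at *; rwa [M.ms_hom f]
theorem N.ace {X Y : M.Ob} (h : M.N X) (f : M.ACE X Y) : M.N Y := h.hom f.choose

/-- similarity: equality up to AC -/
def Sim {X Y X' Y' : M.Ob} (f : M.Hom X Y) (g : M.Hom X' Y') : Prop :=
  ∃ i j, M.AC i ∧ M.AC j ∧ M.comp f j = M.comp i g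

infix:50 " ≈ₛ " => MX0.Sim

theorem Sim.refl {X Y : M.Ob} (f : M.Hom X Y) : f ≈ₛ f :=
  ⟨_, _, M.ac_id _, M.ac_id _, by rw [M.comp_id, M.id_comp]⟩
theorem Sim.rfl {X Y : M.Ob} {f : M.Hom X Y} : f ≈ₛ f := Sim.refl f

theorem Sim.symm {X Y X' Y' : M.Ob} {f : M.Hom X Y} {g : M.Hom X' Y'} : f ≈ₛ g → g ≈ₛ f := by
  rintro ⟨i, j, hi, hj, h⟩
  obtain ⟨i', hi', h1, h2⟩ := M.ac_inv hi
  obtain ⟨j', hj', h3, h4⟩ := M.ac_inv hj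
  refine ⟨i', j', hi', hj', ?_⟩
  rw [← M.comp_id (M.comp i' f), ← h3, ← M.assoc (M.comp i' f), M.assoc i' f j, h, ← M.assoc i' i g, h2, M.id_comp]

theorem Sim.trans {X Y X' Y' X'' Y'' : M.Ob} {f : M.Hom X Y} {g : M.Hom X' Y'}
    {h : M.Hom X'' Y''} : f ≈ₛ g → g ≈ₛ h → f ≈ₛ h := by
  rintro ⟨i, j, hi, hj, e⟩ ⟨i', j', hi', hj', e'⟩
  refine ⟨_, _, M.ac_comp hi hi', M.ac_comp hj hj', ?_⟩
  rw [← M.assoc, e, M.assoc, e', M.assoc]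

instance {X Y X' Y' X'' Y'' : M.Ob} : Trans (γ := M.Hom X'' Y'') (Sim (X := X) (Y := Y) (X' := X') (Y' := Y')) (Sim) Sim :=
  ⟨Sim.trans⟩

theorem Sim.of_eq {X Y : M.Ob} {f g : M.Hom X Y} (h : f = g) : f ≈ₛ g := h ▸ Sim.rfl

theorem Sim.src {X Y X' Y' : M.Ob} {f : M.Hom X Y} {g : M.Hom X' Y'} (h : f ≈ₛ g) :
    M.ACE X X' := let ⟨i, _, hi, _⟩ := h; ⟨i, hi⟩
theorem Sim.tgt {X Y X' Y' : M.Ob} {f : M.Hom X Y} {g : M.Hom X' Y'} (h : f ≈ₛ g) :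
    M.ACE Y Y' := let ⟨_, j, _, hj, _⟩ := h; ⟨j, hj⟩

theorem Sim.eq {X Y : M.Ob} {f g : M.Hom X Y} (hX : M.N X) (h : f ≈ₛ g) : f = g := by
  obtain ⟨i, j, hi, hj, h⟩ := h
  rw [M.ac_uniq hX hi (M.ac_id X), M.ac_uniq (hX.hom f) hj (M.ac_id Y), M.comp_id, M.id_comp] at h
  exact h

theorem ac_sim {X Y X' Y' : M.Ob} {f : M.Hom X Y} {g : M.Hom X' Y'} (hX : M.N X)
    (hf : M.AC f) (hg : M.AC g) (h : M.ACE X X') : f ≈ₛ g := by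
  obtain ⟨i, hi⟩ := h
  obtain ⟨f', hf', h1, h2⟩ := M.ac_inv hf
  refine ⟨i, M.comp f' (M.comp i g), hi, M.ac_comp hf' (M.ac_comp hi hg), ?_⟩
  rw [← M.assoc, h1, M.id_comp]

theorem acc_congr {X Y Z W X' Y' Z' W' : M.Ob} {f : M.Hom X Y} {g : M.Hom Z W}
    {f' : M.Hom X' Y'} {g' : M.Hom Z' W'} {h : M.ACE Y Z} {h' : M.ACE Y' Z'} (hX : M.N X)
    (s : f ≈ₛ f') (t : g ≈ₛ g') : acc f g h ≈ₛ acc f' g' h' := by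
  obtain ⟨i, j, hi, hj, e⟩ := s
  obtain ⟨k, l, hk, hl, e'⟩ := t
  refine ⟨i, l, hi, hl, ?_⟩
  have : M.comp (ac h) k = M.comp j (ac h') :=
    M.ac_uniq (hX.hom f) (M.ac_comp (ac_ac h) hk) (M.ac_comp hj (ac_ac h'))
  unfold acc
  rw [M.assoc, M.assoc, e', ← M.assoc (ac h), this, M.assoc, ← M.assoc, e, M.assoc]

theorem accR {X Y Z W Z' W' : M.Ob} {f : M.Hom X Y} {g : M.Hom Z W}
    {g' : M.Hom Z' W'} {h : M.ACE Y Z} {h' : M.ACE Y Z'} (hX : M.N X)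
    (t : g ≈ₛ g') : acc f g h ≈ₛ acc f g' h' := acc_congr hX Sim.rfl t
theorem accL {X Y Z W X' Y' : M.Ob} {f : M.Hom X Y} {g : M.Hom Z W}
    {f' : M.Hom X' Y'} {h : M.ACE Y Z} {h' : M.ACE Y' Z} (hX : M.N X)
    (s : f ≈ₛ f') : acc f g h ≈ₛ acc f' g h' := acc_congr hX s Sim.rfl

theorem acc_comp {X Y Z : M.Ob} {f : M.Hom X Y} {g : M.Hom Y Z} {h : M.ACE Y Y} (hX : M.N X) :
    acc f g h = M.comp f g := by
  unfold acc
  rw [M.ac_uniq (hX.hom f) (ac_ac h) (M.ac_id Y), M.id_comp]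

theorem acc_assoc {X Y Z W U V : M.Ob} {f : M.Hom X Y} {g : M.Hom Z W} {k : M.Hom U V}
    {h : M.ACE Y Z} {h' : M.ACE W U} : acc (acc f g h) k h' = acc f (acc g k h') h := by
  unfold acc; simp only [M.assoc]

theorem acc_acR {X Y Z W : M.Ob} {f : M.Hom X Y} {g : M.Hom Z W} {h : M.ACE Y Z}
    (hg : M.AC g) : acc f g h ≈ₛ f := by
  obtain ⟨k, hk, -, -⟩ := M.ac_inv (M.ac_comp (ac_ac h) hg)
  refine Sim.symm ⟨M.id X, M.comp (ac h) g, M.ac_id _, M.ac_comp (ac_ac h) hg, ?_⟩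
  rw [M.id_comp]; rfl

theorem acc_acL {X Y Z W : M.Ob} {f : M.Hom X Y} {g : M.Hom Z W} {h : M.ACE Y Z}
    (hf : M.AC f) : acc f g h ≈ₛ g := by
  refine ⟨M.comp f (ac h), M.id W, M.ac_comp hf (ac_ac h), M.ac_id _, ?_⟩
  rw [M.comp_id, M.assoc]; rfl

/-- rewrite two consecutive factors -/
theorem acc2 {X Y Z W U V X' Y' Z' W' : M.Ob} {f : M.Hom X Y} {g : M.Hom Z W} {k : M.Hom U V}
    {f' : M.Hom X' Y'} {g' : M.Hom Z' W'}
    {h : M.ACE Y Z} {h1 : M.ACE W U} {h' : M.ACE Y' Z'} {h1' : M.ACE W' U} (hX : M.N X)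
    (s : acc f g h ≈ₛ acc f' g' h') : acc f (acc g k h1) h ≈ₛ acc f' (acc g' k h1') h' := by
  rw [← acc_assoc, ← acc_assoc]
  exact accL hX s

theorem anM_congr {X Y X' Y' Z W Z' W' : M.Ob} {f : M.Hom X Y} {g : M.Hom Z W}
    {f' : M.Hom X' Y'} {g' : M.Hom Z' W'} (s : f ≈ₛ f') (t : g ≈ₛ g') :
    M.anM f g ≈ₛ M.anM f' g' := by
  obtain ⟨i, j, hi, hj, e⟩ := s
  obtain ⟨k, l, hk, hl, e'⟩ := t
  exact ⟨_, _, M.ac_an hi hk, M.ac_an hj hl, by rw [← M.anM_comp, ← M.anM_comp, e, e']⟩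
theorem orM_congr {X Y X' Y' Z W Z' W' : M.Ob} {f : M.Hom X Y} {g : M.Hom Z W}
    {f' : M.Hom X' Y'} {g' : M.Hom Z' W'} (s : f ≈ₛ f') (t : g ≈ₛ g') :
    M.orM f g ≈ₛ M.orM f' g' := by
  obtain ⟨i, j, hi, hj, e⟩ := s
  obtain ⟨k, l, hk, hl, e'⟩ := t
  exact ⟨_, _, M.ac_or hi hk, M.ac_or hj hl, by rw [← M.orM_comp, ← M.orM_comp, e, e']⟩

theorem id_sim {X Y : M.Ob} (h : M.ACE X Y) : M.id X ≈ₛ M.id Y := by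
  obtain ⟨i, hi⟩ := h
  exact ⟨i, i, hi, hi, by rw [M.id_comp, M.comp_id]⟩

theorem anM_acc {X Y Z W X' Y' Z' W' : M.Ob} {f : M.Hom X Y} {g : M.Hom Z W}
    {f' : M.Hom X' Y'} {g' : M.Hom Z' W'} {h : M.ACE Y Z} {h' : M.ACE Y' Z'}
    {k : M.ACE (M.an Y Y') (M.an Z Z')} (hX : M.N (M.an X X')) :
    M.anM (acc f g h) (acc f' g' h') = acc (M.anM f f') (M.anM g g') k := by
  unfold acc
  rw [M.ac_uniq (hX.hom (M.anM f f')) (ac_ac k) (M.ac_an (ac_ac h) (ac_ac h')),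
    M.anM_comp, M.anM_comp]
theorem orM_acc {X Y Z W X' Y' Z' W' : M.Ob} {f : M.Hom X Y} {g : M.Hom Z W}
    {f' : M.Hom X' Y'} {g' : M.Hom Z' W'} {h : M.ACE Y Z} {h' : M.ACE Y' Z'}
    {k : M.ACE (M.or Y Y') (M.or Z Z')} (hX : M.N (M.or X X')) :
    M.orM (acc f g h) (acc f' g' h') = acc (M.orM f f') (M.orM g g') k := by
  unfold acc
  rw [M.ac_uniq (hX.hom (M.orM f f')) (ac_ac k) (M.ac_or (ac_ac h) (ac_ac h')),
    M.orM_comp, M.orM_comp]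

end MX0
end

section
namespace MX0
variable {L : Type} {M : MX0 L}

variable (M) in
def arSetoid : Setoid {p : Σ X Y, M.Hom X Y // M.N p.1} :=
  ⟨fun f g => f.1.2.2 ≈ₛ g.1.2.2, fun f => Sim.refl f.1.2.2, Sim.symm, Sim.trans⟩

variable (M) in
/-- arrows modulo AC, `none` is junk -/
def A : Type := Option (Quotient M.arSetoid)

/-- inclusion of a linear arrow -/
def inA (c : Quotient M.arSetoid) : M.A := some c

variable (M) in
def bt : M.A := none

open Classical in
noncomputable def ar {X Y : M.Ob} (f : M.Hom X Y) : M.A :=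
  if h : M.N X then inA (Quotient.mk M.arSetoid ⟨⟨X, Y, f⟩, h⟩) else M.bt

theorem N.ace_iff {X Y : M.Ob} (h : M.ACE X Y) : M.N X ↔ M.N Y := ⟨fun n => n.ace h, fun n => n.ace h.symm⟩

theorem mk_sim {X Y X' Y' : M.Ob} {f : M.Hom X Y} {g : M.Hom X' Y'} (h : f ≈ₛ g) : ar f = ar g := by
  have := N.ace_iff h.src
  unfold ar
  by_cases n : M.N X
  · rw [dif_pos n, dif_pos (this.1 n)]
    exact congrArg inA (Quotient.sound (s := M.arSetoid) h)
  · rw [dif_neg n, dif_neg (fun h => n (this.2 h))]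
theorem mk_bot {X Y : M.Ob} {f : M.Hom X Y} (h : ¬ M.N X) : ar f = M.bt := dif_neg h
theorem mk_ne {X Y : M.Ob} {f : M.Hom X Y} (h : M.N X) : ar f ≠ M.bt := by
  unfold ar; rw [dif_pos h]; exact Option.some_ne_none _
theorem N_of_mk {X Y : M.Ob} {f : M.Hom X Y} (h : ar f ≠ M.bt) : M.N X := by
  by_contra n; exact h (mk_bot n)
theorem mk_exact {X Y X' Y' : M.Ob} {f : M.Hom X Y} {g : M.Hom X' Y'} (n : M.N X)
    (h : ar f = ar g) : f ≈ₛ g := by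
  have n' : M.N X' := N_of_mk (f := g) (by rw [← h]; exact mk_ne n)
  unfold ar at h
  rw [dif_pos n, dif_pos n'] at h
  exact Quotient.exact (s := M.arSetoid) (Option.some.inj h)
theorem a_cases (a : M.A) : a = M.bt ∨ ∃ (X Y : M.Ob) (f : M.Hom X Y), M.N X ∧ a = ar f := by
  by_cases h : a = M.bt
  · exact .inl h
  right
  match a, h with
  | none, h => exact absurd rfl h
  | some c, _ =>
    obtain ⟨⟨⟨X, Y, f⟩, n⟩, rfl⟩ := Quotient.exists_rep c
    exact ⟨X, Y, f, n, by unfold ar; rw [dif_pos n]; rfl⟩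

open Classical in
/-- partial binary operation given by a functional relation -/
noncomputable def pick (R : M.A → M.A → M.A → Prop) (a b : M.A) : M.A :=
  if h : ∃ c, R a b c then h.choose else M.bt
theorem pick_eq {R : M.A → M.A → M.A → Prop} {a b c : M.A} (h : R a b c)
    (u : ∀ c', R a b c' → c' = c) : pick R a b = c := by
  unfold pick
  rw [dif_pos ⟨c, h⟩]
  exact u _ (Exists.choose_spec (⟨c, h⟩ : ∃ c, R a b c))
theorem pick_ne {R : M.A → M.A → M.A → Prop} {a b : M.A} (h : pick R a b ≠ M.bt) :
    R a b (pick R a b) := by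
  unfold pick at h ⊢
  by_cases e : ∃ c, R a b c
  · rw [dif_pos e]; exact e.choose_spec
  · rw [dif_neg e] at h; exact absurd rfl h

def CmpR (a b c : M.A) : Prop := ∃ (X Y Z : M.Ob) (f : M.Hom X Y) (g : M.Hom Y Z),
  M.N X ∧ a = ar f ∧ b = ar g ∧ c = ar (M.comp f g)
def AnR (a b c : M.A) : Prop := ∃ (X Y Z W : M.Ob) (f : M.Hom X Y) (g : M.Hom Z W),
  M.N X ∧ M.N Z ∧ a = ar f ∧ b = ar g ∧ c = ar (M.anM f g)
def OrR (a b c : M.A) : Prop := ∃ (X Y Z W : M.Ob) (f : M.Hom X Y) (g : M.Hom Z W),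
  M.N X ∧ M.N Z ∧ a = ar f ∧ b = ar g ∧ c = ar (M.orM f g)
noncomputable def cmp (a b : M.A) : M.A := pick CmpR a b
noncomputable def anA (a b : M.A) : M.A := pick AnR a b
noncomputable def orA (a b : M.A) : M.A := pick OrR a b

theorem N.anL {X Y : M.Ob} (h : M.N (M.an X Y)) : M.N X := by
  unfold N at *; rw [M.ms_an] at h; exact (Multiset.nodup_add.1 h).1
theorem N.anR {X Y : M.Ob} (h : M.N (M.an X Y)) : M.N Y := by
  unfold N at *; rw [M.ms_an] at h; exact (Multiset.nodup_add.1 h).2.1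
theorem N.orL {X Y : M.Ob} (h : M.N (M.or X Y)) : M.N X := by
  unfold N at *; rw [M.ms_or] at h; exact (Multiset.nodup_add.1 h).1
theorem N.orR {X Y : M.Ob} (h : M.N (M.or X Y)) : M.N Y := by
  unfold N at *; rw [M.ms_or] at h; exact (Multiset.nodup_add.1 h).2.1

theorem bt_cmp (a : M.A) : cmp M.bt a = M.bt := by
  by_contra h
  obtain ⟨X, Y, Z, f, g, n, e, -⟩ := pick_ne h
  exact mk_ne n e.symm
theorem cmp_bt (a : M.A) : cmp a M.bt = M.bt := by
  by_contra h
  obtain ⟨X, Y, Z, f, g, n, -, e, -⟩ := pick_ne h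
  exact mk_ne (n.hom f) e.symm
theorem bt_an (a : M.A) : anA M.bt a = M.bt := by
  by_contra h
  obtain ⟨X, Y, Z, W, f, g, n, -, e, -⟩ := pick_ne h
  exact mk_ne n e.symm
theorem an_bt (a : M.A) : anA a M.bt = M.bt := by
  by_contra h
  obtain ⟨X, Y, Z, W, f, g, -, n, -, e, -⟩ := pick_ne h
  exact mk_ne n e.symm
theorem bt_or (a : M.A) : orA M.bt a = M.bt := by
  by_contra h
  obtain ⟨X, Y, Z, W, f, g, n, -, e, -⟩ := pick_ne h
  exact mk_ne n e.symm
theorem or_bt (a : M.A) : orA a M.bt = M.bt := by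
  by_contra h
  obtain ⟨X, Y, Z, W, f, g, -, n, -, e, -⟩ := pick_ne h
  exact mk_ne n e.symm

theorem cmp_mk {X Y Z : M.Ob} (f : M.Hom X Y) (g : M.Hom Y Z) :
    cmp (ar f) (ar g) = ar (M.comp f g) := by
  by_cases n : M.N X
  · refine pick_eq ⟨_, _, _, f, g, n, rfl, rfl, rfl⟩ ?_
    rintro c ⟨X', Y', Z', f', g', n', e, e', rfl⟩
    obtain ⟨i, j, hi, hj, h⟩ := mk_exact n e
    obtain ⟨k, l, hk, hl, h'⟩ := mk_exact (n.hom f) e'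
    refine (mk_sim ⟨i, l, hi, hl, ?_⟩).symm
    rw [M.assoc, h', ← M.assoc, M.ac_uniq (n.hom f) hk hj, h, M.assoc]
  · rw [mk_bot n, mk_bot n, bt_cmp]
theorem an_mk {X Y Z W : M.Ob} (f : M.Hom X Y) (g : M.Hom Z W) :
    anA (ar f) (ar g) = ar (M.anM f g) := by
  by_cases n : M.N X
  · by_cases n' : M.N Z
    · refine pick_eq ⟨_, _, _, _, f, g, n, n', rfl, rfl, rfl⟩ ?_
      rintro c ⟨X', Y', Z', W', f', g', -, -, e, e', rfl⟩
      exact (mk_sim (anM_congr (mk_exact n e) (mk_exact n' e'))).symm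
    · rw [mk_bot (f := g) n', mk_bot (fun h => n' h.anR), an_bt]
  · rw [mk_bot n, mk_bot (fun h => n h.anL), bt_an]
theorem or_mk {X Y Z W : M.Ob} (f : M.Hom X Y) (g : M.Hom Z W) :
    orA (ar f) (ar g) = ar (M.orM f g) := by
  by_cases n : M.N X
  · by_cases n' : M.N Z
    · refine pick_eq ⟨_, _, _, _, f, g, n, n', rfl, rfl, rfl⟩ ?_
      rintro c ⟨X', Y', Z', W', f', g', -, -, e, e', rfl⟩
      exact (mk_sim (orM_congr (mk_exact n e) (mk_exact n' e'))).symm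
    · rw [mk_bot (f := g) n', mk_bot (fun h => n' h.orR), or_bt]
  · rw [mk_bot n, mk_bot (fun h => n h.orL), bt_or]

theorem anA_comm (a b : M.A) : anA a b = anA b a := by
  obtain rfl | ⟨_, _, f, -, rfl⟩ := a_cases a
  · rw [bt_an, an_bt]
  obtain rfl | ⟨_, _, g, -, rfl⟩ := a_cases b
  · rw [bt_an, an_bt]
  rw [an_mk, an_mk]; exact mk_sim (M.an_comm f g)
theorem orA_comm (a b : M.A) : orA a b = orA b a := by
  obtain rfl | ⟨_, _, f, -, rfl⟩ := a_cases a
  · rw [bt_or, or_bt]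
  obtain rfl | ⟨_, _, g, -, rfl⟩ := a_cases b
  · rw [bt_or, or_bt]
  rw [or_mk, or_mk]; exact mk_sim (M.or_comm f g)
theorem anA_assoc (a b c : M.A) : anA (anA a b) c = anA a (anA b c) := by
  obtain rfl | ⟨_, _, f, -, rfl⟩ := a_cases a
  · rw [bt_an, bt_an, bt_an]
  obtain rfl | ⟨_, _, g, -, rfl⟩ := a_cases b
  · rw [bt_an, an_bt, bt_an]
  obtain rfl | ⟨_, _, h, -, rfl⟩ := a_cases c
  · rw [an_bt, an_bt, an_bt]
  simp only [an_mk]; exact mk_sim (M.an_assoc f g h)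
theorem orA_assoc (a b c : M.A) : orA (orA a b) c = orA a (orA b c) := by
  obtain rfl | ⟨_, _, f, -, rfl⟩ := a_cases a
  · rw [bt_or, bt_or, bt_or]
  obtain rfl | ⟨_, _, g, -, rfl⟩ := a_cases b
  · rw [bt_or, or_bt, bt_or]
  obtain rfl | ⟨_, _, h, -, rfl⟩ := a_cases c
  · rw [or_bt, or_bt, or_bt]
  simp only [or_mk]; exact mk_sim (M.or_assoc f g h)

noncomputable def iA (x : M.Q) : M.A := ar (M.id (Quotient.out x))
theorem q_out (x : M.Q) : q (Quotient.out x) = x := Quotient.out_eq _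
theorem iA_q (X : M.Ob) : iA (q X) = ar (M.id X) := mk_sim (id_sim (q_eq.1 (q_out _)))
theorem mk_ac {X Y : M.Ob} {f : M.Hom X Y} (h : M.AC f) : ar f = iA (q X) := by
  rw [iA_q]
  obtain ⟨g, hg, a, b⟩ := M.ac_inv h
  exact mk_sim ⟨M.id X, g, M.ac_id X, hg, by rw [a, M.id_comp]⟩

theorem e_anA (a : M.A) : anA (iA (1 : M.Q)) a = a := by
  obtain rfl | ⟨_, _, f, -, rfl⟩ := a_cases a
  · rw [an_bt]
  rw [← q_e, iA_q, an_mk]; exact mk_sim (M.an_unit f)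
theorem e_orA (a : M.A) : orA (iA (1 : M.Q)) a = a := by
  obtain rfl | ⟨_, _, f, -, rfl⟩ := a_cases a
  · rw [or_bt]
  rw [← q_e, iA_q, or_mk]; exact mk_sim (M.or_unit f)
theorem i_an (x y : M.Q) : iA (x * y) = anA (iA x) (iA y) := by
  obtain ⟨X, rfl⟩ := exists_q x; obtain ⟨Y, rfl⟩ := exists_q y
  rw [← q_an, iA_q, iA_q, iA_q, an_mk, M.anM_id]
theorem i_or (x y : M.Q) : iA (x + y) = orA (iA x) (iA y) := by
  obtain ⟨X, rfl⟩ := exists_q x; obtain ⟨Y, rfl⟩ := exists_q y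
  rw [← q_or, iA_q, iA_q, iA_q, or_mk, M.orM_id]

def msQ : M.Q → Multiset L := Quotient.lift M.ms (fun _ _ ⟨i, _⟩ => M.ms_hom i)
theorem msQ_q (X : M.Ob) : msQ (q X) = M.ms X := rfl
theorem i_bot (x : M.Q) (h : ¬ (msQ x).Nodup) : iA x = M.bt := by
  obtain ⟨X, rfl⟩ := exists_q x
  rw [iA_q, mk_bot h]

theorem cmp_cases {a b : M.A} (h : cmp a b ≠ M.bt) : ∃ (X Y Z : M.Ob) (f : M.Hom X Y) (g : M.Hom Y Z),
    M.N X ∧ a = ar f ∧ b = ar g := by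
  obtain ⟨X, Y, Z, f, g, n, e, e', -⟩ := pick_ne h
  exact ⟨X, Y, Z, f, g, n, e, e'⟩
theorem mk_pre {X Y Z : M.Ob} {i : M.Hom X Y} (h : M.AC i) (f : M.Hom Y Z) :
    ar (M.comp i f) = ar f :=
  mk_sim ⟨i, M.id _, h, M.ac_id _, by rw [M.comp_id]⟩
theorem mk_post {X Y Z : M.Ob} {i : M.Hom Y Z} (h : M.AC i) (f : M.Hom X Y) :
    ar (M.comp f i) = ar f :=
  (mk_sim ⟨M.id _, i, M.ac_id _, h, by rw [M.id_comp]⟩).symm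

theorem cmp_assoc (a b c : M.A) : cmp (cmp a b) c = cmp a (cmp b c) := by
  by_cases h : cmp (cmp a b) c = M.bt
  · by_cases h' : cmp a (cmp b c) = M.bt
    · rw [h, h']
    · obtain ⟨X, Y, Z, f, g, n, rfl, e⟩ := cmp_cases h'
      obtain ⟨Y', Z', W, f', g', n', rfl, rfl⟩ := cmp_cases (a := b) (b := c) (by
        intro h; rw [h, cmp_bt] at h'; exact h' rfl)
      rw [cmp_mk] at e
      obtain ⟨i, hi⟩ := (mk_exact (n.hom f) e.symm).src
      rw [← mk_pre hi f']
      simp only [cmp_mk, M.assoc]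
  · obtain ⟨X, Y, Z, f, g, n, e, rfl⟩ := cmp_cases h
    obtain ⟨Y', Z', W, f', g', n', rfl, rfl⟩ := cmp_cases (a := a) (b := b) (by
        intro h'; rw [h', bt_cmp] at h; exact h rfl)
    rw [cmp_mk] at e
    obtain ⟨i, hi⟩ := (mk_exact n' e).tgt
    rw [← mk_pre hi g]
    simp only [cmp_mk, M.assoc]

def HA (a : M.A) (x y : M.Q) : Prop :=
  ∃ (X Y : M.Ob) (f : M.Hom X Y), M.N X ∧ a = ar f ∧ x = q X ∧ y = q Y
theorem H_bot (x y : M.Q) : ¬ HA M.bt x y := by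
  rintro ⟨X, Y, f, n, e, -⟩
  exact mk_ne n e.symm
theorem H_ex (a : M.A) (h : a ≠ M.bt) : ∃ x y, HA a x y := by
  obtain rfl | ⟨_, _, f, n, rfl⟩ := a_cases a
  · exact absurd rfl h
  · exact ⟨_, _, _, _, f, n, rfl, rfl, rfl⟩
theorem H_uniq {a : M.A} {x y x' y' : M.Q} (h : HA a x y) (h' : HA a x' y') : x = x' ∧ y = y' := by
  obtain ⟨X, Y, f, n, rfl, rfl, rfl⟩ := h
  obtain ⟨X', Y', f', n', e, rfl, rfl⟩ := h'
  have := mk_exact n e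
  exact ⟨q_eq.2 this.src, q_eq.2 this.tgt⟩
theorem H_ms {a : M.A} {x y : M.Q} (h : HA a x y) : msQ x = msQ y := by
  obtain ⟨X, Y, f, n, rfl, rfl, rfl⟩ := h; exact M.ms_hom f
theorem H_N {a : M.A} {x y : M.Q} (h : HA a x y) : (msQ x).Nodup := by
  obtain ⟨X, Y, f, n, rfl, rfl, rfl⟩ := h; exact n
theorem H_i (x : M.Q) (h : (msQ x).Nodup) : HA (iA x) x x := by
  obtain ⟨X, rfl⟩ := exists_q x
  exact ⟨X, X, _, h, iA_q X, rfl, rfl⟩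
theorem H_comp2 {a b : M.A} {x y z : M.Q} (h : HA a x y) (h' : HA b y z) :
    ∃ (X Y Z : M.Ob) (f : M.Hom X Y) (g : M.Hom Y Z), M.N X ∧ a = ar f ∧ b = ar g ∧
      x = q X ∧ y = q Y ∧ z = q Z := by
  obtain ⟨X, Y, f, n, rfl, rfl, rfl⟩ := h
  obtain ⟨X', Y', f', n', rfl, e, rfl⟩ := h'
  obtain ⟨i, hi⟩ := q_eq.1 e
  exact ⟨X, Y, Y', f, M.comp i f', n, rfl, (mk_pre hi _).symm, rfl, rfl, rfl⟩
theorem H_cmp {a b : M.A} {x y z : M.Q} (h : HA a x y) (h' : HA b y z) : HA (cmp a b) x z := by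
  obtain ⟨X, Y, Z, f, g, n, rfl, rfl, rfl, rfl, rfl⟩ := H_comp2 h h'
  exact ⟨_, _, _, n, cmp_mk f g, rfl, rfl⟩
theorem H_ne {a : M.A} {x y : M.Q} (h : HA a x y) : a ≠ M.bt := fun e => H_bot x y (e ▸ h)
theorem H_cmp' {a b : M.A} {x z : M.Q} (h : HA (cmp a b) x z) : ∃ y, HA a x y ∧ HA b y z := by
  obtain ⟨X, Y, Z, f, g, n, rfl, rfl⟩ := cmp_cases (H_ne h)
  have h1 : HA (ar f) (q X) (q Y) := ⟨_, _, f, n, rfl, rfl, rfl⟩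
  have h2 : HA (ar g) (q Y) (q Z) := ⟨_, _, g, n.hom f, rfl, rfl, rfl⟩
  obtain ⟨rfl, rfl⟩ := H_uniq h (H_cmp h1 h2)
  exact ⟨_, h1, h2⟩
theorem H_an {a b : M.A} {x y z w : M.Q} (h : HA a x y) (h' : HA b z w) (n : (msQ (x * z)).Nodup) :
    HA (anA a b) (x * z) (y * w) := by
  obtain ⟨X, Y, f, -, rfl, rfl, rfl⟩ := h
  obtain ⟨X', Y', f', -, rfl, rfl, rfl⟩ := h'
  exact ⟨_, _, _, n, an_mk f f', rfl, rfl⟩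
theorem H_or {a b : M.A} {x y z w : M.Q} (h : HA a x y) (h' : HA b z w) (n : (msQ (x + z)).Nodup) :
    HA (orA a b) (x + z) (y + w) := by
  obtain ⟨X, Y, f, -, rfl, rfl, rfl⟩ := h
  obtain ⟨X', Y', f', -, rfl, rfl, rfl⟩ := h'
  exact ⟨_, _, _, n, or_mk f f', rfl, rfl⟩
theorem H_an' {a b : M.A} {z w : M.Q} (h : HA (anA a b) z w) :
    ∃ x y x' y', HA a x y ∧ HA b x' y' ∧ z = x * x' ∧ w = y * y' := by
  obtain ⟨X, Y, Z, W, f, g, n, n', rfl, rfl, -⟩ := pick_ne (H_ne h)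
  have h1 : HA (ar f) (q X) (q Y) := ⟨_, _, f, n, rfl, rfl, rfl⟩
  have h2 : HA (ar g) (q Z) (q W) := ⟨_, _, g, n', rfl, rfl, rfl⟩
  have hn : M.N (M.an X Z) := N_of_mk (f := M.anM f g) (by rw [← an_mk]; exact H_ne h)
  obtain ⟨rfl, rfl⟩ := H_uniq h (H_an h1 h2 hn)
  exact ⟨_, _, _, _, h1, h2, rfl, rfl⟩
theorem H_or' {a b : M.A} {z w : M.Q} (h : HA (orA a b) z w) :
    ∃ x y x' y', HA a x y ∧ HA b x' y' ∧ z = x + x' ∧ w = y + y' := by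
  obtain ⟨X, Y, Z, W, f, g, n, n', rfl, rfl, -⟩ := pick_ne (H_ne h)
  have h1 : HA (ar f) (q X) (q Y) := ⟨_, _, f, n, rfl, rfl, rfl⟩
  have h2 : HA (ar g) (q Z) (q W) := ⟨_, _, g, n', rfl, rfl, rfl⟩
  have hn : M.N (M.or X Z) := N_of_mk (f := M.orM f g) (by rw [← or_mk]; exact H_ne h)
  obtain ⟨rfl, rfl⟩ := H_uniq h (H_or h1 h2 hn)
  exact ⟨_, _, _, _, h1, h2, rfl, rfl⟩
theorem i_cmp_mk {X Y : M.Ob} {x : M.Q} (f : M.Hom X Y) (h : x = q X) : cmp (iA x) (ar f) = ar f := by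
  rw [h, iA_q, cmp_mk, M.id_comp]
theorem cmp_i_mk {X Y : M.Ob} {x : M.Q} (f : M.Hom X Y) (h : x = q Y) : cmp (ar f) (iA x) = ar f := by
  rw [h, iA_q, cmp_mk, M.comp_id]
theorem i_cmp {a : M.A} {x y : M.Q} (h : HA a x y) : cmp (iA x) a = a := by
  obtain ⟨X, Y, f, -, rfl, rfl, rfl⟩ := h
  exact i_cmp_mk f rfl
theorem cmp_i {a : M.A} {x y : M.Q} (h : HA a x y) : cmp a (iA y) = a := by
  obtain ⟨X, Y, f, -, rfl, rfl, rfl⟩ := h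
  exact cmp_i_mk f rfl
theorem anA_cmp {f g f' g' : M.A} {x y z x' y' z' : M.Q} (hf : HA f x y) (hg : HA g y z)
    (hf' : HA f' x' y') (hg' : HA g' y' z') :
    anA (cmp f g) (cmp f' g') = cmp (anA f f') (anA g g') := by
  obtain ⟨X, Y, Z, f, g, n, rfl, rfl, rfl, rfl, rfl⟩ := H_comp2 hf hg
  obtain ⟨X', Y', Z', f', g', n, rfl, rfl, rfl, rfl, rfl⟩ := H_comp2 hf' hg'
  simp only [cmp_mk, an_mk, M.anM_comp]
theorem orA_cmp {f g f' g' : M.A} {x y z x' y' z' : M.Q} (hf : HA f x y) (hg : HA g y z)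
    (hf' : HA f' x' y') (hg' : HA g' y' z') :
    orA (cmp f g) (cmp f' g') = cmp (orA f f') (orA g g') := by
  obtain ⟨X, Y, Z, f, g, n, rfl, rfl, rfl, rfl, rfl⟩ := H_comp2 hf hg
  obtain ⟨X', Y', Z', f', g', n, rfl, rfl, rfl, rfl, rfl⟩ := H_comp2 hf' hg'
  simp only [cmp_mk, or_mk, M.orM_comp]
end MX0
end

section
open CategoryTheory

/-- arrows of the free category -/
def TQ (L : Type) (A B : Form L) : Type :=
  Quotient (⟨@Eqv L A B, Eqv.refl, Eqv.symm, Eqv.trans⟩ : Setoid (Term L A B))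

namespace TQ
variable {L : Type}
def mk {A B : Form L} (f : Term L A B) : TQ L A B := Quotient.mk _ f
theorem sound {A B : Form L} {f g : Term L A B} (h : Eqv f g) : mk f = mk g := Quotient.sound h
theorem exact {A B : Form L} {f g : Term L A B} (h : mk f = mk g) : Eqv f g := Quotient.exact h
theorem ex {A B : Form L} (f : TQ L A B) : ∃ t, f = mk t := by
  induction f using Quotient.inductionOn with | _ t => exact ⟨t, rfl⟩
def id (A : Form L) : TQ L A A := mk (.id A)
def comp {A B C : Form L} : TQ L A B → TQ L B C → TQ L A C :=
  Quotient.map₂ (fun f g => g ⬝ f) (fun _ _ h _ _ h' => Eqv.congComp h' h)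
end TQ

/-- the two connectives treated uniformly -/
def Form.bin {L : Type} : Bool → Form L → Form L → Form L
  | true, A, B => A ⋏ B
  | false, A, B => A ⋎ B

namespace TQ
variable {L : Type}
def bin : ∀ (o : Bool) {A B C D : Form L}, TQ L A B → TQ L C D → TQ L (.bin o A C) (.bin o B D)
  | true, _, _, _, _ => Quotient.map₂ (fun f g => f ⊼ g) (fun _ _ h _ _ h' => Eqv.congConj h h')
  | false, _, _, _, _ => Quotient.map₂ (fun f g => f ⊽ g) (fun _ _ h _ _ h' => Eqv.congDisj h h')
def as : ∀ (o : Bool) (A B C : Form L), TQ L (.bin o (.bin o A B) C) (.bin o A (.bin o B C))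
  | true, A, B, C => mk (.bConjFrom A B C)
  | false, A, B, C => mk (.bDisjFrom A B C)
def sa : ∀ (o : Bool) (A B C : Form L), TQ L (.bin o A (.bin o B C)) (.bin o (.bin o A B) C)
  | true, A, B, C => mk (.bConjTo A B C)
  | false, A, B, C => mk (.bDisjTo A B C)
def br : ∀ (o : Bool) (A B : Form L), TQ L (.bin o A B) (.bin o B A)
  | true, A, B => mk (.cConj A B)
  | false, A, B => mk (.cDisj B A)
def d (A B C : Form L) : TQ L (.bin true A (.bin false B C)) (.bin false (.bin true A B) C) :=
  mk (.d A B C)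
def mix (A B : Form L) : TQ L (.bin true A B) (.bin false A B) := mk (.mix A B)

variable {A B C D A' B' C' D' : Form L}
theorem id_comp (f : TQ L A B) : comp (id A) f = f := by
  obtain ⟨f, rfl⟩ := ex f; exact sound (.catIdR f)
theorem comp_id (f : TQ L A B) : comp f (id B) = f := by
  obtain ⟨f, rfl⟩ := ex f; exact sound (.catIdL f)
theorem assoc (f : TQ L A B) (g : TQ L B C) (h : TQ L C D) :
    comp (comp f g) h = comp f (comp g h) := by
  obtain ⟨f, rfl⟩ := ex f; obtain ⟨g, rfl⟩ := ex g; obtain ⟨h, rfl⟩ := ex h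
  exact sound (.catAssoc f g h)
theorem bin_id (o : Bool) (A B : Form L) : bin o (id A) (id B) = id _ := by
  cases o
  · exact sound (.disjOne A B)
  · exact sound (.conjOne A B)
theorem bin_comp (o : Bool) (f : TQ L A B) (g : TQ L B C) (f' : TQ L A' B') (g' : TQ L B' C') :
    bin o (comp f g) (comp f' g') = comp (bin o f f') (bin o g g') := by
  obtain ⟨f, rfl⟩ := ex f; obtain ⟨g, rfl⟩ := ex g
  obtain ⟨f', rfl⟩ := ex f'; obtain ⟨g', rfl⟩ := ex g'
  cases o
  · exact sound (.disjTwo g f g' f')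
  · exact sound (.conjTwo g f g' f')
theorem sa_nat (o : Bool) (f : TQ L A A') (g : TQ L B B') (h : TQ L C C') :
    comp (sa o A B C) (bin o (bin o f g) h) = comp (bin o f (bin o g h)) (sa o A' B' C') := by
  obtain ⟨f, rfl⟩ := ex f; obtain ⟨g, rfl⟩ := ex g; obtain ⟨h, rfl⟩ := ex h
  cases o
  · exact sound (.bDisjNat f g h)
  · exact sound (.bConjNat f g h)
theorem sa_as (o : Bool) (A B C : Form L) : comp (sa o A B C) (as o A B C) = id _ := by
  cases o
  · exact sound (.bDisjIso₁ A B C)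
  · exact sound (.bConjIso₁ A B C)
theorem as_sa (o : Bool) (A B C : Form L) : comp (as o A B C) (sa o A B C) = id _ := by
  cases o
  · exact sound (.bDisjIso₂ A B C)
  · exact sound (.bConjIso₂ A B C)
theorem as_nat (o : Bool) (f : TQ L A A') (g : TQ L B B') (h : TQ L C C') :
    comp (bin o (bin o f g) h) (as o A' B' C') = comp (as o A B C) (bin o f (bin o g h)) := by
  rw [← id_comp (bin o (bin o f g) h), ← as_sa o A B C, assoc, assoc, ← assoc (sa _ _ _ _), sa_nat,
    assoc, sa_as, comp_id]
theorem br_nat (o : Bool) (f : TQ L A A') (g : TQ L B B') :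
    comp (bin o f g) (br o A' B') = comp (br o A B) (bin o g f) := by
  obtain ⟨f, rfl⟩ := ex f; obtain ⟨g, rfl⟩ := ex g
  cases o
  · exact (sound (.cDisjNat f g)).symm
  · exact (sound (.cConjNat f g)).symm
theorem br_br (o : Bool) (A B : Form L) : comp (br o A B) (br o B A) = id _ := by
  cases o
  · exact sound (.cDisjIso A B)
  · exact sound (.cConjIso A B)
theorem pent (o : Bool) (A B C D : Form L) :
    comp (as o (.bin o A B) C D) (as o A B (.bin o C D)) =
    comp (comp (bin o (as o A B C) (id D)) (as o A (.bin o B C) D)) (bin o (id A) (as o B C D)) := by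
  cases o
  · exact sound (.bDisjPent A B C D)
  · exact sound (.bConjPent A B C D)
theorem hex (o : Bool) (A B C : Form L) :
    comp (comp (comp (comp (bin o (br o B A) (id C)) (as o A B C)) (br o A (.bin o B C)))
      (as o B C A)) (bin o (id B) (br o C A)) = as o B A C := by
  cases o
  · exact sound (.bcDisj A B C)
  · exact sound (.bcConj A B C)
theorem d_nat (f : TQ L A A') (g : TQ L B B') (h : TQ L C C') :
    comp (d A B C) (bin false (bin true f g) h) = comp (bin true f (bin false g h)) (d A' B' C') := by
  obtain ⟨f, rfl⟩ := ex f; obtain ⟨g, rfl⟩ := ex g; obtain ⟨h, rfl⟩ := ex h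
  exact sound (.dNat f g h)
theorem mix_nat (f : TQ L A A') (g : TQ L B B') :
    comp (mix A B) (bin false f g) = comp (bin true f g) (mix A' B') := by
  obtain ⟨f, rfl⟩ := ex f; obtain ⟨g, rfl⟩ := ex g
  exact sound (.mixNat f g)
theorem d_conj (A B C D : Form L) : comp (d (.bin true A B) C D) (bin false (as true A B C) (id D)) =
    comp (comp (as true A B (.bin false C D)) (bin true (id A) (d B C D))) (d A (.bin true B C) D) :=
  sound (.dConj A B C D)
theorem d_disj (D C B A : Form L) : comp (bin true (id D) (as false C B A)) (d D C (.bin false B A)) =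
    comp (comp (d D (.bin false C B) A) (bin false (d D C B) (id A))) (as false (.bin true D C) B A) :=
  sound (.dDisj D C B A)
def dr (C B A : Form L) : TQ L (.bin true (.bin false C B) A) (.bin false C (.bin true B A)) :=
  comp (comp (comp (comp (br true (.bin false C B) A) (bin true (id A) (br false C B))) (d A B C))
    (bin false (br true A B) (id C))) (br false (.bin true B A) C)
theorem d_bconj (A B C D : Form L) : comp (bin true (d A B C) (id D)) (dr (.bin true A B) C D) =
    comp (comp (as true A (.bin false B C) D) (bin true (id A) (dr B C D))) (d A B (.bin true C D)) :=
  sound (.dBConj A B C D)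
theorem d_bdisj (D C B A : Form L) : comp (dr D C (.bin false B A)) (bin false (id D) (d C B A)) =
    comp (comp (d (.bin false D C) B A) (bin false (dr D C B) (id A))) (as false D (.bin true C B) A) :=
  sound (.dBDisj D C B A)
theorem mix_bconj (A B C : Form L) : comp (sa true A B C) (mix (.bin true A B) C) =
    comp (bin true (id A) (mix B C)) (d A B C) := sound (.mixBConj A B C)
theorem mix_bdisj (C B A : Form L) : comp (mix C (.bin false B A)) (sa false C B A) =
    comp (d C B A) (bin false (mix C B) (id A)) := sound (.mixBDisj C B A)
theorem mix_c (A B : Form L) : comp (br true A B) (mix B A) = comp (mix A B) (br false A B) :=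
  sound (.mixC A B)
end TQ
end

section
open CategoryTheory

/-- formulas with a formal unit -/
abbrev OF (L : Type) := Option (Form L)

def bi {L : Type} (o : Bool) : OF L → OF L → OF L
  | none, Y => Y
  | some A, none => some A
  | some A, some B => some (.bin o A B)

inductive Hm (L : Type) : OF L → OF L → Type
  | s {A B : Form L} : TQ L A B → Hm L (some A) (some B)
  | n : Hm L none none

namespace Hm
variable {L : Type}
def id : ∀ X : OF L, Hm L X X
  | none => n
  | some A => s (.id A)
def comp : ∀ {X Y Z : OF L}, Hm L X Y → Hm L Y Z → Hm L X Z
  | _, _, _, s f, s g => s (.comp f g)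
  | _, _, _, n, n => n
def bin (o : Bool) : ∀ {X X' Y Y' : OF L}, Hm L X X' → Hm L Y Y' → Hm L (bi o X Y) (bi o X' Y')
  | _, _, _, _, n, g => g
  | _, _, _, _, s f, n => s f
  | _, _, _, _, s f, s g => s (.bin o f g)
def as (o : Bool) : ∀ X Y Z : OF L, Hm L (bi o (bi o X Y) Z) (bi o X (bi o Y Z))
  | none, Y, Z => id (bi o Y Z)
  | some A, none, Z => id (bi o (some A) Z)
  | some A, some B, none => id (bi o (some A) (some B))
  | some A, some B, some C => s (.as o A B C)
def sa (o : Bool) : ∀ X Y Z : OF L, Hm L (bi o X (bi o Y Z)) (bi o (bi o X Y) Z)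
  | none, Y, Z => id (bi o Y Z)
  | some A, none, Z => id (bi o (some A) Z)
  | some A, some B, none => id (bi o (some A) (some B))
  | some A, some B, some C => s (.sa o A B C)
def br (o : Bool) : ∀ X Y : OF L, Hm L (bi o X Y) (bi o Y X)
  | none, none => n
  | none, some A => id (some A)
  | some A, none => id (some A)
  | some A, some B => s (.br o A B)
def ru (o : Bool) : ∀ X : OF L, Hm L (bi o X none) X
  | none => n
  | some A => id (some A)
def ru' (o : Bool) : ∀ X : OF L, Hm L X (bi o X none)
  | none => n
  | some A => id (some A)
def d : ∀ X Y Z : OF L, Hm L (bi true X (bi false Y Z)) (bi false (bi true X Y) Z)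
  | none, Y, Z => id (bi false Y Z)
  | some A, none, none => id (some A)
  | some A, none, some C => s (.mix A C)
  | some A, some B, none => id (some (.bin true A B))
  | some A, some B, some C => s (.d A B C)

variable {X Y Z W X' Y' Z' W' : OF L}
theorem id_comp (f : Hm L X Y) : comp (id X) f = f := by
  cases f with
  | s f => exact congrArg s (TQ.id_comp f)
  | n => rfl
theorem comp_id (f : Hm L X Y) : comp f (id Y) = f := by
  cases f with
  | s f => exact congrArg s (TQ.comp_id f)
  | n => rfl
theorem assoc (f : Hm L X Y) (g : Hm L Y Z) (h : Hm L Z W) :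
    comp (comp f g) h = comp f (comp g h) := by
  cases f <;> cases g <;> cases h
  · exact congrArg s (TQ.assoc _ _ _)
  · rfl
theorem bin_id (o : Bool) (X Y : OF L) : bin o (id X) (id Y) = id _ := by
  cases X <;> cases Y <;> try rfl
  exact congrArg s (TQ.bin_id o _ _)
theorem bin_comp (o : Bool) (f : Hm L X Y) (g : Hm L Y Z) (f' : Hm L X' Y') (g' : Hm L Y' Z') :
    bin o (comp f g) (comp f' g') = comp (bin o f f') (bin o g g') := by
  cases f <;> cases g <;> cases f' <;> cases g' <;> try rfl
  exact congrArg s (TQ.bin_comp o _ _ _ _)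
theorem as_nat (o : Bool) (f : Hm L X X') (g : Hm L Y Y') (h : Hm L Z Z') :
    comp (bin o (bin o f g) h) (as o X' Y' Z') = comp (as o X Y Z) (bin o f (bin o g h)) := by
  cases f <;> cases g <;> cases h <;> try exact (comp_id _).trans (id_comp _).symm
  exact congrArg s (TQ.as_nat o _ _ _)
theorem sa_as (o : Bool) (X Y Z : OF L) : comp (sa o X Y Z) (as o X Y Z) = id _ := by
  cases X <;> cases Y <;> cases Z <;> try exact id_comp _
  exact congrArg s (TQ.sa_as o _ _ _)
theorem as_sa (o : Bool) (X Y Z : OF L) : comp (as o X Y Z) (sa o X Y Z) = id _ := by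
  cases X <;> cases Y <;> cases Z <;> try exact id_comp _
  exact congrArg s (TQ.as_sa o _ _ _)
theorem br_nat (o : Bool) (f : Hm L X X') (g : Hm L Y Y') :
    comp (bin o f g) (br o X' Y') = comp (br o X Y) (bin o g f) := by
  cases f <;> cases g <;> try exact (comp_id _).trans (id_comp _).symm
  exact congrArg s (TQ.br_nat o _ _)
theorem br_br (o : Bool) (X Y : OF L) : comp (br o X Y) (br o Y X) = id _ := by
  cases X <;> cases Y <;> try exact id_comp _
  exact congrArg s (TQ.br_br o _ _)
theorem pent (o : Bool) (X Y Z W : OF L) :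
    comp (bin o (as o X Y Z) (id W)) (comp (as o X (bi o Y Z) W) (bin o (id X) (as o Y Z W))) =
    comp (as o (bi o X Y) Z W) (as o X Y (bi o Z W)) := by
  cases X <;> cases Y <;> cases Z <;> cases W
  case some.some.some.some => exact congrArg s ((TQ.assoc _ _ _).symm.trans (TQ.pent o _ _ _ _).symm)
  all_goals simp [as, bi, id, bin, comp, TQ.id_comp, TQ.comp_id, TQ.bin_id]

theorem hex (o : Bool) (X Y Z : OF L) :
    comp (as o X Y Z) (comp (br o X (bi o Y Z)) (as o Y Z X)) =
    comp (bin o (br o X Y) (id Z)) (comp (as o Y X Z) (bin o (id Y) (br o X Z))) := by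
  cases X <;> cases Y <;> cases Z
  case some.some.some A B C =>
    refine congrArg s ?_
    rw [← TQ.hex o A B C]
    simp only [← TQ.assoc]
    rw [← TQ.bin_comp, TQ.br_br, TQ.id_comp, TQ.bin_id, TQ.id_comp]
    simp only [TQ.assoc]
    rw [← TQ.bin_comp, TQ.br_br, TQ.id_comp, TQ.bin_id, TQ.comp_id]
  all_goals simp [as, br, bi, id, bin, comp, TQ.id_comp, TQ.comp_id, TQ.bin_id]
theorem ru_nat (o : Bool) (f : Hm L X X') : comp (bin o f n) (ru o X') = comp (ru o X) f := by
  cases f <;> exact (comp_id _).trans (id_comp _).symm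
theorem tri (o : Bool) (X Y : OF L) : comp (as o X none Y) (bin o (id X) (id Y)) =
    bin o (ru o X) (id Y) := by
  cases X <;> cases Y <;> simp [as, br, bi, id, bin, comp, ru, TQ.id_comp, TQ.comp_id, TQ.bin_id]
end Hm

def OB (L : Type) (_ : Bool) := OF L

instance (L : Type) (o : Bool) : Category (OB L o) where
  Hom X Y := Hm L X Y
  id X := Hm.id X
  comp f g := Hm.comp f g
  id_comp f := Hm.id_comp f
  comp_id f := Hm.comp_id f
  assoc f g h := Hm.assoc f g h

instance (L : Type) (o : Bool) : MonoidalCategoryStruct (OB L o) where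
  tensorObj X Y := bi o X Y
  whiskerLeft X _ _ f := Hm.bin o (Hm.id X) f
  whiskerRight f Y := Hm.bin o f (Hm.id Y)
  tensorHom f g := Hm.bin o f g
  tensorUnit := (none : OF L)
  associator X Y Z := ⟨Hm.as o X Y Z, Hm.sa o X Y Z, Hm.as_sa o _ _ _, Hm.sa_as o _ _ _⟩
  leftUnitor X := ⟨Hm.id X, Hm.id X, Hm.id_comp _, Hm.id_comp _⟩
  rightUnitor X := ⟨Hm.ru o X, Hm.ru' o X, by cases X <;> exact Hm.id_comp _,
    by cases X <;> exact Hm.id_comp _⟩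

instance (L : Type) (o : Bool) : MonoidalCategory (OB L o) := MonoidalCategory.ofTensorHom
  (id_tensorHom_id := fun X Y => Hm.bin_id o X Y)
  (id_tensorHom := fun _ _ _ _ => rfl)
  (tensorHom_id := fun _ _ => rfl)
  (tensorHom_comp_tensorHom := fun f g h k => (Hm.bin_comp o f h g k).symm)
  (associator_naturality := fun f g h => Hm.as_nat o f g h)
  (leftUnitor_naturality := fun f => (Hm.comp_id _).trans (Hm.id_comp _).symm)
  (rightUnitor_naturality := fun f => Hm.ru_nat o f)
  (pentagon := fun X Y Z W => Hm.pent o X Y Z W)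
  (triangle := fun X Y => Hm.tri o X Y)

theorem Hm.hex' {L : Type} (o : Bool) (X Y Z : OF L) :
    comp (sa o X Y Z) (comp (br o (bi o X Y) Z) (sa o Z X Y)) =
    comp (bin o (id X) (br o Y Z)) (comp (sa o X Z Y) (bin o (br o X Z) (id Y))) := by
  have h := hex o Z X Y
  have e1 : comp (sa o X Y Z) (comp (br o (bi o X Y) Z) (sa o Z X Y)) =
      comp (comp (sa o X Y Z) (comp (br o (bi o X Y) Z) (sa o Z X Y)))
        (comp (comp (bin o (br o Z X) (id Y)) (comp (as o X Z Y) (bin o (id X) (br o Z Y))))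
        (comp (bin o (id X) (br o Y Z)) (comp (sa o X Z Y) (bin o (br o X Z) (id Y))))) := by
    rw [assoc (bin o (br o Z X) (id Y)), assoc (as o X Z Y), ← assoc (bin o (id X) (br o Z Y)),
      ← bin_comp, br_br, id_comp, bin_id, id_comp, ← assoc (as o X Z Y), as_sa, id_comp, ← bin_comp,
      br_br, id_comp, bin_id, comp_id]
  rw [e1, ← h]
  simp only [assoc]
  rw [← assoc (sa o Z X Y), sa_as, id_comp, ← assoc (br o (bi o X Y) Z), br_br, id_comp,
    ← assoc (sa o X Y Z), sa_as, id_comp]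

instance (L : Type) (o : Bool) : SymmetricCategory (OB L o) where
  braiding X Y := ⟨Hm.br o X Y, Hm.br o Y X, Hm.br_br o X Y, Hm.br_br o Y X⟩
  braiding_naturality_right X _ _ f := Hm.br_nat o (Hm.id X) f
  braiding_naturality_left f Z := Hm.br_nat o f (Hm.id Z)
  hexagon_forward X Y Z := Hm.hex o X Y Z
  hexagon_reverse X Y Z := Hm.hex' o X Y Z
  symmetry X Y := Hm.br_br o X Y
end

section
open CategoryTheory MonoidalCategory

theorem tensorμ_br {C : Type*} [Category C] [MonoidalCategory C] [SymmetricCategory C]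
    (X Y Z W : C) : (β_ (X ⊗ Y) (Z ⊗ W)).hom ≫ tensorμ Z W X Y =
      tensorμ X Y Z W ≫ ((β_ X Z).hom ⊗ₘ (β_ Y W).hom) := by
  simp [tensorμ, SymmetricCategory.braiding_swap_eq_inv_braiding W X, MonoidalCategory.tensorHom_def]

namespace Hm
variable {L : Type}
def mu (o : Bool) (X Y Z W : OF L) : Hm L (bi o (bi o X Y) (bi o Z W)) (bi o (bi o X Z) (bi o Y W)) :=
  comp (as o X Y (bi o Z W)) (comp (bin o (id X) (sa o Y Z W))
    (comp (bin o (id X) (bin o (br o Y Z) (id W)))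
    (comp (bin o (id X) (as o Z Y W)) (sa o X Z (bi o Y W)))))
theorem mu_br (o : Bool) (X Y Z W : OF L) :
    comp (br o (bi o X Y) (bi o Z W)) (mu o Z W X Y) =
      comp (mu o X Y Z W) (bin o (br o X Z) (br o Y W)) :=
  tensorμ_br (C := OB L o) X Y Z W
theorem mu_nat (o : Bool) {X Y Z W X' Y' Z' W' : OF L} (f : Hm L X X') (g : Hm L Y Y')
    (h : Hm L Z Z') (k : Hm L W W') :
    comp (bin o (bin o f g) (bin o h k)) (mu o X' Y' Z' W') =
      comp (mu o X Y Z W) (bin o (bin o f h) (bin o g k)) :=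
  tensorμ_natural (C := OB L o) f g h k
theorem mu_as (o : Bool) (X₁ X₂ Y₁ Y₂ Z₁ Z₂ : OF L) :
    comp (bin o (mu o X₁ X₂ Y₁ Y₂) (id (bi o Z₁ Z₂))) (comp (mu o (bi o X₁ Y₁) (bi o X₂ Y₂) Z₁ Z₂)
      (bin o (as o X₁ Y₁ Z₁) (as o X₂ Y₂ Z₂))) =
    comp (as o (bi o X₁ X₂) (bi o Y₁ Y₂) (bi o Z₁ Z₂)) (comp
      (bin o (id (bi o X₁ X₂)) (mu o Y₁ Y₂ Z₁ Z₂)) (mu o X₁ X₂ (bi o Y₁ Z₁) (bi o Y₂ Z₂))) :=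
  tensor_associativity (C := OB L o) X₁ X₂ Y₁ Y₂ Z₁ Z₂
end Hm

def Form.ms {L : Type} : Form L → Multiset L
  | .letter a => {a}
  | .conj A B => A.ms + B.ms
  | .disj A B => A.ms + B.ms
theorem Form.ms_bin {L : Type} (o : Bool) (A B : Form L) : (Form.bin o A B).ms = A.ms + B.ms := by
  cases o <;> rfl
theorem Form.ms_ne {L : Type} (A : Form L) : A.ms ≠ 0 := by
  induction A with
  | letter a => simp [Form.ms]
  | conj A B h _ => intro h'; exact h (add_eq_zero.1 h').1
  | disj A B h _ => intro h'; exact h (add_eq_zero.1 h').1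

/-- arrows built from associativity and commutativity only -/
inductive TQ.AC {L : Type} : ∀ {A B : Form L}, TQ L A B → Prop
  | id (A : Form L) : TQ.AC (TQ.id A)
  | comp {A B C : Form L} {f : TQ L A B} {g : TQ L B C} : TQ.AC f → TQ.AC g → TQ.AC (TQ.comp f g)
  | bin (o : Bool) {A B C D : Form L} {f : TQ L A B} {g : TQ L C D} :
      TQ.AC f → TQ.AC g → TQ.AC (TQ.bin o f g)
  | as (o : Bool) (A B C : Form L) : TQ.AC (TQ.as o A B C)
  | sa (o : Bool) (A B C : Form L) : TQ.AC (TQ.sa o A B C)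
  | br (o : Bool) (A B : Form L) : TQ.AC (TQ.br o A B)

theorem TQ.AC.ms {L : Type} {A B : Form L} {f : TQ L A B} (h : TQ.AC f) : A.ms = B.ms := by
  induction h with
  | id => rfl
  | comp _ _ h h' => exact h.trans h'
  | bin o _ _ h h' => simp only [Form.ms_bin, h, h']
  | as o => simp only [Form.ms_bin, add_assoc]
  | sa o => simp only [Form.ms_bin, add_assoc]
  | br o => simp only [Form.ms_bin, add_comm]

theorem TQ.AC.inv {L : Type} {A B : Form L} {f : TQ L A B} (h : TQ.AC f) :
    ∃ g, TQ.AC g ∧ TQ.comp f g = TQ.id A ∧ TQ.comp g f = TQ.id B := by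
  induction h with
  | id => exact ⟨_, .id _, TQ.id_comp _, TQ.id_comp _⟩
  | @comp A B C f g _ _ h h' =>
    obtain ⟨f', a, b, c⟩ := h
    obtain ⟨g', a', b', c'⟩ := h'
    refine ⟨TQ.comp g' f', a'.comp a, ?_, ?_⟩
    · rw [TQ.assoc, ← TQ.assoc g, b', TQ.id_comp, b]
    · rw [TQ.assoc, ← TQ.assoc f', c, TQ.id_comp, c']
  | bin o _ _ h h' =>
    obtain ⟨f', a, b, c⟩ := h
    obtain ⟨g', a', b', c'⟩ := h'
    refine ⟨TQ.bin o f' g', a.bin o a', ?_, ?_⟩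
    · rw [← TQ.bin_comp, b, b', TQ.bin_id]
    · rw [← TQ.bin_comp, c, c', TQ.bin_id]
  | as o => exact ⟨_, .sa o _ _ _, TQ.as_sa o _ _ _, TQ.sa_as o _ _ _⟩
  | sa o => exact ⟨_, .as o _ _ _, TQ.sa_as o _ _ _, TQ.as_sa o _ _ _⟩
  | br o => exact ⟨_, .br o _ _, TQ.br_br o _ _, TQ.br_br o _ _⟩

inductive Hm.AC {L : Type} : ∀ {X Y : OF L}, Hm L X Y → Prop
  | s {A B : Form L} {f : TQ L A B} : TQ.AC f → Hm.AC (Hm.s f)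
  | n : Hm.AC Hm.n

namespace Hm.AC
variable {L : Type}
theorem id (X : OF L) : AC (Hm.id X) := by
  cases X
  · exact .n
  · exact .s (.id _)
theorem comp {X Y Z : OF L} {f : Hm L X Y} {g : Hm L Y Z} (hf : AC f) (hg : AC g) :
    AC (Hm.comp f g) := by
  cases hf <;> cases hg
  · exact .s (.comp ‹_› ‹_›)
  · exact .n
theorem bin (o : Bool) {X Y Z W : OF L} {f : Hm L X Y} {g : Hm L Z W} (hf : AC f) (hg : AC g) :
    AC (Hm.bin o f g) := by
  cases hf <;> cases hg
  · exact .s (.bin o ‹_› ‹_›)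
  · exact .s ‹_›
  · exact .s ‹_›
  · exact .n
theorem as (o : Bool) (X Y Z : OF L) : AC (Hm.as o X Y Z) := by
  cases X <;> cases Y <;> cases Z <;> first | exact id _ | exact .s (.as o _ _ _)
theorem sa (o : Bool) (X Y Z : OF L) : AC (Hm.sa o X Y Z) := by
  cases X <;> cases Y <;> cases Z <;> first | exact id _ | exact .s (.sa o _ _ _)
theorem br (o : Bool) (X Y : OF L) : AC (Hm.br o X Y) := by
  cases X <;> cases Y <;> first | exact id _ | exact .s (.br o _ _)
theorem inv {X Y : OF L} {f : Hm L X Y} (h : AC f) :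
    ∃ g, AC g ∧ Hm.comp f g = Hm.id X ∧ Hm.comp g f = Hm.id Y := by
  cases h with
  | s h =>
    obtain ⟨g, a, b, c⟩ := h.inv
    exact ⟨_, .s a, congrArg _ b, congrArg _ c⟩
  | n => exact ⟨_, .n, rfl, rfl⟩
end Hm.AC

/-- a splitting of a formula -/
structure SpD (L : Type) (o : Bool) (C : OF L) where
  X : OF L
  Y : OF L
  s : Hm L C (bi o X Y)

namespace SpD
variable {L : Type} {o : Bool}
def atm (o : Bool) (C : Form L) : Bool → SpD L o (some C)
  | true => ⟨some C, none, Hm.id (some C)⟩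
  | false => ⟨none, some C, Hm.id (some C)⟩
def mul (o : Bool) {A B : OF L} (u : SpD L o A) (v : SpD L o B) : SpD L o (bi o A B) :=
  ⟨bi o u.X v.X, bi o u.Y v.Y, Hm.comp (Hm.bin o u.s v.s) (Hm.mu o u.X u.Y v.X v.Y)⟩
def Rel {C D : OF L} (u : SpD L o C) (v : SpD L o D) (h : Hm L C D) : Prop :=
  ∃ (f : Hm L u.X v.X) (g : Hm L u.Y v.Y), f.AC ∧ g.AC ∧
    Hm.comp h v.s = Hm.comp u.s (Hm.bin o f g)

theorem Rel.id {C : OF L} (u : SpD L o C) : Rel u u (Hm.id C) :=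
  ⟨Hm.id _, Hm.id _, .id _, .id _, by
    rw [Hm.bin_id, Hm.comp_id, Hm.id_comp]⟩
theorem Rel.comp {C D E : OF L} {u : SpD L o C} {v : SpD L o D} {w : SpD L o E} {h : Hm L C D}
    {k : Hm L D E} (r : Rel u v h) (r' : Rel v w k) : Rel u w (Hm.comp h k) := by
  obtain ⟨f, g, a, b, c⟩ := r
  obtain ⟨f', g', a', b', c'⟩ := r'
  refine ⟨_, _, a.comp a', b.comp b', ?_⟩
  rw [Hm.bin_comp, ← Hm.assoc, ← c, Hm.assoc, Hm.assoc, ← c']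
theorem Rel.inv {C D : OF L} {u : SpD L o C} {v : SpD L o D} {h : Hm L C D} {k : Hm L D C}
    (r : Rel u v h) (e : Hm.comp h k = Hm.id _) (e' : Hm.comp k h = Hm.id _) : Rel v u k := by
  obtain ⟨f, g, a, b, c⟩ := r
  obtain ⟨f', a', x, y⟩ := a.inv
  obtain ⟨g', b', x', y'⟩ := b.inv
  refine ⟨f', g', a', b', ?_⟩
  have : v.s = Hm.comp k (Hm.comp h v.s) := by
    rw [← Hm.assoc]; exact ((congrArg (fun z => Hm.comp z v.s) e').trans (Hm.id_comp _)).symm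
  rw [this, c, Hm.assoc, Hm.assoc, ← Hm.bin_comp, x, x', Hm.bin_id, Hm.comp_id]
theorem Rel.mul {A B C D : OF L} {u : SpD L o A} {v : SpD L o B} {u' : SpD L o C} {v' : SpD L o D}
    {h : Hm L A C} {k : Hm L B D} (r : Rel u u' h) (r' : Rel v v' k) :
    Rel (mul o u v) (mul o u' v') (Hm.bin o h k) := by
  obtain ⟨f, g, a, b, c⟩ := r
  obtain ⟨f', g', a', b', c'⟩ := r'
  refine ⟨_, _, a.bin o a', b.bin o b', ?_⟩
  dsimp only [SpD.mul]
  rw [Hm.assoc, ← Hm.mu_nat, ← Hm.assoc, ← Hm.assoc, ← Hm.bin_comp, ← Hm.bin_comp, ← c, ← c']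
theorem Rel.br {A B : OF L} (u : SpD L o A) (v : SpD L o B) :
    Rel (SpD.mul o u v) (SpD.mul o v u) (Hm.br o A B) := by
  refine ⟨_, _, .br o _ _, .br o _ _, ?_⟩
  dsimp only [SpD.mul]
  rw [Hm.assoc, ← Hm.mu_br, ← Hm.assoc, ← Hm.assoc, Hm.br_nat]
theorem Rel.as {A B C : OF L} (u : SpD L o A) (v : SpD L o B) (w : SpD L o C) :
    Rel (SpD.mul o (SpD.mul o u v) w) (SpD.mul o u (SpD.mul o v w)) (Hm.as o A B C) := by
  refine ⟨_, _, .as o _ _ _, .as o _ _ _, ?_⟩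
  dsimp only [SpD.mul]
  have h1 : Hm.bin o (Hm.comp (Hm.bin o u.s v.s) (Hm.mu o u.X u.Y v.X v.Y)) w.s =
    Hm.comp (Hm.bin o (Hm.bin o u.s v.s) w.s) (Hm.bin o (Hm.mu o u.X u.Y v.X v.Y) (Hm.id _)) := by
    rw [← Hm.bin_comp, Hm.comp_id]
  have h2 : Hm.bin o u.s (Hm.comp (Hm.bin o v.s w.s) (Hm.mu o v.X v.Y w.X w.Y)) =
    Hm.comp (Hm.bin o u.s (Hm.bin o v.s w.s)) (Hm.bin o (Hm.id _) (Hm.mu o v.X v.Y w.X w.Y)) := by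
    rw [← Hm.bin_comp, Hm.comp_id]
  rw [h1, h2, Hm.assoc, Hm.assoc, Hm.assoc, Hm.mu_as, ← Hm.assoc, ← Hm.assoc, ← Hm.as_nat]
  simp only [Hm.assoc]
theorem Rel.atm {C D : Form L} {h : TQ L C D} (ac : TQ.AC h) (b : Bool) :
    Rel (SpD.atm o C b) (SpD.atm o D b) (Hm.s h) := by
  cases b
  · exact ⟨Hm.n, Hm.s h, .n, .s ac, (Hm.comp_id _).trans (Hm.id_comp _).symm⟩
  · exact ⟨Hm.s h, Hm.n, .s ac, .n, (Hm.comp_id _).trans (Hm.id_comp _).symm⟩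
end SpD

open Classical in
noncomputable def sp {L : Type} (S : Set L) : ∀ (o : Bool) (C : Form L), SpD L o (some C)
  | o, .letter a => .atm o _ (decide (a ∈ S))
  | true, .conj A B => SpD.mul true (sp S true A) (sp S true B)
  | false, .disj A B => SpD.mul false (sp S false A) (sp S false B)
  | false, .conj A B => .atm false _ (decide (∀ a ∈ (Form.conj A B).ms, a ∈ S))
  | true, .disj A B => .atm true _ (decide (∀ a ∈ (Form.disj A B).ms, a ∈ S))

namespace sp
variable {L : Type} {S : Set L}
theorem bin_eq (o : Bool) (A B : Form L) : sp S o (.bin o A B) = SpD.mul o (sp S o A) (sp S o B) := by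
  cases o
  · exact sp.eq_3 ..
  · exact sp.eq_2 ..
open Classical in
theorem not_eq (o : Bool) (A B : Form L) : sp S o (.bin (!o) A B) =
    .atm o _ (decide (∀ a ∈ (Form.bin (!o) A B).ms, a ∈ S)) := by
  cases o
  · exact sp.eq_4 ..
  · exact sp.eq_5 ..
open Classical in
theorem nat' {o o' : Bool} (ho : o' = !o) {A B C D : Form L} {h : TQ L (.bin o' A B) (.bin o' C D)}
    (ac : TQ.AC h) : SpD.Rel (sp S o _) (sp S o _) (Hm.s h) := by
  subst ho
  rw [not_eq, not_eq, ac.ms]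
  exact SpD.Rel.atm ac _
theorem nat (o : Bool) {A B : Form L} {h : TQ L A B} (ac : TQ.AC h) :
    SpD.Rel (sp S o A) (sp S o B) (Hm.s h) := by
  induction ac with
  | id => exact .id _
  | comp _ _ h h' => exact h.comp h'
  | @bin o' A B C D f g hf hg h h' =>
    by_cases e : o' = o
    · subst e; rw [bin_eq, bin_eq]; exact h.mul h'
    · exact nat' (by revert e; cases o <;> cases o' <;> simp) (hf.bin o' hg)
  | as o' A B C =>
    by_cases e : o' = o
    · subst e; simp only [bin_eq]; exact .as _ _ _
    · exact nat' (by revert e; cases o <;> cases o' <;> simp) (.as ..)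
  | sa o' A B C =>
    by_cases e : o' = o
    · subst e; simp only [bin_eq]; exact (SpD.Rel.as _ _ _).inv (congrArg Hm.s (TQ.as_sa ..)) (congrArg Hm.s (TQ.sa_as ..))
    · exact nat' (by revert e; cases o <;> cases o' <;> simp) (.sa ..)
  | br o' A B =>
    by_cases e : o' = o
    · subst e; simp only [bin_eq]; exact .br _ _
    · exact nat' (by revert e; cases o <;> cases o' <;> simp) (.br ..)
theorem mul_atm (o : Bool) (A B : Form L) (b : Bool) :
    SpD.mul o (SpD.atm o A b) (SpD.atm o B b) = SpD.atm o _ b := by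
  cases b
  · show SpD.mk none (some _) _ = SpD.mk none (some _) _
    congr 1
    simp [SpD.atm, Hm.mu, Hm.as, Hm.sa, Hm.br, bi, Hm.id, Hm.bin, Hm.comp, TQ.id_comp, TQ.bin_id]
  · show SpD.mk (some _) none _ = SpD.mk (some _) none _
    congr 1
    simp [SpD.atm, Hm.mu, Hm.as, Hm.sa, Hm.br, bi, Hm.id, Hm.bin, Hm.comp, TQ.id_comp, TQ.bin_id]
open Classical in
theorem all_in (o : Bool) {C : Form L} (h : ∀ a ∈ C.ms, a ∈ S) : sp S o C = SpD.atm o C true := by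
  induction C with
  | letter a => rw [sp.eq_1]; simp [h a (by simp [Form.ms])]
  | conj A B ha hb =>
    cases o
    · rw [sp.eq_4, decide_eq_true h]
    · rw [sp.eq_2, ha (fun a m => h a (Multiset.mem_add.2 (.inl m))),
        hb (fun a m => h a (Multiset.mem_add.2 (.inr m)))]
      exact mul_atm true A B _
  | disj A B ha hb =>
    cases o
    · rw [sp.eq_3, ha (fun a m => h a (Multiset.mem_add.2 (.inl m))),
        hb (fun a m => h a (Multiset.mem_add.2 (.inr m)))]
      exact mul_atm false A B _
    · rw [sp.eq_5, decide_eq_true h]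
open Classical in
theorem all_out (o : Bool) {C : Form L} (h : ∀ a ∈ C.ms, a ∉ S) : sp S o C = SpD.atm o C false := by
  have key : ∀ D : Form L, (∀ a ∈ D.ms, a ∉ S) → ¬ ∀ a ∈ D.ms, a ∈ S := by
    intro D h h'
    obtain ⟨a, ha⟩ := Multiset.exists_mem_of_ne_zero D.ms_ne
    exact h a ha (h' a ha)
  induction C with
  | letter a => rw [sp.eq_1]; simp [h a (by simp [Form.ms])]
  | conj A B ha hb =>
    cases o
    · rw [sp.eq_4, decide_eq_false (key _ h)]
    · rw [sp.eq_2, ha (fun a m => h a (Multiset.mem_add.2 (.inl m))),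
        hb (fun a m => h a (Multiset.mem_add.2 (.inr m)))]
      exact mul_atm true A B _
  | disj A B ha hb =>
    cases o
    · rw [sp.eq_3, ha (fun a m => h a (Multiset.mem_add.2 (.inl m))),
        hb (fun a m => h a (Multiset.mem_add.2 (.inr m)))]
      exact mul_atm false A B _
    · rw [sp.eq_5, decide_eq_false (key _ h)]
theorem mul_mix (o : Bool) (A B : Form L) :
    SpD.mul o (SpD.atm o A true) (SpD.atm o B false) =
      ⟨some A, some B, Hm.id (bi o (some A) (some B))⟩ := by
  show SpD.mk (some _) (some _) _ = SpD.mk (some _) (some _) _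
  congr 1
  simp [SpD.atm, Hm.mu, Hm.as, Hm.sa, Hm.br, bi, Hm.id, Hm.bin, Hm.comp, TQ.id_comp, TQ.bin_id]
end sp

theorem Form.size_pos {L : Type} (A : Form L) : 0 < A.size := by
  induction A <;> simp only [Form.size] <;> omega

theorem Form.size_bin {L : Type} (o : Bool) (A B : Form L) :
    (Form.bin o A B).size = A.size + B.size := by cases o <;> rfl

/-- every arrow out of a letter is an identity -/
theorem Term.one {L : Type} {A B : Form L} (f : Term L A B) :
    A.size = 1 → ∃ h : A = B, TQ.mk f = h ▸ TQ.id A := by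
  have p := @Form.size_pos L
  induction f with
  | id A => intro _; exact ⟨rfl, rfl⟩
  | comp g f hg hf =>
    intro h
    obtain ⟨rfl, e⟩ := hf h
    obtain ⟨rfl, e'⟩ := hg h
    refine ⟨rfl, ?_⟩
    have : TQ.mk (g ⬝ f) = TQ.comp (TQ.mk f) (TQ.mk g) := rfl
    rw [this, e, e']; exact TQ.id_comp _
  | conj f g => intro h; rename_i A B _ _ _ _; have := p A; have := p B; simp only [Form.size] at h; omega
  | disj f g => intro h; rename_i A B _ _ _ _; have := p A; have := p B; simp only [Form.size] at h; omega
  | _ A B => intro h; have := p A; have := p B; simp only [Form.size] at h; omega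

theorem TQ.one {L : Type} {A : Form L} (f : TQ L A A) (h : A.size = 1) : f = TQ.id A := by
  obtain ⟨f, rfl⟩ := TQ.ex f
  obtain ⟨_, e⟩ := f.one h
  exact e

theorem TQ.AC.endo {L : Type} {A : Form L} (hn : A.ms.Nodup) {h : TQ L A A} (ac : TQ.AC h) :
    h = TQ.id A := by
  have key : ∀ (o : Bool) (A B : Form L), (∀ {h : TQ L A A}, TQ.AC h → h = TQ.id A) →
      (∀ {h : TQ L B B}, TQ.AC h → h = TQ.id B) → (Form.bin o A B).ms.Nodup →
      ∀ {h : TQ L (.bin o A B) (.bin o A B)}, TQ.AC h → h = TQ.id _ := by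
    intro o A B ha hb hn h ac
    rw [Form.ms_bin, Multiset.nodup_add] at hn
    obtain ⟨hA, hB, hd⟩ := hn
    have r := sp.nat (S := {a | a ∈ A.ms}) o ac
    rw [sp.bin_eq, sp.all_in o (S := {a | a ∈ A.ms}) (C := A) (fun _ h => h), sp.all_out o (S := {a | a ∈ A.ms}) (C := B)
      (fun a m m' => Multiset.disjoint_left.1 hd m' m), sp.mul_mix] at r
    obtain ⟨f, g, a, b, c⟩ := r
    dsimp only at f g a b c
    cases a with | s a => cases b with | s b =>
    rw [ha a, hb b] at c
    have c' : Hm.s h = Hm.bin o (Hm.id (some A)) (Hm.id (some B)) :=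
      (Hm.comp_id _).symm.trans (c.trans (Hm.id_comp _))
    rw [Hm.bin_id] at c'
    exact Hm.s.inj c'
  induction A with
  | letter a => exact TQ.one _ rfl
  | conj A B ha hb =>
    have hn' := Multiset.nodup_add.1 hn
    exact key true A B (fun h => ha hn'.1 h) (fun h => hb hn'.2.1 h) hn ac
  | disj A B ha hb =>
    have hn' := Multiset.nodup_add.1 hn
    exact key false A B (fun h => ha hn'.1 h) (fun h => hb hn'.2.1 h) hn ac

theorem Hm.AC.uniq {L : Type} {X Y : OF L} (hn : ∀ A, X = some A → A.ms.Nodup) {f g : Hm L X Y}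
    (hf : f.AC) (hg : g.AC) : f = g := by
  cases hf with
  | n => cases hg; rfl
  | @s A B f hf =>
    cases hg with | @s _ _ g hg =>
    obtain ⟨k, a, b, c⟩ := hg.inv
    have := TQ.AC.endo (hn A rfl) (hf.comp a)
    have e : TQ.comp (TQ.comp f k) g = g := by rw [this, TQ.id_comp]
    rw [TQ.assoc, c, TQ.comp_id] at e
    rw [e]
end

section
theorem Term.msEq {L : Type} {A B : Form L} (f : Term L A B) : A.ms = B.ms := by
  induction f with
  | id => rfl
  | comp _ _ h h' => exact h'.trans h
  | conj _ _ h h' => exact congrArg₂ _ h h'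
  | disj _ _ h h' => exact congrArg₂ _ h h'
  | bConjTo => exact (add_assoc _ _ _).symm
  | bConjFrom => exact add_assoc _ _ _
  | bDisjTo => exact (add_assoc _ _ _).symm
  | bDisjFrom => exact add_assoc _ _ _
  | cConj => exact add_comm _ _
  | cDisj => exact add_comm _ _
  | d => exact (add_assoc _ _ _).symm
  | mix => rfl

theorem TQ.ms {L : Type} {A B : Form L} (f : TQ L A B) : A.ms = B.ms := by
  obtain ⟨f, -⟩ := TQ.ex f
  exact f.msEq

def omS {L : Type} : OF L → Multiset L
  | none => 0
  | some A => A.ms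
theorem omS_bi {L : Type} (o : Bool) (X Y : OF L) : omS (bi o X Y) = omS X + omS Y := by
  cases X <;> cases Y <;> simp [bi, omS, Form.ms_bin]

def HmM (L : Type) : MX0 L where
  Ob := OF L
  Hom := Hm L
  id := Hm.id
  comp := Hm.comp
  id_comp := Hm.id_comp
  comp_id := Hm.comp_id
  assoc := Hm.assoc
  e := none
  an := bi true
  or := bi false
  anM := Hm.bin true
  orM := Hm.bin false
  anM_id := Hm.bin_id true
  orM_id := Hm.bin_id false
  anM_comp := Hm.bin_comp true
  orM_comp := Hm.bin_comp false
  AC := Hm.AC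
  ac_id := Hm.AC.id
  ac_comp := Hm.AC.comp
  ac_an := Hm.AC.bin true
  ac_or := Hm.AC.bin false
  ac_inv := Hm.AC.inv
  ms := omS
  ms_hom := by rintro _ _ (f | _); exacts [TQ.ms ‹_›, rfl]
  ms_e := rfl
  ms_an := omS_bi true
  ms_or := omS_bi false
  ac_uniq := fun {X Y i j} hn hi hj => Hm.AC.uniq (fun A e => by subst e; exact hn) hi hj
  an_comm := fun f g => ⟨_, _, .br true _ _, .br true _ _, Hm.br_nat true f g⟩
  or_comm := fun f g => ⟨_, _, .br false _ _, .br false _ _, Hm.br_nat false f g⟩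
  an_assoc := fun f g h => ⟨_, _, .as true _ _ _, .as true _ _ _, Hm.as_nat true f g h⟩
  or_assoc := fun f g h => ⟨_, _, .as false _ _ _, .as false _ _ _, Hm.as_nat false f g h⟩
  an_unit := fun f => ⟨_, _, .id _, .id _, (Hm.comp_id _).trans (Hm.id_comp _).symm⟩
  or_unit := fun f => ⟨_, _, .id _, .id _, (Hm.comp_id _).trans (Hm.id_comp _).symm⟩

theorem Hm.d_nat {L : Type} {X Y Z X' Y' Z' : OF L} (f : Hm L X X') (g : Hm L Y Y') (h : Hm L Z Z') :
    comp (d X Y Z) (bin false (bin true f g) h) = comp (bin true f (bin false g h)) (d X' Y' Z') := by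
  cases f with
  | n => exact (Hm.id_comp _).trans (Hm.comp_id _).symm
  | s f =>
    cases g with
    | n =>
      cases h with
      | n => exact (Hm.id_comp _).trans (Hm.comp_id _).symm
      | s h => exact congrArg Hm.s (TQ.mix_nat f h)
    | s g =>
      cases h with
      | n => exact (Hm.id_comp _).trans (Hm.comp_id _).symm
      | s h => exact congrArg Hm.s (TQ.d_nat f g h)

namespace Fl
open MX0
variable {L : Type}
abbrev QL (L : Type) := (HmM L).Q
abbrev AL (L : Type) := (HmM L).A
def qq (X : OF L) : QL L := q (M := HmM L) X
noncomputable def aa {X Y : OF L} (f : Hm L X Y) : AL L := ar (M := HmM L) f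
noncomputable def D (x y z : QL L) : AL L := aa (Hm.d (Quotient.out x) (Quotient.out y) (Quotient.out z))

theorem qq_an (X Y : OF L) : qq (bi true X Y) = qq X * qq Y := rfl
theorem qq_or (X Y : OF L) : qq (bi false X Y) = qq X + qq Y := rfl
theorem qq_e : qq (none : OF L) = 1 := rfl
theorem q_ex (x : QL L) : ∃ X : OF L, x = qq X := by
  obtain ⟨X, h⟩ := exists_q x; exact ⟨X, h.symm⟩
theorem D_q (X Y Z : OF L) : D (qq X) (qq Y) (qq Z) = aa (Hm.d X Y Z) := by
  obtain ⟨i, hi⟩ := q_eq.1 (q_out (M := HmM L) (qq X))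
  obtain ⟨j, hj⟩ := q_eq.1 (q_out (M := HmM L) (qq Y))
  obtain ⟨k, hk⟩ := q_eq.1 (q_out (M := HmM L) (qq Z))
  exact mk_sim (M := HmM L) ⟨_, _, Hm.AC.bin true hi (.bin false hj hk), .bin false (.bin true hi hj) hk,
    Hm.d_nat i j k⟩
theorem aa_comp {X Y Z : OF L} (f : Hm L X Y) (g : Hm L Y Z) : aa (Hm.comp f g) = cmp (aa f) (aa g) :=
  (cmp_mk (M := HmM L) f g).symm
theorem aa_an {X Y Z W : OF L} (f : Hm L X Y) (g : Hm L Z W) : aa (Hm.bin true f g) = anA (aa f) (aa g) :=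
  (an_mk (M := HmM L) f g).symm
theorem aa_or {X Y Z W : OF L} (f : Hm L X Y) (g : Hm L Z W) : aa (Hm.bin false f g) = orA (aa f) (aa g) :=
  (or_mk (M := HmM L) f g).symm
theorem aa_id (X : OF L) : aa (Hm.id X) = iA (qq X) := (iA_q (M := HmM L) X).symm
theorem aa_ac {X Y : OF L} {f : Hm L X Y} (h : f.AC) : aa f = iA (qq X) := mk_ac (M := HmM L) h
theorem aa_pre {X Y Z : OF L} {f : Hm L X Y} (h : f.AC) (g : Hm L Y Z) : aa (Hm.comp f g) = aa g :=
  mk_pre (M := HmM L) h g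
theorem aa_post {X Y Z : OF L} {f : Hm L Y Z} (h : f.AC) (g : Hm L X Y) : aa (Hm.comp g f) = aa g :=
  mk_post (M := HmM L) h g
/-- class of a typed arrow -/
noncomputable def tt {A B : Form L} (f : TQ L A B) : AL L := aa (Hm.s f)
theorem tt_comp {A B C : Form L} (f : TQ L A B) (g : TQ L B C) : tt (TQ.comp f g) = cmp (tt f) (tt g) :=
  aa_comp (Hm.s f) (Hm.s g)
theorem tt_an {A B C D : Form L} (f : TQ L A B) (g : TQ L C D) : tt (TQ.bin true f g) = anA (tt f) (tt g) :=
  aa_an (Hm.s f) (Hm.s g)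
theorem tt_or {A B C D : Form L} (f : TQ L A B) (g : TQ L C D) : tt (TQ.bin false f g) = orA (tt f) (tt g) :=
  aa_or (Hm.s f) (Hm.s g)
theorem tt_id (A : Form L) : tt (TQ.id A) = iA (qq (some A)) := aa_id (some A)
theorem tt_pre {A B C : Form L} {f : TQ L A B} (h : TQ.AC f) (g : TQ L B C) : tt (TQ.comp f g) = tt g :=
  aa_pre (.s h) (Hm.s g)
theorem tt_post {A B C : Form L} {g : TQ L B C} (h : TQ.AC g) (f : TQ L A B) : tt (TQ.comp f g) = tt f :=
  aa_post (.s h) (Hm.s f)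
theorem tt_d (A B C : Form L) : tt (TQ.d A B C) = D (qq (some A)) (qq (some B)) (qq (some C)) :=
  (D_q (some A) (some B) (some C)).symm
theorem tt_mix (A B : Form L) : tt (TQ.mix A B) = D (qq (some A)) 1 (qq (some B)) :=
  (D_q (some A) none (some B)).symm
theorem tt_dr (C B A : Form L) : tt (TQ.dr C B A) = D (qq (some A)) (qq (some B)) (qq (some C)) := by
  unfold TQ.dr
  rw [tt_post (.br _ _ _), tt_post (.bin _ (.br _ _ _) (.id _)), tt_comp, ← tt_comp, tt_pre, tt_d]
  exact .comp (.br _ _ _) (.bin _ (.id _) (.br _ _ _))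
end Fl
end

section
namespace Fl
open MX0
variable {L : Type}

theorem q_cases (x : QL L) : x = 1 ∨ ∃ A : Form L, x = qq (some A) := by
  obtain ⟨_ | A, rfl⟩ := q_ex x
  · exact .inl rfl
  · exact .inr ⟨A, rfl⟩
theorem D_l (y z : QL L) : D 1 y z = iA (y + z) := by
  obtain ⟨Y, rfl⟩ := q_ex y; obtain ⟨Z, rfl⟩ := q_ex z
  exact (D_q none Y Z).trans (aa_id (bi false Y Z))
theorem D_r (x y : QL L) : D x y 1 = iA (x * y) := by
  obtain ⟨X, rfl⟩ := q_ex x; obtain ⟨Y, rfl⟩ := q_ex y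
  refine (D_q X Y none).trans ?_
  cases X
  · cases Y
    · exact aa_id none
    · exact aa_id (some _)
  · cases Y
    · exact aa_id (some _)
    · exact aa_id (some _)
theorem i_i (x : QL L) : cmp (iA x) (iA x) = iA x := by
  obtain ⟨X, rfl⟩ := q_ex x
  exact i_cmp_mk _ (q_out _).symm
theorem i_D (x y z : QL L) : cmp (iA (x * (y + z))) (D x y z) = D x y z := by
  obtain ⟨X, rfl⟩ := q_ex x; obtain ⟨Y, rfl⟩ := q_ex y; obtain ⟨Z, rfl⟩ := q_ex z
  rw [D_q]; exact i_cmp_mk _ rfl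
theorem D_i (x y z : QL L) : cmp (D x y z) (iA (x * y + z)) = D x y z := by
  obtain ⟨X, rfl⟩ := q_ex x; obtain ⟨Y, rfl⟩ := q_ex y; obtain ⟨Z, rfl⟩ := q_ex z
  rw [D_q]; exact cmp_i_mk _ rfl
theorem an_e (a : AL L) : anA a (iA (1 : QL L)) = a := by rw [anA_comm, e_anA]
theorem or_e (a : AL L) : orA a (iA (1 : QL L)) = a := by rw [orA_comm, e_orA]
theorem add_one' (x : QL L) : x + 1 = x := by rw [add_comm, one_add]
theorem D_sym (x y : QL L) : D x 1 y = D y 1 x := by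
  rcases q_cases x with rfl | ⟨A, rfl⟩
  · rw [D_l, D_r, one_add, mul_one]
  rcases q_cases y with rfl | ⟨B, rfl⟩
  · rw [D_l, D_r, one_add, mul_one]
  have := congrArg tt (TQ.mix_c A B)
  rw [tt_pre (.br _ _ _), tt_post (.br _ _ _), tt_mix, tt_mix] at this
  exact this.symm

theorem i_D1 (x z : QL L) : cmp (iA (x * z)) (D x 1 z) = D x 1 z := by
  have := i_D x 1 z; rwa [one_add] at this
theorem D1_i (x z : QL L) : cmp (D x 1 z) (iA (x + z)) = D x 1 z := by
  have := D_i x 1 z; rwa [mul_one] at this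

theorem S1 (x y u v : QL L) : D (x * y) u v = cmp (anA (iA x) (D y u v)) (D x (y * u) v) := by
  rcases q_cases x with rfl | ⟨A, rfl⟩
  · rw [one_mul, e_anA, D_l, D_i]
  rcases q_cases y with rfl | ⟨B, rfl⟩
  · rw [one_mul, mul_one, D_l, ← i_an, i_D]
  rcases q_cases v with rfl | ⟨V, rfl⟩
  · rw [D_r, D_r, D_r, ← i_an, ← mul_assoc, i_i]
  rcases q_cases u with rfl | ⟨U, rfl⟩
  · have := congrArg tt (TQ.mix_bconj A B V)
    rw [tt_pre (.sa _ _ _ _), tt_comp, tt_an, tt_mix, tt_mix, tt_d, tt_id] at this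
    rw [mul_one]; exact this
  · have := congrArg tt (TQ.d_conj A B U V)
    rw [tt_post (.bin _ (.as _ _ _ _) (.id _)), tt_comp, tt_pre (.as _ _ _ _), tt_an, tt_d, tt_d,
      tt_d, tt_id] at this
    exact this

theorem S2 (x p r v : QL L) : D x p (r + v) = cmp (D x (p + r) v) (orA (D x p r) (iA v)) := by
  rcases q_cases x with rfl | ⟨A, rfl⟩
  · rw [D_l, D_l, D_l, ← i_or, ← add_assoc, i_i]
  rcases q_cases r with rfl | ⟨R, rfl⟩
  · rw [D_r, one_add, add_one', ← i_or, D_i]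
  rcases q_cases v with rfl | ⟨V, rfl⟩
  · rw [D_r, or_e, add_one', i_D]
  rcases q_cases p with rfl | ⟨B, rfl⟩
  · have := congrArg tt (TQ.mix_bdisj A R V)
    rw [tt_post (.sa _ _ _ _), tt_comp, tt_or, tt_mix, tt_mix, tt_d, tt_id] at this
    rw [one_add]; exact this
  · have := congrArg tt (TQ.d_disj A B R V)
    rw [tt_pre (.bin _ (.id _) (.as _ _ _ _)), tt_post (.as _ _ _ _), tt_comp, tt_or, tt_d, tt_d,
      tt_d, tt_id] at this
    exact this

theorem E3 (u b c w : QL L) : cmp (anA (D u b c) (iA w)) (D w c (u * b)) =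
    cmp (anA (iA u) (D w c b)) (D u b (c * w)) := by
  rcases q_cases u with rfl | ⟨A, rfl⟩
  · rw [D_l, D_l, e_anA, ← i_an, one_mul, mul_comm (b + c), add_comm b c, i_D, add_comm b, mul_comm c,
      D_i]
  rcases q_cases w with rfl | ⟨W, rfl⟩
  · rw [D_l, D_l, an_e, ← i_an, mul_one, add_comm c, add_comm c, i_D, D_i]
  rcases q_cases b with rfl | ⟨B, rfl⟩
  · rw [D_r, ← i_an, mul_one, mul_comm c, i_D1, D_sym _ (qq (some W) * c), S1, anA_comm, mul_one, D_sym c]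
  rcases q_cases c with rfl | ⟨C, rfl⟩
  · rw [D_r, ← i_an, one_mul, D_sym (qq (some W)) (qq (some B)), mul_comm _ (qq (some W)), i_D1, D_sym, S1, mul_one]
  have := congrArg tt (TQ.d_bconj A B C W)
  rw [tt_comp, tt_comp, tt_pre (.as _ _ _ _), tt_an, tt_an, tt_d, tt_d, tt_dr, tt_dr, tt_id, tt_id] at this
  exact this

theorem E4 (x u n v : QL L) : cmp (D (x + u) n v) (orA (D n x u) (iA v)) =
    cmp (D (n + v) x u) (orA (D x n v) (iA u)) := by
  rcases q_cases x with rfl | ⟨X, rfl⟩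
  · rw [D_l, ← i_or, one_add, D1_i, D_sym (n + v), D_sym n, S2 u, one_add]
  rcases q_cases n with rfl | ⟨N, rfl⟩
  · rw [D_l, ← i_or, one_add, D1_i, D_sym _ v, D_sym _ v, S2, one_add]
  rcases q_cases u with rfl | ⟨U, rfl⟩
  · rw [D_r, D_r, ← i_or, add_one', or_e, mul_comm _ (qq (some X)), mul_comm _ (qq (some X)), i_D, D_i]
  rcases q_cases v with rfl | ⟨V, rfl⟩
  · rw [D_r, D_r, ← i_or, add_one', or_e, mul_comm _ (qq (some N)), mul_comm _ (qq (some N)), i_D, D_i]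
  have := congrArg tt (TQ.d_bdisj U X N V)
  rw [tt_comp, tt_post (.as _ _ _ _), tt_comp, tt_or, tt_or, tt_d, tt_d, tt_dr, tt_dr, tt_id, tt_id,
    orA_comm (iA _)] at this
  rw [add_comm (qq (some X))]
  exact this.symm
end Fl
end

section
namespace Fl
open MX0
variable {L : Type}

open Classical in
noncomputable def rs (S : Set L) : Form L → OF L
  | .letter a => if a ∈ S then some (.letter a) else none
  | .conj A B => bi true (rs S A) (rs S B)
  | .disj A B => bi false (rs S A) (rs S B)
theorem rs_bin (S : Set L) (o : Bool) (A B : Form L) : rs S (.bin o A B) = bi o (rs S A) (rs S B) := by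
  cases o <;> rfl
noncomputable def rsO (S : Set L) : OF L → OF L
  | none => none
  | some A => rs S A
theorem bi_none (o : Bool) (X : OF L) : bi o X none = X := by cases X <;> rfl
theorem rsO_bi (S : Set L) (o : Bool) (X Y : OF L) : rsO S (bi o X Y) = bi o (rsO S X) (rsO S Y) := by
  cases X
  · rfl
  · cases Y
    · exact (bi_none _ _).symm
    · exact rs_bin S o _ _
theorem rs_ac (S : Set L) {A B : Form L} {f : TQ L A B} (h : TQ.AC f) :
    ∃ f' : Hm L (rs S A) (rs S B), f'.AC := by
  induction h with
  | id => exact ⟨_, .id _⟩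
  | comp _ _ h h' =>
    obtain ⟨f, h⟩ := h; obtain ⟨f', h'⟩ := h'; exact ⟨_, h.comp h'⟩
  | bin o _ _ h h' =>
    obtain ⟨f, h⟩ := h; obtain ⟨f', h'⟩ := h'
    cases o
    · exact ⟨_, h.bin false h'⟩
    · exact ⟨_, h.bin true h'⟩
  | as o =>
    cases o
    · exact ⟨_, Hm.AC.as false _ _ _⟩
    · exact ⟨_, Hm.AC.as true _ _ _⟩
  | sa o =>
    cases o
    · exact ⟨_, Hm.AC.sa false _ _ _⟩
    · exact ⟨_, Hm.AC.sa true _ _ _⟩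
  | br o =>
    cases o
    · exact ⟨_, Hm.AC.br false _ _⟩
    · exact ⟨_, Hm.AC.br true _ _⟩
theorem rs_hom (S : Set L) {A B : Form L} (f : Term L A B) : Nonempty (Hm L (rs S A) (rs S B)) := by
  induction f with
  | id => exact ⟨Hm.id _⟩
  | comp _ _ h h' => obtain ⟨h⟩ := h; obtain ⟨h'⟩ := h'; exact ⟨Hm.comp h' h⟩
  | conj _ _ h h' => obtain ⟨h⟩ := h; obtain ⟨h'⟩ := h'; exact ⟨Hm.bin true h h'⟩
  | disj _ _ h h' => obtain ⟨h⟩ := h; obtain ⟨h'⟩ := h'; exact ⟨Hm.bin false h h'⟩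
  | bConjTo => exact ⟨Hm.sa true _ _ _⟩
  | bConjFrom => exact ⟨Hm.as true _ _ _⟩
  | bDisjTo => exact ⟨Hm.sa false _ _ _⟩
  | bDisjFrom => exact ⟨Hm.as false _ _ _⟩
  | cConj => exact ⟨Hm.br true _ _⟩
  | cDisj => exact ⟨Hm.br false _ _⟩
  | d => exact ⟨Hm.d _ _ _⟩
  | mix A B => exact ⟨Hm.comp (Hm.d (rs S A) none (rs S B)) (Hm.bin false (Hm.ru true _) (Hm.id _))⟩
theorem rsO_ac (S : Set L) {X Y : OF L} {f : Hm L X Y} (h : f.AC) :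
    ∃ f' : Hm L (rsO S X) (rsO S Y), f'.AC := by
  cases h with
  | s h => exact rs_ac S h
  | n => exact ⟨_, .n⟩
theorem rsO_hom (S : Set L) {X Y : OF L} (f : Hm L X Y) : Nonempty (Hm L (rsO S X) (rsO S Y)) := by
  cases f with
  | s h => obtain ⟨h, -⟩ := TQ.ex h; exact rs_hom S h
  | n => exact ⟨.n⟩
noncomputable def rsQ (S : Set L) : QL L → QL L :=
  Quotient.map (rsO S) (fun _ _ ⟨_, h⟩ => rsO_ac S h)
theorem rsQ_q (S : Set L) (X : OF L) : rsQ S (qq X) = qq (rsO S X) := rfl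
theorem rs_mem (S : Set L) (A : Form L) (a : L) : a ∈ omS (rs S A) ↔ a ∈ A.ms ∧ a ∈ S := by
  induction A with
  | letter b =>
    unfold rs
    by_cases h : b ∈ S
    · simp only [h, if_true, omS, Form.ms, Multiset.mem_singleton]
      constructor
      · rintro rfl; exact ⟨rfl, h⟩
      · exact fun h => h.1
    · simp only [h, if_false, omS, Form.ms, Multiset.mem_singleton]
      constructor
      · intro h; simp at h
      · rintro ⟨rfl, h'⟩; exact absurd h' h
  | conj A B h h' => rw [rs, omS_bi, Multiset.mem_add, h, h', Form.ms, Multiset.mem_add]; tauto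
  | disj A B h h' => rw [rs, omS_bi, Multiset.mem_add, h, h', Form.ms, Multiset.mem_add]; tauto
theorem rs_all (S : Set L) (A : Form L) (H : ∀ a ∈ A.ms, a ∈ S) : rs S A = some A := by
  induction A with
  | letter b => unfold rs; rw [if_pos (H b (Multiset.mem_singleton_self b))]
  | conj A B h h' =>
    rw [rs, h (fun a m => H a (Multiset.mem_add.2 (.inl m))), h' (fun a m => H a (Multiset.mem_add.2 (.inr m)))]; rfl
  | disj A B h h' =>
    rw [rs, h (fun a m => H a (Multiset.mem_add.2 (.inl m))), h' (fun a m => H a (Multiset.mem_add.2 (.inr m)))]; rfl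

def kd : Form L → Option Bool
  | .letter _ => none
  | .conj _ _ => some true
  | .disj _ _ => some false
theorem kd_bin (o : Bool) (A B : Form L) : kd (.bin o A B) = some o := by cases o <;> rfl
theorem kd_ac {A B : Form L} {f : TQ L A B} (h : TQ.AC f) : kd A = kd B := by
  induction h with
  | id => rfl
  | comp _ _ h h' => exact h.trans h'
  | bin o => simp only [kd_bin]
  | as o => simp only [kd_bin]
  | sa o => simp only [kd_bin]
  | br o => simp only [kd_bin]
theorem card_size (A : Form L) : A.ms.card = A.size := by
  induction A with
  | letter => rfl
  | conj A B h h' => simp [Form.ms, Form.size, h, h']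
  | disj A B h h' => simp [Form.ms, Form.size, h, h']
theorem ms_q (X : OF L) : msQ (qq X) = omS X := rfl
theorem ms_zero (x : QL L) (h : msQ x = 0) : x = 1 := by
  rcases q_cases x with rfl | ⟨A, rfl⟩
  · rfl
  · exact absurd h (Form.ms_ne A)
theorem qs_ne (A : Form L) : qq (some A) ≠ 1 := fun h =>
  Form.ms_ne A (show msQ (qq (some A)) = 0 by rw [h]; rfl)
theorem prime (p r u v : QL L) (h : p + r = u * v) : p = 1 ∨ r = 1 ∨ u = 1 ∨ v = 1 := by
  rcases q_cases p with rfl | ⟨P, rfl⟩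
  · exact .inl rfl
  rcases q_cases r with rfl | ⟨R, rfl⟩
  · exact .inr (.inl rfl)
  rcases q_cases u with rfl | ⟨U, rfl⟩
  · exact .inr (.inr (.inl rfl))
  rcases q_cases v with rfl | ⟨V, rfl⟩
  · exact .inr (.inr (.inr rfl))
  obtain ⟨f, hf⟩ := q_eq.1 (show q (M := HmM L) (some (.bin false P R)) = q (M := HmM L) (some (.bin true U V)) from h)
  change Hm.AC f at hf
  cases hf with
  | s h => have := kd_ac h; simp [kd_bin] at this
theorem cases' (x : QL L) : (msQ x).card ≤ 1 ∨ (∃ p r : QL L, p ≠ 1 ∧ r ≠ 1 ∧ x = p * r) ∨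
    (∃ p r : QL L, p ≠ 1 ∧ r ≠ 1 ∧ x = p + r) := by
  rcases q_cases x with rfl | ⟨A, rfl⟩
  · left; exact Nat.zero_le _
  · match A with
    | .letter a => left; exact le_refl 1
    | .conj A B => exact .inr (.inl ⟨_, _, qs_ne A, qs_ne B, rfl⟩)
    | .disj A B => exact .inr (.inr ⟨_, _, qs_ne A, qs_ne B, rfl⟩)
theorem one {f : AL L} {x y : QL L} (h : HA f x y) (c : (msQ x).card ≤ 1) : f = iA x ∧ x = y := by
  obtain ⟨X, Y, f, n, rfl, rfl, rfl⟩ := h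
  change Hm L X Y at f
  cases f with
  | n => exact ⟨aa_ac .n, rfl⟩
  | @s A B f =>
    have hs : A.size = 1 := by
      have h1 : A.ms.card ≤ 1 := c
      rw [card_size] at h1
      have := A.size_pos
      omega
    have e : A = B := by
      obtain ⟨t, -⟩ := TQ.ex f
      exact (t.one hs).1
    subst e
    rw [TQ.one f hs]
    exact ⟨aa_ac (.s (.id A)), rfl⟩
theorem D_nat_aux {X Y Z X' Y' Z' : OF L} (f : Hm L X X') (g : Hm L Y Y') (h : Hm L Z Z') :
    cmp (anA (aa f) (orA (aa g) (aa h))) (D (qq X') (qq Y') (qq Z')) =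
      cmp (D (qq X) (qq Y) (qq Z)) (orA (anA (aa f) (aa g)) (aa h)) := by
  have := congrArg aa (Hm.d_nat f g h)
  rw [aa_comp, aa_comp, aa_or, aa_an, aa_an, aa_or, ← D_q, ← D_q] at this
  exact this.symm
theorem D_nat {f g h : AL L} {x y z x' y' z' : QL L} (hf : HA f x x') (hg : HA g y y') (hh : HA h z z') :
    cmp (anA f (orA g h)) (D x' y' z') = cmp (D x y z) (orA (anA f g) h) := by
  obtain ⟨X, X', f, -, rfl, rfl, rfl⟩ := hf
  obtain ⟨Y, Y', g, -, rfl, rfl, rfl⟩ := hg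
  obtain ⟨Z, Z', h, -, rfl, rfl, rfl⟩ := hh
  exact D_nat_aux f g h
theorem H_D (x y z : QL L) (h : (msQ (x * (y + z))).Nodup) : HA (D x y z) (x * (y + z)) (x * y + z) := by
  obtain ⟨X, rfl⟩ := q_ex x; obtain ⟨Y, rfl⟩ := q_ex y; obtain ⟨Z, rfl⟩ := q_ex z
  exact ⟨_, _, Hm.d X Y Z, h, D_q X Y Z, rfl, rfl⟩
theorem D_bot (x y z : QL L) (h : ¬ (msQ (x * (y + z))).Nodup) : D x y z = (HmM L).bt := by
  obtain ⟨X, rfl⟩ := q_ex x; obtain ⟨Y, rfl⟩ := q_ex y; obtain ⟨Z, rfl⟩ := q_ex z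
  rw [D_q]; exact mk_bot h
theorem res_H (S : Set L) {f : AL L} {x y : QL L} (h : HA f x y) : ∃ f', HA f' (rsQ S x) (rsQ S y) := by
  obtain ⟨X, Y, f, n, rfl, rfl, rfl⟩ := h
  obtain ⟨f'⟩ := rsO_hom S f
  have hn : (omS (rsO S X)).Nodup := by
    change (omS X).Nodup at n
    cases X with
    | none => exact Multiset.nodup_zero
    | some A =>
      change A.ms.Nodup at n
      change (omS (rs S A)).Nodup
      clear f f'
      have key : omS (rs S A) ≤ A.ms := by
        clear n
        induction A with
        | letter b =>
          unfold rs
          split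
          · exact le_refl _
          · exact Multiset.zero_le _
        | conj A B h h' => rw [rs, omS_bi]; exact add_le_add h h'
        | disj A B h h' => rw [rs, omS_bi]; exact add_le_add h h'
      exact Multiset.nodup_of_le key n
  exact ⟨_, _, _, f', hn, rfl, rfl, rfl⟩
theorem tt_ac {A B : Form L} {f : TQ L A B} (h : TQ.AC f) : tt f = iA (qq (some A)) := aa_ac (.s h)
theorem ind (p : AL L → Prop) (hi : ∀ x : QL L, (msQ x).Nodup → p (iA x)) (hd : ∀ x y z, p (D x y z))
    (ha : ∀ f g, p f → p g → p (anA f g)) (ho : ∀ f g, p f → p g → p (orA f g))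
    (hc : ∀ f g, p f → p g → p (cmp f g)) {A B : Form L} (f : Term L A B) (n : A.ms.Nodup) :
    p (tt (TQ.mk f)) := by
  induction f with
  | id A => exact (tt_ac (TQ.AC.id A)).symm ▸ hi _ n
  | comp g f h h' =>
    have := tt_comp (TQ.mk f) (TQ.mk g)
    exact this ▸ hc _ _ (h' n) (h (f.msEq ▸ n))
  | conj f g h h' =>
    have := tt_an (TQ.mk f) (TQ.mk g)
    have n' := Multiset.nodup_add.1 n
    exact this ▸ ha _ _ (h n'.1) (h' n'.2.1)
  | disj f g h h' =>
    have := tt_or (TQ.mk f) (TQ.mk g)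
    have n' := Multiset.nodup_add.1 n
    exact this ▸ ho _ _ (h n'.1) (h' n'.2.1)
  | bConjTo A B C => exact (tt_ac (TQ.AC.sa true A B C)).symm ▸ hi _ n
  | bConjFrom A B C => exact (tt_ac (TQ.AC.as true A B C)).symm ▸ hi _ n
  | bDisjTo A B C => exact (tt_ac (TQ.AC.sa false A B C)).symm ▸ hi _ n
  | bDisjFrom A B C => exact (tt_ac (TQ.AC.as false A B C)).symm ▸ hi _ n
  | cConj A B => exact (tt_ac (TQ.AC.br true A B)).symm ▸ hi _ n
  | cDisj A B => exact (tt_ac (TQ.AC.br false B A)).symm ▸ hi _ n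
  | d A B C => exact (tt_d A B C).symm ▸ hd _ _ _
  | mix A B => exact (tt_mix A B).symm ▸ hd _ _ _

variable (L) in
noncomputable def FL : FS L where
  Q := QL L
  e := 1
  an x y := x * y
  or x y := x + y
  an_comm := mul_comm
  or_comm := add_comm
  an_assoc := mul_assoc
  or_assoc := add_assoc
  e_an := one_mul
  e_or := one_add
  ms := msQ
  ms_e := rfl
  ms_an x y := by
    obtain ⟨X, rfl⟩ := q_ex x; obtain ⟨Y, rfl⟩ := q_ex y; exact omS_bi true X Y
  ms_or x y := by
    obtain ⟨X, rfl⟩ := q_ex x; obtain ⟨Y, rfl⟩ := q_ex y; exact omS_bi false X Y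
  ms_zero := ms_zero
  res := rsQ
  res_e _ := rfl
  res_an S x y := by
    obtain ⟨X, rfl⟩ := q_ex x; obtain ⟨Y, rfl⟩ := q_ex y; exact congrArg qq (rsO_bi S true X Y)
  res_or S x y := by
    obtain ⟨X, rfl⟩ := q_ex x; obtain ⟨Y, rfl⟩ := q_ex y; exact congrArg qq (rsO_bi S false X Y)
  res_mem S x a := by
    rcases q_cases x with rfl | ⟨A, rfl⟩
    · exact ⟨fun h => absurd h (Multiset.notMem_zero a), fun h => absurd h.1 (Multiset.notMem_zero a)⟩
    · exact rs_mem S A a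
  res_all S x h := by
    rcases q_cases x with rfl | ⟨A, rfl⟩
    · rfl
    · exact congrArg qq (rs_all S A h)
  prime p r u v _ h := prime p r u v h
  cases := cases'
  A := AL L
  bot := (HmM L).bt
  anA := anA
  orA := orA
  anA_comm := anA_comm
  orA_comm := orA_comm
  anA_assoc := anA_assoc
  orA_assoc := orA_assoc
  bot_an := bt_an
  bot_or := bt_or
  i := iA
  e_anA := e_anA
  e_orA := e_orA
  i_an := i_an
  i_or := i_or
  i_bot := i_bot
  cmp := cmp
  cmp_assoc := cmp_assoc
  bot_cmp := bt_cmp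
  cmp_bot := cmp_bt
  H := HA
  H_bot := H_bot
  H_ex := H_ex
  H_uniq := H_uniq
  H_ms := H_ms
  H_N := H_N
  H_i := H_i
  H_cmp := H_cmp
  H_cmp' := H_cmp'
  H_an := H_an
  H_an' := H_an'
  H_or := H_or
  H_or' := H_or'
  i_cmp := i_cmp
  cmp_i := cmp_i
  anA_cmp := anA_cmp
  orA_cmp := orA_cmp
  d := D
  d_bot := D_bot
  H_d := H_D
  d_nat := D_nat
  S1 := S1
  S2 := S2
  E3 := E3
  E4 := E4
  d_l := D_l
  d_r := D_r
  res_H := res_H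
  one := one
  ind p hi hd ha ho hc f x y h := by
    obtain ⟨X, Y, f, n, rfl, rfl, rfl⟩ := h
    change Hm L X Y at f
    cases f with
    | n =>
      have : aa (Hm.n : Hm L none none) = iA 1 := aa_ac .n
      change p (aa (Hm.n : Hm L none none))
      rw [this]; exact hi _ Multiset.nodup_zero
    | s f =>
      obtain ⟨f, rfl⟩ := TQ.ex f
      exact ind p hi hd ha ho hc f n
end Fl

theorem Term.linear {L : Type} {A B : Form L} (f g : Term L A B) (n : A.ms.Nodup) : Eqv f g := by
  have h : ∀ f : Term L A B, (Fl.FL L).H (Fl.tt (TQ.mk f)) (Fl.qq (some A)) (Fl.qq (some B)) :=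
    fun f => ⟨_, _, Hm.s (TQ.mk f), n, rfl, rfl, rfl⟩
  have e := (Fl.FL L).uniq (h f) (h g)
  obtain ⟨i, j, hi, hj, e⟩ := MX0.mk_exact (M := HmM L) (f := Hm.s (TQ.mk f)) (g := Hm.s (TQ.mk g)) n e
  have hi' : i = Hm.id _ := (HmM L).ac_uniq n hi (Hm.AC.id _)
  have hj' : j = Hm.id _ := (HmM L).ac_uniq (show B.ms.Nodup from f.msEq ▸ n) hj (Hm.AC.id _)
  subst hi'; subst hj'
  have e' : Hm.s (TQ.mk f) = Hm.s (TQ.mk g) := (Hm.comp_id _).symm.trans (Eq.trans e (Hm.id_comp (Hm.s (TQ.mk g))))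
  exact TQ.exact (Hm.s.inj e')
end

section
section Lifting
variable {L P : Type}

def Form.map (v : L → P) : Form L → Form P
  | .letter a => .letter (v a)
  | .conj A B => .conj (A.map v) (B.map v)
  | .disj A B => .disj (A.map v) (B.map v)

def Term.map (v : L → P) : ∀ {A B : Form L}, Term L A B → Term P (A.map v) (B.map v)
  | _, _, .id A => .id (A.map v)
  | _, _, .comp g f => .comp (Term.map v g) (Term.map v f)
  | _, _, .conj f g => .conj (Term.map v f) (Term.map v g)
  | _, _, .disj f g => .disj (Term.map v f) (Term.map v g)
  | _, _, .bConjTo A B C => .bConjTo (A.map v) (B.map v) (C.map v)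
  | _, _, .bConjFrom A B C => .bConjFrom (A.map v) (B.map v) (C.map v)
  | _, _, .bDisjTo A B C => .bDisjTo (A.map v) (B.map v) (C.map v)
  | _, _, .bDisjFrom A B C => .bDisjFrom (A.map v) (B.map v) (C.map v)
  | _, _, .cConj A B => .cConj (A.map v) (B.map v)
  | _, _, .cDisj A B => .cDisj (A.map v) (B.map v)
  | _, _, .d A B C => .d (A.map v) (B.map v) (C.map v)
  | _, _, .mix A B => .mix (A.map v) (B.map v)

theorem Form.size_map (v : L → P) (A : Form L) : (A.map v).size = A.size := by
  induction A with
  | letter => rfl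
  | conj A B h h' => simp only [Form.map, Form.size, h, h']
  | disj A B h h' => simp only [Form.map, Form.size, h, h']

theorem Term.G_map (v : L → P) {A B : Form L} (f : Term L A B) : (f.map v).G = f.G := by
  induction f <;> simp only [Term.map, Term.G, Form.size_map, *]

theorem Eqv.map (v : L → P) {A B : Form L} {f g : Term L A B} (h : Eqv f g) :
    Eqv (f.map v) (g.map v) := by
  induction h with
  | refl f => exact .refl _
  | symm _ h => exact .symm h
  | trans _ _ h h' => exact .trans h h'
  | congComp _ _ h h' => exact .congComp h h'
  | congConj _ _ h h' => exact .congConj h h'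
  | congDisj _ _ h h' => exact .congDisj h h'
  | catIdR f => exact .catIdR _
  | catIdL f => exact .catIdL _
  | catAssoc f g h => exact .catAssoc _ _ _
  | conjOne => exact .conjOne _ _
  | disjOne => exact .disjOne _ _
  | conjTwo => exact .conjTwo _ _ _ _
  | disjTwo => exact .disjTwo _ _ _ _
  | bConjNat => exact .bConjNat _ _ _
  | bDisjNat => exact .bDisjNat _ _ _
  | cConjNat => exact .cConjNat _ _
  | cDisjNat => exact .cDisjNat _ _
  | dNat => exact .dNat _ _ _
  | bConjIso₁ => exact .bConjIso₁ _ _ _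
  | bConjIso₂ => exact .bConjIso₂ _ _ _
  | bDisjIso₁ => exact .bDisjIso₁ _ _ _
  | bDisjIso₂ => exact .bDisjIso₂ _ _ _
  | bConjPent => exact .bConjPent _ _ _ _
  | bDisjPent => exact .bDisjPent _ _ _ _
  | cConjIso => exact .cConjIso _ _
  | cDisjIso => exact .cDisjIso _ _
  | bcConj => exact .bcConj _ _ _
  | bcDisj => exact .bcDisj _ _ _
  | dConj => exact .dConj _ _ _ _
  | dDisj => exact .dDisj _ _ _ _
  | dBConj => exact .dBConj _ _ _ _
  | dBDisj => exact .dBDisj _ _ _ _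
  | mixNat => exact .mixNat _ _
  | mixBConj => exact .mixBConj _ _ _
  | mixBDisj => exact .mixBDisj _ _ _
  | mixC => exact .mixC _ _

theorem Form.map_conj {v : L → P} {A' : Form L} {A B : Form P} (h : A'.map v = A ⋏ B) :
    ∃ X Y, A' = X ⋏ Y ∧ X.map v = A ∧ Y.map v = B := by
  cases A' with
  | letter => cases h
  | conj X Y => cases h; exact ⟨X, Y, rfl, rfl, rfl⟩
  | disj => cases h
theorem Form.map_disj {v : L → P} {A' : Form L} {A B : Form P} (h : A'.map v = A ⋎ B) :
    ∃ X Y, A' = X ⋎ Y ∧ X.map v = A ∧ Y.map v = B := by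
  cases A' with
  | letter => cases h
  | conj => cases h
  | disj X Y => cases h; exact ⟨X, Y, rfl, rfl, rfl⟩

theorem Term.lift (v : L → P) {A B : Form P} (f : Term P A B) : ∀ (A' : Form L), A'.map v = A →
    ∃ (B' : Form L) (f' : Term L A' B'), B'.map v = B ∧ HEq (f'.map v) f := by
  induction f with
  | id A => rintro A' rfl; exact ⟨A', .id A', rfl, HEq.rfl⟩
  | comp g f hg hf =>
    rintro A' rfl
    obtain ⟨B', f', rfl, h⟩ := hf A' rfl
    obtain ⟨C', g', rfl, h'⟩ := hg B' rfl
    obtain rfl := eq_of_heq h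
    obtain rfl := eq_of_heq h'
    exact ⟨C', .comp g' f', rfl, HEq.rfl⟩
  | conj f g hf hg =>
    intro A' h
    obtain ⟨X, Y, rfl, rfl, rfl⟩ := Form.map_conj h
    obtain ⟨B', f', rfl, h⟩ := hf X rfl
    obtain ⟨C', g', rfl, h'⟩ := hg Y rfl
    obtain rfl := eq_of_heq h
    obtain rfl := eq_of_heq h'
    exact ⟨_, .conj f' g', rfl, HEq.rfl⟩
  | disj f g hf hg =>
    intro A' h
    obtain ⟨X, Y, rfl, rfl, rfl⟩ := Form.map_disj h
    obtain ⟨B', f', rfl, h⟩ := hf X rfl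
    obtain ⟨C', g', rfl, h'⟩ := hg Y rfl
    obtain rfl := eq_of_heq h
    obtain rfl := eq_of_heq h'
    exact ⟨_, .disj f' g', rfl, HEq.rfl⟩
  | bConjTo =>
    intro A' h
    obtain ⟨X, Y, rfl, rfl, h2⟩ := Form.map_conj h
    obtain ⟨Y, Z, rfl, rfl, rfl⟩ := Form.map_conj h2
    exact ⟨_, .bConjTo X Y Z, rfl, HEq.rfl⟩
  | bConjFrom =>
    intro A' h
    obtain ⟨X, Z, rfl, h2, rfl⟩ := Form.map_conj h
    obtain ⟨X, Y, rfl, rfl, rfl⟩ := Form.map_conj h2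
    exact ⟨_, .bConjFrom X Y Z, rfl, HEq.rfl⟩
  | bDisjTo =>
    intro A' h
    obtain ⟨X, Y, rfl, rfl, h2⟩ := Form.map_disj h
    obtain ⟨Y, Z, rfl, rfl, rfl⟩ := Form.map_disj h2
    exact ⟨_, .bDisjTo X Y Z, rfl, HEq.rfl⟩
  | bDisjFrom =>
    intro A' h
    obtain ⟨X, Z, rfl, h2, rfl⟩ := Form.map_disj h
    obtain ⟨X, Y, rfl, rfl, rfl⟩ := Form.map_disj h2
    exact ⟨_, .bDisjFrom X Y Z, rfl, HEq.rfl⟩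
  | cConj =>
    intro A' h
    obtain ⟨X, Y, rfl, rfl, rfl⟩ := Form.map_conj h
    exact ⟨_, .cConj X Y, rfl, HEq.rfl⟩
  | cDisj =>
    intro A' h
    obtain ⟨X, Y, rfl, rfl, rfl⟩ := Form.map_disj h
    exact ⟨_, .cDisj Y X, rfl, HEq.rfl⟩
  | d =>
    intro A' h
    obtain ⟨X, Y, rfl, rfl, h2⟩ := Form.map_conj h
    obtain ⟨Y, Z, rfl, rfl, rfl⟩ := Form.map_disj h2
    exact ⟨_, .d X Y Z, rfl, HEq.rfl⟩
  | mix =>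
    intro A' h
    obtain ⟨X, Y, rfl, rfl, rfl⟩ := Form.map_conj h
    exact ⟨_, .mix X Y, rfl, HEq.rfl⟩

def Form.lst : Form L → List L
  | .letter a => [a]
  | .conj A B => A.lst ++ B.lst
  | .disj A B => A.lst ++ B.lst
theorem Form.length_lst (A : Form L) : A.lst.length = A.size := by
  induction A with
  | letter => rfl
  | conj A B h h' => simp only [Form.lst, Form.size, List.length_append, h, h']
  | disj A B h h' => simp only [Form.lst, Form.size, List.length_append, h, h']

def lab (l l' : List L) : ℕ ⊕ ℕ → Option L
  | .inl i => l[i]?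
  | .inr i => l'[i]?

/-- `R` connects only equally labelled positions, and every target position with some source one -/
def Trk (l l' : List L) (R : GRel) : Prop :=
  (∀ u w, R u w → ∃ x, lab l l' u = some x ∧ lab l l' w = some x) ∧
  (∀ j, j < l'.length → ∃ i, i < l.length ∧ R (.inl i) (.inr j))

theorem Trk.gid (l : List L) {n : ℕ} (h : l.length = n) : Trk l l (gId n) := by
  subst h
  refine ⟨?_, fun j hj => ⟨j, hj, j, hj, .inl rfl, .inr rfl⟩⟩
  rintro u w ⟨i, hi, hu, hw⟩
  refine ⟨l[i], ?_, ?_⟩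
  · rcases hu with rfl | rfl <;> simp [lab, hi]
  · rcases hw with rfl | rfl <;> simp [lab, hi]

theorem Trk.gswap (l l' : List L) {a b : ℕ} (ha : l.length = a) (hb : l'.length = b) :
    Trk (l ++ l') (l' ++ l) (gSwap a b) := by
  subst ha; subst hb
  constructor
  · rintro u w ⟨i, hi, hu, hw⟩
    have hi' : i < (l ++ l').length := by simpa using hi
    have key : (l' ++ l)[if i < l.length then i + l'.length else i - l.length]? = (l ++ l')[i]? := by
      split
      · next h =>
        rw [List.getElem?_append_right (by omega), List.getElem?_append_left h]
        congr 1; omega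
      · next h =>
        rw [List.getElem?_append_left (by omega), List.getElem?_append_right (by omega)]
    refine ⟨(l ++ l')[i], ?_, ?_⟩
    · rcases hu with rfl | rfl
      · exact List.getElem?_eq_getElem hi'
      · exact key.trans (List.getElem?_eq_getElem hi')
    · rcases hw with rfl | rfl
      · exact List.getElem?_eq_getElem hi'
      · exact key.trans (List.getElem?_eq_getElem hi')
  · intro j hj
    rw [List.length_append] at hj
    by_cases h : j < l'.length
    · refine ⟨j + l.length, by rw [List.length_append]; omega, j + l.length, by omega, .inl rfl, .inr ?_⟩
      congr 1
      beta_reduce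
      rw [if_neg (by omega)]; omega
    · refine ⟨j - l'.length, by rw [List.length_append]; omega, j - l'.length, by omega, .inl rfl, .inr ?_⟩
      congr 1
      beta_reduce
      rw [if_pos (by omega)]; omega

theorem Trk.gcomp {l l' l'' : List L} {R S : GRel} (hR : Trk l l' R) (hS : Trk l' l'' S) :
    Trk l l'' (gComp S R) := by
  constructor
  · let lab3 : ℕ ⊕ ℕ ⊕ ℕ → Option L := fun x => match x with
      | .inl i => l[i]?
      | .inr (.inl i) => l'[i]?
      | .inr (.inr i) => l''[i]?
    have step : ∀ x y : ℕ ⊕ ℕ ⊕ ℕ, ((∃ x' y', Sum.map id Sum.inl x' = x ∧ Sum.map id Sum.inl y' = y ∧ R x' y') ∨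
      (∃ x' y', Sum.inr x' = x ∧ Sum.inr y' = y ∧ S x' y')) → ∃ a, lab3 x = some a ∧ lab3 y = some a := by
      rintro x y (⟨x', y', rfl, rfl, h⟩ | ⟨x', y', rfl, rfl, h⟩)
      · obtain ⟨a, h1, h2⟩ := hR.1 _ _ h
        refine ⟨a, ?_, ?_⟩
        · rw [← h1]; rcases x' with i | i <;> rfl
        · rw [← h2]; rcases y' with i | i <;> rfl
      · obtain ⟨a, h1, h2⟩ := hS.1 _ _ h
        refine ⟨a, ?_, ?_⟩
        · rw [← h1]; rcases x' with i | i <;> rfl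
        · rw [← h2]; rcases y' with i | i <;> rfl
    have e : ∀ u, lab l l'' u = lab3 (Sum.map id Sum.inr u) := by
      rintro (i | i) <;> rfl
    intro u w h
    rw [e, e]
    unfold gComp at h
    generalize Sum.map id Sum.inr w = y at h ⊢
    generalize Sum.map id Sum.inr u = x at h ⊢
    induction h with
    | single h => exact step _ _ h
    | tail _ h ih =>
      obtain ⟨a, h1, h2⟩ := ih
      obtain ⟨b, h3, h4⟩ := step _ _ h
      rw [h2] at h3
      exact ⟨a, h1, by rw [h4, h3]⟩
  · intro j hj
    obtain ⟨k, hk, h⟩ := hS.2 j hj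
    obtain ⟨i, hi, h'⟩ := hR.2 k hk
    exact ⟨i, hi, .tail (.single (.inl ⟨_, _, rfl, rfl, h'⟩)) (.inr ⟨_, _, rfl, rfl, h⟩)⟩

theorem lab_left {l l' m m' : List L} {u : ℕ ⊕ ℕ} {x : L} (h : lab l l' u = some x) :
    lab (l ++ m) (l' ++ m') u = some x := by
  rcases u with i | i
  · exact (List.getElem?_append_left (List.getElem?_eq_some_iff.1 h).1).trans h
  · exact (List.getElem?_append_left (List.getElem?_eq_some_iff.1 h).1).trans h
theorem lab_right (l l' m m' : List L) (u : ℕ ⊕ ℕ) :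
    lab (l ++ m) (l' ++ m') (Sum.map (· + l.length) (· + l'.length) u) = lab m m' u := by
  rcases u with i | i
  · simp only [Sum.map_inl, lab]; rw [List.getElem?_append_right (by omega)]; congr 1; omega
  · simp only [Sum.map_inr, lab]; rw [List.getElem?_append_right (by omega)]; congr 1; omega

theorem Trk.gpar {l l' m m' : List L} {R S : GRel} {a d : ℕ} (ha : l.length = a) (hd : l'.length = d)
    (hR : Trk l l' R) (hS : Trk m m' S) : Trk (l ++ m) (l' ++ m') (gPar a d R S) := by
  subst ha; subst hd
  constructor
  · rintro u w (h | ⟨u, w, h, rfl, rfl⟩)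
    · obtain ⟨x, h1, h2⟩ := hR.1 u w h
      exact ⟨x, lab_left h1, lab_left h2⟩
    · rw [lab_right, lab_right]; exact hS.1 u w h
  · intro j hj
    rw [List.length_append] at hj
    by_cases h : j < l'.length
    · obtain ⟨i, hi, h⟩ := hR.2 j h
      exact ⟨i, by rw [List.length_append]; omega, .inl h⟩
    · obtain ⟨i, hi, h⟩ := hS.2 (j - l'.length) (by omega)
      refine ⟨i + l.length, by rw [List.length_append]; omega, .inr ⟨_, _, h, rfl, ?_⟩⟩
      simp only [Sum.map_inr]; congr 1; omega

theorem Term.trk {A B : Form L} (f : Term L A B) : Trk A.lst B.lst f.G := by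
  have ll := @Form.length_lst L
  induction f with
  | id A => exact .gid _ (ll A)
  | comp _ _ h h' => exact .gcomp h' h
  | conj _ _ h h' => exact .gpar (ll _) (ll _) h h'
  | disj _ _ h h' => exact .gpar (ll _) (ll _) h h'
  | bConjTo A B C =>
    simp only [Form.lst, List.append_assoc]; exact .gid _ (by simp [ll])
  | bConjFrom A B C =>
    simp only [Form.lst, List.append_assoc]; exact .gid _ (by simp [ll, add_assoc])
  | bDisjTo A B C =>
    simp only [Form.lst, List.append_assoc]; exact .gid _ (by simp [ll])
  | bDisjFrom A B C =>
    simp only [Form.lst, List.append_assoc]; exact .gid _ (by simp [ll, add_assoc])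
  | cConj A B => exact .gswap _ _ (ll _) (ll _)
  | cDisj A B => exact .gswap _ _ (ll _) (ll _)
  | d A B C =>
    simp only [Form.lst, List.append_assoc]; exact .gid _ (by simp [ll])
  | mix A B => exact .gid _ (by simp [ll, Form.lst])

theorem Trk.uniq {l l' l'' : List L} {R : GRel} (h : Trk l l' R) (h' : Trk l l'' R)
    (e : l'.length = l''.length) : l' = l'' := by
  apply List.ext_getElem? 
  intro j
  by_cases hj : j < l'.length
  · obtain ⟨i, -, hr⟩ := h.2 j hj
    obtain ⟨x, h1, h2⟩ := h.1 _ _ hr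
    obtain ⟨y, h3, h4⟩ := h'.1 _ _ hr
    simp only [lab] at h1 h2 h3 h4
    rw [h2, h4, ← h1, h3]
  · rw [List.getElem?_eq_none (by omega), List.getElem?_eq_none (by omega)]

theorem Form.map_inj (v : L → P) (A : Form L) : ∀ B : Form L, A.map v = B.map v → A.lst = B.lst → A = B := by
  have key : ∀ A B : Form L, A.map v = B.map v → A.lst.length = B.lst.length := by
    intro A B h
    rw [length_lst, length_lst, ← size_map v, h, size_map]
  induction A with
  | letter a =>
    rintro (b | _ | _) h h'
    · cases h'; rfl
    · cases h
    · cases h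
  | conj A A' ih ih' =>
    rintro (b | ⟨B, B'⟩ | _) h h'
    · cases h
    · injection h with h1 h2
      obtain ⟨h3, h4⟩ := List.append_inj h' (key _ _ h1)
      rw [ih B h1 h3, ih' B' h2 h4]
    · cases h
  | disj A A' ih ih' =>
    rintro (b | _ | ⟨B, B'⟩) h h'
    · cases h
    · cases h
    · injection h with h1 h2
      obtain ⟨h3, h4⟩ := List.append_inj h' (key _ _ h1)
      rw [ih B h1 h3, ih' B' h2 h4]

/-- number the occurrences of letters -/
def Form.num : ℕ → Form P → Form (ℕ × P)
  | k, .letter a => .letter (k, a)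
  | k, .conj A B => .conj (A.num k) (B.num (k + A.size))
  | k, .disj A B => .disj (A.num k) (B.num (k + A.size))
theorem Form.map_num (A : Form P) : ∀ k, (A.num k).map Prod.snd = A := by
  induction A with
  | letter => intro k; rfl
  | conj A B h h' => intro k; simp only [Form.num, Form.map, h, h']
  | disj A B h h' => intro k; simp only [Form.num, Form.map, h, h']
theorem Form.num_mem (A : Form P) : ∀ k, ∀ x ∈ (A.num k).ms, k ≤ x.1 ∧ x.1 < k + A.size := by
  induction A with
  | letter a =>
    intro k x hx
    simp only [Form.num, Form.ms, Multiset.mem_singleton] at hx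
    subst hx; exact ⟨le_refl _, Nat.lt_succ_self _⟩
  | conj A B h h' =>
    intro k x hx
    simp only [Form.num, Form.ms, Multiset.mem_add, Form.size] at hx ⊢
    rcases hx with hx | hx
    · have := h _ _ hx; omega
    · have := h' _ _ hx; omega
  | disj A B h h' =>
    intro k x hx
    simp only [Form.num, Form.ms, Multiset.mem_add, Form.size] at hx ⊢
    rcases hx with hx | hx
    · have := h _ _ hx; omega
    · have := h' _ _ hx; omega
theorem Form.num_nodup (A : Form P) : ∀ k, (A.num k).ms.Nodup := by
  induction A with
  | letter a => intro k; exact Multiset.nodup_singleton _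
  | conj A B h h' =>
    intro k
    refine Multiset.nodup_add.2 ⟨h k, h' _, Multiset.disjoint_left.2 fun hx hx' => ?_⟩
    have := Form.num_mem A _ _ hx; have := Form.num_mem B _ _ hx'; omega
  | disj A B h h' =>
    intro k
    refine Multiset.nodup_add.2 ⟨h k, h' _, Multiset.disjoint_left.2 fun hx hx' => ?_⟩
    have := Form.num_mem A _ _ hx; have := Form.num_mem B _ _ hx'; omega

theorem Term.lift_eqv (v : L → P) (A' B' C' : Form L) (n : A'.ms.Nodup) (f : Term L A' B') (g : Term L A' C')
    {B : Form P} (hB : B'.map v = B) (hC : C'.map v = B) (f₀ g₀ : Term P (A'.map v) B)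
    (hf : HEq (f.map v) f₀) (hg : HEq (g.map v) g₀) (e : f₀.G = g₀.G) : Eqv f₀ g₀ := by
  subst hB
  obtain rfl := eq_of_heq hf
  have hG : f.G = g.G := by
    rw [← Term.G_map v f, e]
    have : ∀ {D : Form P} (hD : C'.map v = D) (g₁ : Term P (A'.map v) D), HEq (g.map v) g₁ → g₁.G = g.G := by
      rintro D rfl g₁ h
      obtain rfl := eq_of_heq h
      exact Term.G_map v g
    exact this hC g₀ hg
  have hl : B'.lst = C'.lst := by
    refine Trk.uniq f.trk (hG ▸ g.trk) ?_
    rw [Form.length_lst, Form.length_lst, ← Form.size_map v, ← hC, Form.size_map]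
  obtain rfl := Form.map_inj v B' C' hC.symm hl
  obtain rfl := eq_of_heq hg
  exact (Term.linear f g n).map v
end Lifting

theorem MDS_coherence' {P : Type} {A B : Form P} (f g : Term P A B) :
    Term.G f = Term.G g → Eqv f g := by
  intro h
  have key : ∀ A' : Form (ℕ × P), A'.ms.Nodup → A'.map Prod.snd = A → Eqv f g := by
    rintro A' n rfl
    obtain ⟨B', f', hB, hf⟩ := Term.lift Prod.snd f A' rfl
    obtain ⟨C', g', hC, hg⟩ := Term.lift Prod.snd g A' rfl
    exact Term.lift_eqv Prod.snd A' B' C' n f' g' hB hC f g hf hg h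
  exact key (A.num 0) (A.num_nodup 0) (A.map_num 0)
end

/-- **MDS Coherence**: the functor `G` from MDS to Br is faithful; that is, for all
arrow terms `f, g : A ⊢ B` of MDS, if `Gf = Gg` in Br then `f = g` in MDS. -/
theorem MDS_coherence {P : Type} {A B : Form P} (f g : Term P A B) :
    Term.G f = Term.G g → Eqv f g := by
  exact MDS_coherence' f g
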